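/- arXiv:1001.3344 — 2 statements merged into one kernel-verified Lean document; each statement's English description precedes it below -/
import Mathlib

section
/- Stability of the flow of an ODE driven by a smooth path in rough-path norm (Proposition 4.1): Let 1/3 < γ ≤ 1 and T > 0, and let g ∈ C³(ℝ^d; ℝ^{d×l}) be bounded with bounded derivatives up to order three. Then there exists a nondecreasing function C_T : ℝ → [0,∞), depending only on T, g, γ, d, l, such that for every continuous piecewise continuously differentiable path x : [0,T] → ℝ^l, all 0 ≤ s ≤ t ≤ T and all z, z̃ ∈ ℝ^d: (i) |Φ(z;s,t) − Φ(z̃;s,t)| ≤ C_T(‖x‖_{γ,rough}) |z − z̃|, and (ii) |(Φ(z;s,t) − Φ(z̃;s,t)) − (z − z̃)| ≤ C_T(‖x‖_{γ,rough}) (t−s)^γ |z − z̃|. -/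
open Set MeasureTheory
open scoped ENNReal

noncomputable section

/-- `ℝ^m` with the Euclidean norm. -/
abbrev Vec (m : ℕ) := EuclideanSpace ℝ (Fin m)

/-- Sup "norm" `sup_{t ∈ [a,b]} ‖f t‖` as an extended nonnegative real. -/
noncomputable def supENorm {E : Type*} [NormedAddCommGroup E] (a b : ℝ) (f : ℝ → E) : ℝ≥0∞ :=
  ⨆ t : Icc a b, ENNReal.ofReal ‖f t‖

/-- γ-Hölder seminorm `sup_{a ≤ s < t ≤ b} ‖f t - f s‖/(t-s)^γ` as an extended
nonnegative real. -/
noncomputable def holderENorm {E : Type*} [NormedAddCommGroup E] (γ a b : ℝ) (f : ℝ → E) :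
    ℝ≥0∞ :=
  ⨆ p : {p : ℝ × ℝ // a ≤ p.1 ∧ p.1 < p.2 ∧ p.2 ≤ b},
    ENNReal.ofReal (‖f p.1.2 - f p.1.1‖ / (p.1.2 - p.1.1) ^ γ)

/-- `g` is `C³`, bounded with bounded derivatives up to order three. -/
def IsC3Bounded {E F : Type*} [NormedAddCommGroup E] [NormedSpace ℝ E]
    [NormedAddCommGroup F] [NormedSpace ℝ F] (g : E → F) : Prop :=
  ContDiff ℝ 3 g ∧ ∀ n : ℕ, n ≤ 3 → ∃ B : ℝ, ∀ z : E, ‖iteratedFDeriv ℝ n g z‖ ≤ B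

/-- The vector field `D^{(i)}g^{(j)} = ∑_p g^{(i)}_p ∂_p g^{(j)}`: the derivative of the
`j`-th column of `g` in the direction of the `i`-th column. -/
noncomputable def Dvf (d l : ℕ) (g : Vec d → Vec l →L[ℝ] Vec d) (i j : Fin l)
    (z : Vec d) : Vec d :=
  fderiv ℝ (fun w => g w (EuclideanSpace.single j (1 : ℝ))) z
    (g z (EuclideanSpace.single i (1 : ℝ)))

/-- The vector field `D^{(i)}D^{(j)}g^{(p)}`. -/
noncomputable def DDvf (d l : ℕ) (g : Vec d → Vec l →L[ℝ] Vec d) (i j p : Fin l)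
    (z : Vec d) : Vec d :=
  fderiv ℝ (fun w => Dvf d l g j p w) z (g z (EuclideanSpace.single i (1 : ℝ)))

/-- `x` is continuous on `[0,T]` and piecewise continuously differentiable with (piecewise)
derivative `x'`: there is a partition `0 = τ_0 < ⋯ < τ_N = T` such that `x'` is continuous on
each `[τ_k, τ_{k+1}]` and is the derivative of `x` on each `(τ_k, τ_{k+1})`. -/
def PiecewiseC1 (l : ℕ) (T : ℝ) (x x' : ℝ → Vec l) : Prop :=
  ContinuousOn x (Icc 0 T) ∧
  ∃ (N : ℕ) (τ : ℕ → ℝ), τ 0 = 0 ∧ τ N = T ∧ (∀ k < N, τ k < τ (k + 1)) ∧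
    ∀ k < N, ContinuousOn x' (Icc (τ k) (τ (k + 1))) ∧
      ∀ t ∈ Ioo (τ k) (τ (k + 1)), HasDerivAt x (x' t) t

/-- `y` solves, on `[s,t]`, the ODE `ẏ_u = g(y_u) ẋ_u` with `y_s = z`, in integral form. -/
def OdeSol (d l : ℕ) (g : Vec d → Vec l →L[ℝ] Vec d) (x' : ℝ → Vec l) (s t : ℝ)
    (z : Vec d) (y : ℝ → Vec d) : Prop :=
  y s = z ∧ ∀ u ∈ Icc s t, y u = z + ∫ v in s..u, g (y v) (x' v)

/-- The second-order Taylor (Milstein) numerical flow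
`Ψ(z;s,t) = z + g(z)(x_t - x_s) + ∑_{i,j} (D^{(i)}g^{(j)})(z) ∫_s^t (x^{(i)}_u - x^{(i)}_s) ẋ^{(j)}_u du`. -/
noncomputable def Psi (d l : ℕ) (g : Vec d → Vec l →L[ℝ] Vec d) (x x' : ℝ → Vec l)
    (s t : ℝ) (z : Vec d) : Vec d :=
  z + g z (x t - x s) +
    ∑ i : Fin l, ∑ j : Fin l,
      (∫ u in s..t, (x u i - x s i) * x' u j) • Dvf d l g i j z

/-- The entries of the Lévy area `x²_{st} = ∫_s^t (x_u - x_s) ⊗ ẋ_u du` of a smooth path. -/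
noncomputable def x2Entry (l : ℕ) (x x' : ℝ → Vec l) (s t : ℝ) (i j : Fin l) : ℝ :=
  ∫ u in s..t, (x u i - x s i) * x' u j

/-- Euclidean norm of the Lévy area `x²_{st}` of a smooth path. -/
noncomputable def x2Norm (l : ℕ) (x x' : ℝ → Vec l) (s t : ℝ) : ℝ :=
  Real.sqrt (∑ i : Fin l, ∑ j : Fin l, (x2Entry l x x' s t i j) ^ 2)

/-- The rough-path norm `‖x‖_{γ,rough} = sup_{[0,T]} |x| + γ-Hölder seminorm of x
+ sup_{s<t} |x²_{st}|/(t-s)^{2γ}` of a smooth path. -/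
noncomputable def roughNormSmooth (l : ℕ) (γ T : ℝ) (x x' : ℝ → Vec l) : ℝ :=
  (supENorm 0 T x + holderENorm γ 0 T x +
    ⨆ p : {p : ℝ × ℝ // 0 ≤ p.1 ∧ p.1 < p.2 ∧ p.2 ≤ T},
      ENNReal.ofReal (x2Norm l x x' p.1.1 p.1.2 / (p.1.2 - p.1.1) ^ (2 * γ))).toReal


/-! ### A sewing-type estimate -/

lemma sewing_bound (F : ℝ → ℝ → ℝ) (a b α κ C M K : ℝ) (hκ0 : 0 ≤ κ) (hκ2 : κ < 2)
    (hK0 : 0 ≤ K)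
    (hK : κ * (2 * (K * (1 / 2 : ℝ) ^ α)) + C ≤ K)
    (hM : ∀ s t, a ≤ s → s ≤ t → t ≤ b → F s t ≤ M * (t - s) ^ 2)
    (hF : ∀ s t, a ≤ s → s ≤ t → t ≤ b →
      F s t ≤ κ * (F s ((s + t) / 2) + F ((s + t) / 2) t) + C * (t - s) ^ α)
    (s t : ℝ) (has : a ≤ s) (hst : s ≤ t) (htb : t ≤ b) : F s t ≤ K * (t - s) ^ α := by
  have key : ∀ n : ℕ, ∀ s t, a ≤ s → s ≤ t → t ≤ b →
      F s t ≤ K * (t - s) ^ α + M * (κ / 2) ^ n * (t - s) ^ 2 := by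
    intro n
    induction n with
    | zero =>
      intro s t h1 h2 h3
      have := hM s t h1 h2 h3
      have h4 : 0 ≤ K * (t - s) ^ α := mul_nonneg hK0 (Real.rpow_nonneg (by linarith) _)
      simp only [pow_zero, mul_one]
      linarith
    | succ n ih =>
      intro s t h1 h2 h3
      have e1 := ih s ((s + t) / 2) h1 (by linarith) (by linarith)
      have e2 := ih ((s + t) / 2) t (by linarith) (by linarith) h3
      have e3 := hF s t h1 h2 h3
      have q1 : ((s + t) / 2 - s) = (t - s) * (1 / 2) := by ring
      have q2 : (t - (s + t) / 2) = (t - s) * (1 / 2) := by ring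
      have q3 : ((t - s) * (1 / 2)) ^ α = (t - s) ^ α * (1 / 2 : ℝ) ^ α :=
        Real.mul_rpow (by linarith) (by norm_num)
      rw [q1, q3] at e1
      rw [q2, q3] at e2
      have h4 : 0 ≤ (t - s) ^ α := Real.rpow_nonneg (by linarith) _
      have e4 := mul_le_mul_of_nonneg_left (add_le_add e1 e2) hκ0
      have e5 := mul_le_mul_of_nonneg_right hK h4
      have e6 : M * (κ / 2) ^ (n + 1) * (t - s) ^ 2
        = κ * (2 * (M * (κ / 2) ^ n * ((t - s) * (1 / 2)) ^ 2)) := by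
        rw [pow_succ]; ring
      rw [e6]
      calc F s t ≤ _ := e3
        _ ≤ _ := add_le_add_left e4 _
        _ = (κ * (2 * (K * (1 / 2 : ℝ) ^ α)) + C) * (t - s) ^ α +
            κ * (2 * (M * (κ / 2) ^ n * ((t - s) * (1 / 2)) ^ 2)) := by ring
        _ ≤ _ := by linarith
  have hlim : Filter.Tendsto (fun n : ℕ => K * (t - s) ^ α + M * (κ / 2) ^ n * (t - s) ^ 2)
      Filter.atTop (nhds (K * (t - s) ^ α + M * 0 * (t - s) ^ 2)) := by
    have := tendsto_pow_atTop_nhds_zero_of_lt_one (r := κ / 2) (by linarith) (by linarith)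
    exact ((this.const_mul M).mul_const _).const_add _
  have := ge_of_tendsto' hlim (fun n => key n s t has hst htb)
  simpa using this

/-! ### Core estimate for approximate flows -/

lemma exists_kappa (γ : ℝ) (hγ : 1 / 3 < γ) : ∃ κ : ℝ, 1 < κ ∧ κ < 2 ∧
    κ * (2 * (1 / 2 : ℝ) ^ (3 * γ)) < 1 := by
  have h : 2 * (1 / 2 : ℝ) ^ (3 * γ) < 1 := by
    have : (1 / 2 : ℝ) ^ (3 * γ) < (1 / 2 : ℝ) ^ (1 : ℝ) :=
      Real.rpow_lt_rpow_of_exponent_gt (by norm_num) (by norm_num) (by linarith)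
    rw [Real.rpow_one] at this
    linarith
  have h0 : 0 < 2 * (1 / 2 : ℝ) ^ (3 * γ) := by positivity
  set lam := 2 * (1 / 2 : ℝ) ^ (3 * γ)
  refine ⟨1 + (1 - lam) / 2, by linarith, by linarith, by nlinarith⟩

lemma core_step (γ : ℝ) (hγ : 1 / 3 < γ) (L : ℝ) (hL : 0 ≤ L) :
    ∃ h : ℝ, 0 < h ∧ h ≤ 1 ∧ ∃ K : ℝ, 0 ≤ K ∧
    ∀ (E : Type) [NormedAddCommGroup E] (θ : ℝ → ℝ → E → E) (y w : ℝ → E) (a b M : ℝ),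
      a ≤ b → b - a ≤ h →
      (∀ s t, a ≤ s → s ≤ t → t ≤ b → ∀ p q, ‖θ s t p - θ s t q‖ ≤ L * (t - s) ^ γ * ‖p - q‖) →
      (∀ s t, a ≤ s → s ≤ t → t ≤ b → ∀ p q r r',
        ‖θ s t p - θ s t (p - r) - (θ s t q - θ s t (q - r'))‖ ≤
          L * (t - s) ^ γ * (‖r - r'‖ + ‖r‖ * ‖p - q‖)) →
      (∀ s u t, a ≤ s → s ≤ u → u ≤ t → t ≤ b → ∀ p,
        ‖θ s u p + θ u t (p + θ s u p) - θ s t p‖ ≤ L * (t - s) ^ (3 * γ)) →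
      (∀ s u t, a ≤ s → s ≤ u → u ≤ t → t ≤ b → ∀ p q,
        ‖(θ s u p + θ u t (p + θ s u p) - θ s t p) -
          (θ s u q + θ u t (q + θ s u q) - θ s t q)‖ ≤ L * (t - s) ^ (3 * γ) * ‖p - q‖) →
      (∀ s t, a ≤ s → s ≤ t → t ≤ b → ‖y t - y s - θ s t (y s)‖ ≤ M * (t - s) ^ 2) →
      (∀ s t, a ≤ s → s ≤ t → t ≤ b → ‖w t - w s - θ s t (w s)‖ ≤ M * (t - s) ^ 2) →
      ContinuousOn (fun u => y u - w u) (Icc a b) →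
      ‖y b - w b‖ ≤ 2 * ‖y a - w a‖ ∧
      ‖(y b - w b) - (y a - w a)‖ ≤ K * (b - a) ^ γ * ‖y a - w a‖ := by
  obtain ⟨κ, hκ1, hκ2, hκ⟩ := exists_kappa γ hγ
  set lam := 2 * (1 / 2 : ℝ) ^ (3 * γ) with hlam
  have hden : 0 < 1 - κ * lam := by linarith
  obtain ⟨K1, hK1⟩ : ∃ K1, K1 = L / (1 - κ * lam) := ⟨_, rfl⟩
  obtain ⟨K2, hK2⟩ : ∃ K2, K2 = (L * K1 + L) / (1 - κ * lam) := ⟨_, rfl⟩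
  have hK1n : 0 ≤ K1 := by rw [hK1]; positivity
  have hK2n : 0 ≤ K2 := by rw [hK2]; positivity
  -- choice of h
  obtain ⟨h, h0, h1, hh1, hh2⟩ : ∃ h : ℝ, 0 < h ∧ h ≤ 1 ∧ L * h ^ γ ≤ κ - 1 ∧
      (L + K2) * h ^ γ ≤ 1 / 2 := by
    have hγ0 : 0 < γ := by linarith
    have hc : Filter.Tendsto (fun h : ℝ => h ^ γ) (nhdsWithin 0 (Ioi 0)) (nhds 0) := by
      have := (Real.continuousAt_rpow_const 0 γ (Or.inr hγ0.le)).tendsto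
      rw [Real.zero_rpow hγ0.ne'] at this
      exact this.mono_left nhdsWithin_le_nhds
    have e1 : ∀ᶠ h : ℝ in nhdsWithin 0 (Ioi 0), L * h ^ γ < κ - 1 := by
      have := hc.const_mul L
      rw [mul_zero] at this
      exact this.eventually_lt_const (by linarith)
    have e2 : ∀ᶠ h : ℝ in nhdsWithin 0 (Ioi 0), (L + K2) * h ^ γ < 1 / 2 := by
      have := hc.const_mul (L + K2)
      rw [mul_zero] at this
      exact this.eventually_lt_const (by norm_num)
    have e3 : ∀ᶠ h : ℝ in nhdsWithin 0 (Ioi 0), h < 1 :=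
      nhdsWithin_le_nhds (Iio_mem_nhds (by norm_num))
    have e4 : ∀ᶠ h : ℝ in nhdsWithin 0 (Ioi 0), 0 < h := self_mem_nhdsWithin
    obtain ⟨h, a1, a2, a3, a4⟩ := (e1.and (e2.and (e3.and e4))).exists
    exact ⟨h, a4, a3.le, a1.le, a2.le⟩
  refine ⟨h, h0, h1, 2 * (L + K2), by positivity, ?_⟩
  intro E _ θ y w a b M hab hbh H1 H2 H3 H4 Hy Hw hcont
  have hγ0 : 0 < γ := by linarith
  -- elementary power facts
  have pow_h : ∀ s t, a ≤ s → s ≤ t → t ≤ b → (t - s) ^ γ ≤ h ^ γ := fun s t h1 h2 h3 =>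
    Real.rpow_le_rpow (by linarith) (by linarith) hγ0.le
  have pow_1 : ∀ s t, a ≤ s → s ≤ t → t ≤ b → (t - s) ^ γ ≤ 1 := fun s t h1 h2 h3 =>
    Real.rpow_le_one (by linarith) (by linarith) hγ0.le
  have pow_0 : ∀ s t : ℝ, s ≤ t → 0 ≤ (t - s) ^ γ := fun s t h2 => Real.rpow_nonneg (by linarith) _
  have pow3_0 : ∀ s t : ℝ, s ≤ t → 0 ≤ (t - s) ^ (3 * γ) :=
    fun s t h2 => Real.rpow_nonneg (by linarith) _
  -- one path remainder estimate
  have rem : ∀ y : ℝ → E,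
      (∀ s t, a ≤ s → s ≤ t → t ≤ b → ‖y t - y s - θ s t (y s)‖ ≤ M * (t - s) ^ 2) →
      ∀ s t, a ≤ s → s ≤ t → t ≤ b → ‖y t - y s - θ s t (y s)‖ ≤ K1 * (t - s) ^ (3 * γ) := by
    intro y Hy
    refine sewing_bound (fun s t => ‖y t - y s - θ s t (y s)‖) a b (3 * γ) κ L M K1
      (by linarith) hκ2 hK1n ?_ Hy ?_
    · have : K1 * (1 - κ * lam) = L := by rw [hK1]; field_simp
      rw [hlam] at this
      nlinarith
    · intro s t h1 h2 h3
      set u := (s + t) / 2 with hu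
      have hsu : s ≤ u := by rw [hu]; linarith
      have hut : u ≤ t := by rw [hu]; linarith
      set R := y u - y s - θ s u (y s) with hR
      have id1 : y t - y s - θ s t (y s) = (y t - y u - θ u t (y u)) + R +
          (θ u t (y u) - θ u t (y u - R)) +
          (θ s u (y s) + θ u t (y s + θ s u (y s)) - θ s t (y s)) := by
        have : y u - R = y s + θ s u (y s) := by rw [hR]; abel
        rw [this, hR]; abel
      have b1 := H1 u t (by linarith) hut h3 (y u) (y u - R)
      rw [sub_sub_cancel] at b1
      have b2 := H3 s u t h1 hsu hut h3 (y s)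
      have b3 : L * (t - u) ^ γ * ‖R‖ ≤ (κ - 1) * ‖R‖ :=
        mul_le_mul_of_nonneg_right ((mul_le_mul_of_nonneg_left
          (pow_h u t (by linarith) hut h3) hL).trans hh1) (norm_nonneg _)
      have n1 : ‖y t - y s - θ s t (y s)‖ ≤ ‖y t - y u - θ u t (y u)‖ + ‖R‖ +
          ‖θ u t (y u) - θ u t (y u - R)‖ +
          ‖θ s u (y s) + θ u t (y s + θ s u (y s)) - θ s t (y s)‖ := by
        rw [id1]; exact norm_add₄_le
      have n2 : 0 ≤ (κ - 1) * ‖y t - y u - θ u t (y u)‖ :=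
        mul_nonneg (by linarith) (norm_nonneg _)
      show ‖y t - y s - θ s t (y s)‖ ≤ κ * (‖R‖ + ‖y t - y u - θ u t (y u)‖) + _
      linarith
  have Ry := rem y Hy
  have Rw := rem w Hw
  -- supremum of the difference
  obtain ⟨c, hc, hcmax⟩ := isCompact_Icc.exists_isMaxOn (nonempty_Icc.2 hab) hcont.norm
  set D := ‖y c - w c‖ with hD
  have hDm : ∀ u, a ≤ u → u ≤ b → ‖y u - w u‖ ≤ D := fun u h1 h2 => hcmax ⟨h1, h2⟩
  have hD0 : 0 ≤ D := norm_nonneg _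
  have Rd : ∀ s t, a ≤ s → s ≤ t → t ≤ b →
      ‖(y t - y s - θ s t (y s)) - (w t - w s - θ s t (w s))‖ ≤ (K2 * D) * (t - s) ^ (3 * γ) := by
    refine sewing_bound (fun s t => ‖(y t - y s - θ s t (y s)) - (w t - w s - θ s t (w s))‖)
      a b (3 * γ) κ ((L * K1 + L) * D) (2 * M) (K2 * D)
      (by linarith) hκ2 (by positivity) ?_ ?_ ?_
    · have : K2 * (1 - κ * lam) = L * K1 + L := by rw [hK2]; field_simp
      rw [← this, hlam]
      apply le_of_eq; ring
    · intro s t h1 h2 h3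
      have := norm_sub_le (y t - y s - θ s t (y s)) (w t - w s - θ s t (w s))
      have := Hy s t h1 h2 h3
      have := Hw s t h1 h2 h3
      show ‖(y t - y s - θ s t (y s)) - (w t - w s - θ s t (w s))‖ ≤ _
      linarith
    · intro s t h1 h2 h3
      set u := (s + t) / 2 with hu
      have hsu : s ≤ u := by rw [hu]; linarith
      have hut : u ≤ t := by rw [hu]; linarith
      have b4 := Ry s u h1 hsu (by linarith)
      set R := y u - y s - θ s u (y s) with hR
      set R' := w u - w s - θ s u (w s) with hR'
      have id1 : (y t - y s - θ s t (y s)) - (w t - w s - θ s t (w s)) =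
          ((y t - y u - θ u t (y u)) - (w t - w u - θ u t (w u))) + (R - R') +
          (θ u t (y u) - θ u t (y u - R) - (θ u t (w u) - θ u t (w u - R'))) +
          ((θ s u (y s) + θ u t (y s + θ s u (y s)) - θ s t (y s)) -
           (θ s u (w s) + θ u t (w s + θ s u (w s)) - θ s t (w s))) := by
        have e1 : y u - R = y s + θ s u (y s) := by rw [hR]; abel
        have e2 : w u - R' = w s + θ s u (w s) := by rw [hR']; abel
        rw [e1, e2, hR, hR']; abel
      have b1 := H2 u t (by linarith) hut h3 (y u) (w u) R R'
      have b2 := H4 s u t h1 hsu hut h3 (y s) (w s)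
      have b3 : L * (t - u) ^ γ * ‖R - R'‖ ≤ (κ - 1) * ‖R - R'‖ :=
        mul_le_mul_of_nonneg_right ((mul_le_mul_of_nonneg_left
          (pow_h u t (by linarith) hut h3) hL).trans hh1) (norm_nonneg _)
      have b5 : ‖R‖ ≤ K1 * (t - s) ^ (3 * γ) := b4.trans
        (mul_le_mul_of_nonneg_left
          (Real.rpow_le_rpow (by linarith) (by linarith) (by linarith)) hK1n)
      have b6 : L * (t - u) ^ γ * (‖R‖ * ‖y u - w u‖) ≤
          L * (K1 * (t - s) ^ (3 * γ) * D) := by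
        have i1 : L * (t - u) ^ γ ≤ L := by
          have := mul_le_mul_of_nonneg_left (pow_1 u t (by linarith) hut h3) hL
          linarith
        have i2 : ‖R‖ * ‖y u - w u‖ ≤ K1 * (t - s) ^ (3 * γ) * D :=
          mul_le_mul b5 (hDm u (by linarith) (by linarith)) (norm_nonneg _)
            (mul_nonneg hK1n (pow3_0 s t h2))
        exact mul_le_mul i1 i2 (by positivity) hL
      have b7 : L * (t - s) ^ (3 * γ) * ‖y s - w s‖ ≤ L * (t - s) ^ (3 * γ) * D :=
        mul_le_mul_of_nonneg_left (hDm s h1 (by linarith)) (mul_nonneg hL (pow3_0 s t h2))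
      have n1 := norm_add₄_le
        (a := (y t - y u - θ u t (y u)) - (w t - w u - θ u t (w u))) (b := R - R')
        (c := θ u t (y u) - θ u t (y u - R) - (θ u t (w u) - θ u t (w u - R')))
        (d := (θ s u (y s) + θ u t (y s + θ s u (y s)) - θ s t (y s)) -
           (θ s u (w s) + θ u t (w s + θ s u (w s)) - θ s t (w s)))
      rw [← id1] at n1
      have n2 : 0 ≤ (κ - 1) * ‖(y t - y u - θ u t (y u)) - (w t - w u - θ u t (w u))‖ :=
        mul_nonneg (by linarith) (norm_nonneg _)
      show ‖(y t - y s - θ s t (y s)) - (w t - w s - θ s t (w s))‖ ≤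
        κ * (‖R - R'‖ + ‖(y t - y u - θ u t (y u)) - (w t - w u - θ u t (w u))‖) + _
      rw [mul_add] at b1
      linarith
  -- increments of the difference
  have inc : ∀ t, a ≤ t → t ≤ b →
      ‖(y t - w t) - (y a - w a)‖ ≤ (L + K2) * (t - a) ^ γ * D := by
    intro t h1 h2
    have e1 := Rd a t le_rfl h1 h2
    have e2 := H1 a t le_rfl h1 h2 (y a) (w a)
    have e3 : (y t - w t) - (y a - w a) =
        ((y t - y a - θ a t (y a)) - (w t - w a - θ a t (w a))) +
        (θ a t (y a) - θ a t (w a)) := by abel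
    have e4 : (t - a) ^ (3 * γ) ≤ (t - a) ^ γ := by
      rcases eq_or_lt_of_le h1 with h | h
      · rw [← h, sub_self, Real.zero_rpow hγ0.ne', Real.zero_rpow (by linarith)]
      · exact Real.rpow_le_rpow_of_exponent_ge (by linarith) (by linarith) (by linarith)
    have e5 : L * (t - a) ^ γ * ‖y a - w a‖ ≤ L * (t - a) ^ γ * D :=
      mul_le_mul_of_nonneg_left (hDm a le_rfl hab) (mul_nonneg hL (pow_0 a t h1))
    have e6 : K2 * D * (t - a) ^ (3 * γ) ≤ K2 * D * (t - a) ^ γ :=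
      mul_le_mul_of_nonneg_left e4 (by positivity)
    rw [e3]
    refine (norm_add_le _ _).trans ?_
    linarith
  have hD2 : D ≤ 2 * ‖y a - w a‖ := by
    have e1 := inc c hc.1 hc.2
    have e2 : (L + K2) * (c - a) ^ γ * D ≤ 1 / 2 * D :=
      mul_le_mul_of_nonneg_right ((mul_le_mul_of_nonneg_left
          (pow_h a c le_rfl hc.1 hc.2) (by positivity)).trans hh2) hD0
    have e3 : D ≤ ‖(y c - w c) - (y a - w a)‖ + ‖y a - w a‖ := by
      have := norm_add_le ((y c - w c) - (y a - w a)) (y a - w a)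
      rwa [sub_add_cancel] at this
    linarith
  refine ⟨(hDm b hab le_rfl).trans hD2, (inc b hab le_rfl).trans ?_⟩
  have := mul_le_mul_of_nonneg_left hD2 (mul_nonneg (add_nonneg hL hK2n) (pow_0 a b hab))
  linarith

/-! ### Mean value estimates -/

/-- Boundedness, Lipschitz and second-order increment estimate with a common constant. -/
structure NiceFun {E F : Type} [NormedAddCommGroup E] [NormedAddCommGroup F]
    (B : ℝ) (f : E → F) : Prop where
  bdd : ∀ p, ‖f p‖ ≤ B
  lip : ∀ p q, ‖f p - f q‖ ≤ B * ‖p - q‖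
  four : ∀ p q r r', ‖f p - f (p - r) - (f q - f (q - r'))‖ ≤ B * (‖r - r'‖ + ‖r‖ * ‖p - q‖)

section MV
set_option maxSynthPendingDepth 3
variable {E F : Type} [NormedAddCommGroup E] [NormedSpace ℝ E]
  [NormedAddCommGroup F] [NormedSpace ℝ F]

lemma lip_of_fderiv {f : E → F} {B : ℝ} (hf : Differentiable ℝ f)
    (hB : ∀ p, ‖fderiv ℝ f p‖ ≤ B) (p q : E) : ‖f p - f q‖ ≤ B * ‖p - q‖ :=
  convex_univ.norm_image_sub_le_of_norm_fderiv_le (fun x _ => hf x) (fun x _ => hB x)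
    (mem_univ q) (mem_univ p)

lemma nice_of_fderiv {f : E → F} {B : ℝ} (hf : Differentiable ℝ f)
    (hf2 : Differentiable ℝ (fderiv ℝ f)) (h0 : ∀ p, ‖f p‖ ≤ B)
    (h1 : ∀ p, ‖fderiv ℝ f p‖ ≤ B) (h2 : ∀ p, ‖fderiv ℝ (fderiv ℝ f) p‖ ≤ B) :
    NiceFun B f := by
  have lip := lip_of_fderiv hf h1
  refine ⟨h0, lip, ?_⟩
  intro p q r r'
  have e1 : ∀ z, HasFDerivAt (fun z => f z - f (z - r)) (fderiv ℝ f z - fderiv ℝ f (z - r)) z := by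
    intro z
    refine (hf z).hasFDerivAt.sub ?_
    have := (hf (z - r)).hasFDerivAt.comp z ((hasFDerivAt_id z).sub_const r)
    simpa [Function.comp_def] using this
  have e2 : ‖(f p - f (p - r)) - (f q - f (q - r))‖ ≤ (B * ‖r‖) * ‖p - q‖ := by
    refine lip_of_fderiv (f := fun z => f z - f (z - r)) (fun z => (e1 z).differentiableAt)
      ?_ p q
    intro z
    rw [(e1 z).fderiv]
    simpa using lip_of_fderiv hf2 h2 z (z - r)
  have e3 := lip (q - r') (q - r)
  have e4 : q - r' - (q - r) = r - r' := by abel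
  rw [e4] at e3
  have e5 : f p - f (p - r) - (f q - f (q - r')) =
    ((f p - f (p - r)) - (f q - f (q - r))) + (f (q - r') - f (q - r)) := by abel
  rw [e5]
  refine (norm_add_le _ _).trans ?_
  linarith

/-- derivative of the Taylor remainder in the increment -/
lemma taylor_incr {f : E → F} {B : ℝ} (hf : Differentiable ℝ f)
    (hf2 : Differentiable ℝ (fderiv ℝ f)) (hB : 0 ≤ B)
    (h2 : ∀ p, ‖fderiv ℝ (fderiv ℝ f) p‖ ≤ B) (a v w : E) :
    ‖(f (a + v) - f a - fderiv ℝ f a v) - (f (a + w) - f a - fderiv ℝ f a w)‖ ≤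
      B * (‖v‖ + ‖w‖) * ‖v - w‖ := by
  have e1 : ∀ z, HasFDerivAt (fun z => f (a + z) - f a - fderiv ℝ f a z)
      (fderiv ℝ f (a + z) - fderiv ℝ f a) z := by
    intro z
    refine HasFDerivAt.sub ?_ (fderiv ℝ f a).hasFDerivAt
    refine HasFDerivAt.sub_const _ ?_
    have := (hf (a + z)).hasFDerivAt.comp z ((hasFDerivAt_id z).const_add a)
    simpa [Function.comp_def] using this
  refine (convex_closedBall (0 : E) (‖v‖ + ‖w‖)).norm_image_sub_le_of_norm_hasFDerivWithin_le
    (f := fun z => f (a + z) - f a - fderiv ℝ f a z)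
    (fun z _ => (e1 z).hasFDerivWithinAt) ?_ ?_ ?_
  · intro z hz
    have h3 : ‖z‖ ≤ ‖v‖ + ‖w‖ := by simpa using hz
    have h4 := lip_of_fderiv hf2 h2 (a + z) a
    rw [add_sub_cancel_left] at h4
    exact h4.trans (mul_le_mul_of_nonneg_left h3 hB)
  · simp
  · simp

lemma taylor_bound {f : E → F} {B : ℝ} (hf : Differentiable ℝ f)
    (hf2 : Differentiable ℝ (fderiv ℝ f)) (hB : 0 ≤ B)
    (h2 : ∀ p, ‖fderiv ℝ (fderiv ℝ f) p‖ ≤ B) (a v : E) :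
    ‖f (a + v) - f a - fderiv ℝ f a v‖ ≤ B * ‖v‖ ^ 2 := by
  have := taylor_incr hf hf2 hB h2 a v 0
  simp only [add_zero, sub_self, map_zero, sub_zero, norm_zero] at this
  calc _ ≤ _ := this
    _ = _ := by ring

lemma taylor_base {f : E → F} {B : ℝ} (hf : Differentiable ℝ f)
    (hf2 : Differentiable ℝ (fderiv ℝ f)) (hf3 : Differentiable ℝ (fderiv ℝ (fderiv ℝ f)))
    (hB : 0 ≤ B) (h3 : ∀ p, ‖fderiv ℝ (fderiv ℝ (fderiv ℝ f)) p‖ ≤ B) (a b v : E) :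
    ‖(f (a + v) - f a - fderiv ℝ f a v) - (f (b + v) - f b - fderiv ℝ f b v)‖ ≤
      B * ‖v‖ ^ 2 * ‖a - b‖ := by
  have symm : ∀ z, ∀ u : E, fderiv ℝ (fderiv ℝ f) z u v = fderiv ℝ (fderiv ℝ f) z v u := by
    intro z u
    exact second_derivative_symmetric (fun y => (hf y).hasFDerivAt) (hf2 z).hasFDerivAt u v
  have e1 : ∀ z, HasFDerivAt (fun z => f (z + v) - f z - fderiv ℝ f z v)
      (fderiv ℝ f (z + v) - fderiv ℝ f z - fderiv ℝ (fderiv ℝ f) z v) z := by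
    intro z
    have a1 : HasFDerivAt (fun z => fderiv ℝ f z v) (fderiv ℝ (fderiv ℝ f) z v) z := by
      have := (hf2 z).hasFDerivAt.clm_apply (hasFDerivAt_const v z)
      refine this.congr_fderiv ?_
      ext u
      simp [symm]
    refine HasFDerivAt.sub (HasFDerivAt.sub ?_ (hf z).hasFDerivAt) a1
    have := (hf (z + v)).hasFDerivAt.comp z ((hasFDerivAt_id z).add_const v)
    simpa [Function.comp_def] using this
  refine lip_of_fderiv (f := fun z => f (z + v) - f z - fderiv ℝ f z v)
    (fun z => (e1 z).differentiableAt) ?_ a b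
  intro z
  rw [(e1 z).fderiv]
  exact taylor_bound hf2 hf3 hB h3 z v
end MV

/-! ### Estimates on the Milstein increment -/
section Alg
set_option maxSynthPendingDepth 3
variable {E V : Type} [NormedAddCommGroup E] [NormedSpace ℝ E]
  [NormedAddCommGroup V] [NormedSpace ℝ V]

/-- second-order vector field -/
def GG (g : E → V →L[ℝ] E) (z : E) : V →L[ℝ] V →L[ℝ] E := (fderiv ℝ g z).comp (g z)

/-- Milstein increment -/
def tht (g : E → V →L[ℝ] E) (v : V) (c : (V →L[ℝ] V →L[ℝ] E) →L[ℝ] E) (z : E) : E :=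
  g z v + c (GG g z)

structure GoodG (B : ℝ) (g : E → V →L[ℝ] E) : Prop where
  pos : 0 ≤ B
  d1 : Differentiable ℝ g
  d2 : Differentiable ℝ (fderiv ℝ g)
  d3 : Differentiable ℝ (fderiv ℝ (fderiv ℝ g))
  b0 : ∀ p, ‖g p‖ ≤ B
  b1 : ∀ p, ‖fderiv ℝ g p‖ ≤ B
  b2 : ∀ p, ‖fderiv ℝ (fderiv ℝ g) p‖ ≤ B
  b3 : ∀ p, ‖fderiv ℝ (fderiv ℝ (fderiv ℝ g)) p‖ ≤ B
  nG : NiceFun B (GG g)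

lemma GoodG.ng {B : ℝ} {g : E → V →L[ℝ] E} (hg : GoodG B g) : NiceFun B g :=
  nice_of_fderiv hg.d1 hg.d2 hg.b0 hg.b1 hg.b2

lemma tht_nice {B r q : ℝ} {g : E → V →L[ℝ] E} (hg : GoodG B g) (hr : 0 ≤ r)
    (hq0 : 0 ≤ q) (hq1 : q ≤ 1) {v : V} {c : (V →L[ℝ] V →L[ℝ] E) →L[ℝ] E}
    (hv : ‖v‖ ≤ r * q) (hc : ‖c‖ ≤ r * q ^ 2) : NiceFun (2 * B * r * q) (tht g v c) := by
  have hc' : ‖c‖ ≤ r * q := hc.trans (mul_le_mul_of_nonneg_left (by nlinarith) hr)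
  have hB := hg.pos
  have key : ∀ (A : V →L[ℝ] E) (A' : V →L[ℝ] V →L[ℝ] E) (m : ℝ), ‖A‖ ≤ B * m → ‖A'‖ ≤ B * m →
      ‖A v + c A'‖ ≤ 2 * B * r * q * m := by
    intro A A' m h1 h2
    have i1 : ‖A v‖ ≤ (B * m) * (r * q) :=
      (A.le_opNorm v).trans (mul_le_mul h1 hv (norm_nonneg _) ((norm_nonneg _).trans h1))
    have i2 : ‖c A'‖ ≤ (r * q) * (B * m) :=
      (c.le_opNorm A').trans (mul_le_mul hc' h2 (norm_nonneg _) (by positivity))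
    refine (norm_add_le _ _).trans ?_
    linarith
  refine ⟨fun p => ?_, fun p p' => ?_, fun p p' s s' => ?_⟩
  · have := key (g p) (GG g p) 1 (by simpa using hg.b0 p) (by simpa using hg.nG.bdd p)
    simpa [tht] using this
  · have := key _ _ _ (hg.ng.lip p p') (hg.nG.lip p p')
    refine le_trans (le_of_eq ?_) this
    congr 1
    simp only [tht, map_sub, _root_.sub_apply]
    abel
  · have := key _ _ _ (hg.ng.four p p' s s') (hg.nG.four p p' s s')
    refine le_trans (le_of_eq ?_) this
    congr 1
    simp only [tht, map_sub, _root_.sub_apply]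
    abel

lemma defect_eq (g : E → V →L[ℝ] E) (v1 v2 : V)
    (c1 c2 c3 : (V →L[ℝ] V →L[ℝ] E) →L[ℝ] E)
    (chen : ∀ A, c3 A = c1 A + c2 A + A v1 v2) (z : E) :
    tht g v1 c1 z + tht g v2 c2 (z + tht g v1 c1 z) - tht g (v1 + v2) c3 z =
      (g (z + tht g v1 c1 z) - g z - fderiv ℝ g z (tht g v1 c1 z)) v2 +
      fderiv ℝ g z (c1 (GG g z)) v2 +
      c2 (GG g (z + tht g v1 c1 z) - GG g z) := by
  have e1 : fderiv ℝ g z (tht g v1 c1 z) = GG g z v1 + fderiv ℝ g z (c1 (GG g z)) := by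
    simp [tht, GG]
  rw [e1]
  set z' := z + tht g v1 c1 z
  simp only [tht, map_sub, map_add, _root_.sub_apply,
    _root_.add_apply, chen]
  abel

lemma defect_bounds {B r : ℝ} {g : E → V →L[ℝ] E} (hg : GoodG B g) (hr : 0 ≤ r) :
    ∃ L : ℝ, 0 ≤ L ∧ 2 * B * r ≤ L ∧ ∀ q : ℝ, 0 ≤ q → q ≤ 1 → ∀ (v1 v2 : V)
    (c1 c2 c3 : (V →L[ℝ] V →L[ℝ] E) →L[ℝ] E), ‖v1‖ ≤ r * q → ‖v2‖ ≤ r * q →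
    ‖c1‖ ≤ r * q ^ 2 → ‖c2‖ ≤ r * q ^ 2 → (∀ A, c3 A = c1 A + c2 A + A v1 v2) →
    (∀ z, ‖tht g v1 c1 z + tht g v2 c2 (z + tht g v1 c1 z) - tht g (v1 + v2) c3 z‖
      ≤ L * q ^ 3) ∧
    (∀ z w, ‖(tht g v1 c1 z + tht g v2 c2 (z + tht g v1 c1 z) - tht g (v1 + v2) c3 z) -
      (tht g v1 c1 w + tht g v2 c2 (w + tht g v1 c1 w) - tht g (v1 + v2) c3 w)‖
      ≤ L * q ^ 3 * ‖z - w‖) := by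
  have hB := hg.pos
  obtain ⟨M, hM⟩ : ∃ M, M = 2 * B * r := ⟨_, rfl⟩
  have hM0 : 0 ≤ M := by rw [hM]; positivity
  refine ⟨3 * B * M ^ 2 * r + 2 * B ^ 2 * r ^ 2 + r * B * M * (2 + M) + M,
    by positivity, by rw [← hM]; linarith [show 0 ≤ 3 * B * M ^ 2 * r + 2 * B ^ 2 * r ^ 2 + r * B * M * (2 + M) by positivity], ?_⟩
  intro q hq0 hq1 v1 v2 c1 c2 c3 hv1 hv2 hc1 hc2 chen
  have nt := tht_nice hg hr hq0 hq1 hv1 hc1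
  rw [← hM] at nt
  set θ := tht g v1 c1 with hθ
  have ev : ∀ (A : V →L[ℝ] E) (m : ℝ), ‖A‖ ≤ m → ‖A v2‖ ≤ m * (r * q) := fun A m h =>
    (A.le_opNorm v2).trans (mul_le_mul h hv2 (norm_nonneg _) ((norm_nonneg _).trans h))
  have ec : ∀ (A : V →L[ℝ] V →L[ℝ] E) (m : ℝ), ‖A‖ ≤ m → ‖c2 A‖ ≤ (r * q ^ 2) * m :=
    fun A m h => (c2.le_opNorm A).trans (mul_le_mul hc2 h (norm_nonneg _) (by positivity))
  have ec1 : ∀ (A : V →L[ℝ] V →L[ℝ] E) (m : ℝ), ‖A‖ ≤ m → ‖c1 A‖ ≤ (r * q ^ 2) * m :=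
    fun A m h => (c1.le_opNorm A).trans (mul_le_mul hc1 h (norm_nonneg _) (by positivity))
  constructor
  · intro z
    rw [defect_eq g v1 v2 c1 c2 c3 chen z, ← hθ]
    have t1 : ‖g (z + θ z) - g z - fderiv ℝ g z (θ z)‖ ≤ B * (M * q) ^ 2 :=
      (taylor_bound hg.d1 hg.d2 hB hg.b2 z (θ z)).trans
        (mul_le_mul_of_nonneg_left (pow_le_pow_left₀ (norm_nonneg _) (nt.bdd z) 2) hB)
    have t2 : ‖fderiv ℝ g z (c1 (GG g z))‖ ≤ B * (r * q ^ 2 * B) :=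
      ((fderiv ℝ g z).le_opNorm _).trans
        (mul_le_mul (hg.b1 z) (ec1 _ _ (hg.nG.bdd z)) (norm_nonneg _) hB)
    have t3 : ‖GG g (z + θ z) - GG g z‖ ≤ B * (M * q) := by
      have := hg.nG.lip (z + θ z) z
      rw [add_sub_cancel_left] at this
      exact this.trans (mul_le_mul_of_nonneg_left (nt.bdd z) hB)
    refine norm_add₃_le.trans ?_
    have s1 := ev _ _ t1
    have s2 := ev _ _ t2
    have s3 := ec _ _ t3
    have : 0 ≤ q ^ 3 * (2 * B * M ^ 2 * r + B ^ 2 * r ^ 2 + r * B * M * (1 + M) + M) := by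
      positivity
    linarith
  · intro z w
    rw [defect_eq g v1 v2 c1 c2 c3 chen z, defect_eq g v1 v2 c1 c2 c3 chen w, ← hθ]
    have id1 : ∀ a b c a' b' c' : E, (a + b + c) - (a' + b' + c') =
      (a - a') + (b - b') + (c - c') := by intros; abel
    rw [id1, ← _root_.sub_apply, ← _root_.sub_apply, ← map_sub]
    set N := ‖z - w‖ with hN
    have hN0 : 0 ≤ N := norm_nonneg _
    have lt : ‖θ z - θ w‖ ≤ M * q * N := nt.lip z w
    have t1 : ‖(g (z + θ z) - g z - fderiv ℝ g z (θ z)) -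
        (g (w + θ w) - g w - fderiv ℝ g w (θ w))‖ ≤ 3 * B * M ^ 2 * q ^ 2 * N := by
      have a1 := taylor_base hg.d1 hg.d2 hg.d3 hB hg.b3 z w (θ z)
      have a2 := taylor_incr hg.d1 hg.d2 hB hg.b2 w (θ z) (θ w)
      have a3 : B * ‖θ z‖ ^ 2 * ‖z - w‖ ≤ B * (M * q) ^ 2 * N :=
        mul_le_mul_of_nonneg_right
        (mul_le_mul_of_nonneg_left (pow_le_pow_left₀ (norm_nonneg _) (nt.bdd z) 2) hB) hN0
      have a4 : B * (‖θ z‖ + ‖θ w‖) * ‖θ z - θ w‖ ≤ B * (M * q + M * q) * (M * q * N) :=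
        mul_le_mul (mul_le_mul_of_nonneg_left (add_le_add (nt.bdd z) (nt.bdd w)) hB) lt
          (norm_nonneg _) (by positivity)
      have a5 := norm_sub_le_norm_sub_add_norm_sub
        (g (z + θ z) - g z - fderiv ℝ g z (θ z))
        (g (w + θ z) - g w - fderiv ℝ g w (θ z))
        (g (w + θ w) - g w - fderiv ℝ g w (θ w))
      linarith
    have t2 : ‖fderiv ℝ g z (c1 (GG g z)) - fderiv ℝ g w (c1 (GG g w))‖ ≤
        2 * B ^ 2 * r * q ^ 2 * N := by
      have a1 : fderiv ℝ g z (c1 (GG g z)) - fderiv ℝ g w (c1 (GG g w)) =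
        (fderiv ℝ g z - fderiv ℝ g w) (c1 (GG g z)) + fderiv ℝ g w (c1 (GG g z - GG g w)) := by
        simp only [map_sub, _root_.sub_apply]; abel
      have a2 : ‖(fderiv ℝ g z - fderiv ℝ g w) (c1 (GG g z))‖ ≤ (B * N) * (r * q ^ 2 * B) :=
        (ContinuousLinearMap.le_opNorm _ _).trans
        (mul_le_mul (lip_of_fderiv hg.d2 hg.b2 z w) (ec1 _ _ (hg.nG.bdd z)) (norm_nonneg _)
          (by positivity))
      have a3 : ‖fderiv ℝ g w (c1 (GG g z - GG g w))‖ ≤ B * (r * q ^ 2 * (B * N)) :=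
        (ContinuousLinearMap.le_opNorm _ _).trans
        (mul_le_mul (hg.b1 w) (ec1 _ _ (hg.nG.lip z w)) (norm_nonneg _) hB)
      rw [a1]
      refine (norm_add_le _ _).trans ?_
      linarith
    have t3 : ‖GG g (z + θ z) - GG g z - (GG g (w + θ w) - GG g w)‖ ≤
        B * M * (2 + M) * q * N := by
      have a1 := hg.nG.four (z + θ z) (w + θ w) (θ z) (θ w)
      rw [add_sub_cancel_right, add_sub_cancel_right] at a1
      have a2 : ‖z + θ z - (w + θ w)‖ ≤ N + M * N := by
        have : z + θ z - (w + θ w) = (z - w) + (θ z - θ w) := by abel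
        rw [this]
        refine (norm_add_le _ _).trans (add_le_add le_rfl (lt.trans ?_))
        have : M * N * q ≤ M * N := mul_le_of_le_one_right (by positivity) hq1
        linarith
      have a3 : ‖θ z‖ * ‖z + θ z - (w + θ w)‖ ≤ (M * q) * (N + M * N) :=
        mul_le_mul (nt.bdd z) a2 (norm_nonneg _) (by positivity)
      have := mul_le_mul_of_nonneg_left (add_le_add lt a3) hB
      linarith
    refine norm_add₃_le.trans ?_
    have s1 := ev _ _ t1
    have s2 := ev _ _ t2
    have s3 := ec _ _ t3
    have : 0 ≤ M * q ^ 3 * N := by positivity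
    linarith
end Alg

/-! ### Regularity of the vector field -/
section Reg
set_option maxSynthPendingDepth 3
variable {E V : Type} [NormedAddCommGroup E] [NormedSpace ℝ E]
  [NormedAddCommGroup V] [NormedSpace ℝ V]

lemma goodG_of_C3 {g : E → V →L[ℝ] E} (hg : IsC3Bounded g) : ∃ B, GoodG B g := by
  obtain ⟨hC, hb⟩ := hg
  obtain ⟨B0, h0⟩ := hb 0 (by norm_num)
  obtain ⟨B1, h1⟩ := hb 1 (by norm_num)
  obtain ⟨B2, h2⟩ := hb 2 (by norm_num)
  obtain ⟨B3, h3⟩ := hb 3 (by norm_num)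
  obtain ⟨B, hB⟩ : ∃ B, B = |B0| + |B1| + |B2| + |B3| := ⟨_, rfl⟩
  have n0 := abs_nonneg B0
  have n1 := abs_nonneg B1
  have n2 := abs_nonneg B2
  have n3 := abs_nonneg B3
  have hB0 : 0 ≤ B := by rw [hB]; positivity
  have hbd : ∀ n : ℕ, n ≤ 3 → ∀ z, ‖iteratedFDeriv ℝ n g z‖ ≤ B := by
    intro n hn z
    have := h0 z
    have := h1 z
    have := h2 z
    have := h3 z
    have := le_abs_self B0
    have := le_abs_self B1
    have := le_abs_self B2
    have := le_abs_self B3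
    interval_cases n <;> linarith
  have c1 : ContDiff ℝ 2 (fderiv ℝ g) := hC.fderiv_right (by norm_num)
  have c2 : ContDiff ℝ 1 (fderiv ℝ (fderiv ℝ g)) := c1.fderiv_right (by norm_num)
  have c0 : ContDiff ℝ 2 g := hC.of_le (by norm_num)
  have hGe : GG g = fun z => ContinuousLinearMap.compL ℝ V E (V →L[ℝ] E) (fderiv ℝ g z) (g z) := by
    funext z; rfl
  have cG : ContDiff ℝ 2 (GG g) := by
    rw [hGe]
    exact (ContinuousLinearMap.contDiff _ |>.comp c1).clm_apply c0
  have cG1 : ContDiff ℝ 1 (fderiv ℝ (GG g)) := cG.fderiv_right (by norm_num)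
  have bG : ∀ n : ℕ, n ≤ 2 → ∃ C : ℝ, ∀ z, ‖iteratedFDeriv ℝ n (GG g) z‖ ≤ C := by
    intro n hn
    refine ⟨‖ContinuousLinearMap.compL ℝ V E (V →L[ℝ] E)‖ *
      ∑ i ∈ Finset.range (n + 1), (n.choose i : ℝ) * B * B, fun z => ?_⟩
    rw [hGe]
    refine (ContinuousLinearMap.norm_iteratedFDeriv_le_of_bilinear _ c1 c0 z
      (by exact_mod_cast hn)).trans ?_
    refine mul_le_mul_of_nonneg_left (Finset.sum_le_sum fun i hi => ?_) (norm_nonneg _)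
    have hi' : i ≤ n := by simpa [Nat.lt_succ_iff] using hi
    rw [norm_iteratedFDeriv_fderiv]
    have := hbd (i + 1) (by omega) z
    have := hbd (n - i) (by omega) z
    gcongr
  obtain ⟨C0, k0⟩ := bG 0 (by norm_num)
  obtain ⟨C1, k1⟩ := bG 1 (by norm_num)
  obtain ⟨C2, k2⟩ := bG 2 (by norm_num)
  have m0 := abs_nonneg C0
  have m1 := abs_nonneg C1
  have m2 := abs_nonneg C2
  have l0 := le_abs_self C0
  have l1 := le_abs_self C1
  have l2 := le_abs_self C2
  refine ⟨B + |C0| + |C1| + |C2|, by positivity, hC.differentiable (by norm_num),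
    c1.differentiable (by norm_num), c2.differentiable (by norm_num), ?_, ?_, ?_, ?_, ?_⟩
  · intro p
    have := hbd 0 (by norm_num) p
    rw [norm_iteratedFDeriv_zero] at this
    linarith
  · intro p
    have := hbd 1 (by norm_num) p
    rw [norm_iteratedFDeriv_one] at this
    linarith
  · intro p
    have := hbd 2 (by norm_num) p
    rw [← norm_iteratedFDeriv_fderiv, norm_iteratedFDeriv_one] at this
    linarith
  · intro p
    have := hbd 3 (by norm_num) p
    rw [← norm_iteratedFDeriv_fderiv, ← norm_iteratedFDeriv_fderiv,
      norm_iteratedFDeriv_one] at this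
    linarith
  · refine nice_of_fderiv (cG.differentiable (by norm_num)) (cG1.differentiable (by norm_num))
      ?_ ?_ ?_
    · intro p
      have := k0 p
      rw [norm_iteratedFDeriv_zero] at this
      linarith
    · intro p
      have := k1 p
      rw [norm_iteratedFDeriv_one] at this
      linarith
    · intro p
      have := k2 p
      rw [← norm_iteratedFDeriv_fderiv, norm_iteratedFDeriv_one] at this
      linarith
end Reg

/-! ### Regularity of the path -/

structure GoodPath (l : ℕ) (T : ℝ) (x x' : ℝ → Vec l) : Prop where
  cx : ContinuousOn x (Icc 0 T)
  cx' : ContinuousOn x' (Icc 0 T)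
  ftc : ∀ s t, 0 ≤ s → s ≤ t → t ≤ T → ∫ u in s..t, x' u = x t - x s

lemma goodPath_of_piecewise {l : ℕ} {T : ℝ} {x x' : ℝ → Vec l}
    (h : PiecewiseC1 l T x x') : GoodPath l T x x' := by
  obtain ⟨cx, N, τ, h0, hN, hlt, hk⟩ := h
  have glue : ∀ k, k ≤ N → 0 ≤ τ k ∧ ContinuousOn x' (Icc 0 (τ k)) ∧
      ∀ u, 0 < u → u < τ k → u ∉ range τ → HasDerivAt x (x' u) u := by
    intro k
    induction k with
    | zero =>
      intro _
      rw [h0]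
      refine ⟨le_rfl, by simp, fun u h1 h2 => by linarith⟩
    | succ k ih =>
      intro hkN
      obtain ⟨a1, a2, a3⟩ := ih (by omega)
      have b1 := hlt k (by omega)
      obtain ⟨b2, b3⟩ := hk k (by omega)
      refine ⟨by linarith, ?_, ?_⟩
      · rw [← Icc_union_Icc_eq_Icc a1 b1.le]
        exact a2.union_of_isClosed b2 isClosed_Icc isClosed_Icc
      · intro u h1 h2 h3
        rcases lt_trichotomy u (τ k) with h | h | h
        · exact a3 u h1 h h3
        · exact absurd ⟨k, h.symm⟩ h3
        · exact b3 u ⟨h, h2⟩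
  obtain ⟨_, c1, c2⟩ := glue N le_rfl
  rw [hN] at c1 c2
  refine ⟨cx, c1, fun s t h1 h2 h3 => ?_⟩
  have hsub : Icc s t ⊆ Icc 0 T := Icc_subset_Icc h1 h3
  refine integral_eq_of_hasDerivAt_off_countable_of_le x x' h2 (countable_range τ)
    (cx.mono hsub) ?_ ?_
  · rintro u ⟨⟨hu1, hu2⟩, hu3⟩
    exact c2 u (by linarith) (by linarith) hu3
  · exact (c1.mono (by rw [uIcc_of_le h2]; exact hsub)).intervalIntegrable

lemma GoodPath.bdd {l : ℕ} {T : ℝ} {x x' : ℝ → Vec l} (h : GoodPath l T x x') :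
    ∃ M, 0 ≤ M ∧ ∀ u ∈ Icc 0 T, ‖x u‖ ≤ M ∧ ‖x' u‖ ≤ M := by
  obtain ⟨M1, h1⟩ := isCompact_Icc.exists_bound_of_continuousOn h.cx
  obtain ⟨M2, h2⟩ := isCompact_Icc.exists_bound_of_continuousOn h.cx'
  refine ⟨|M1| + |M2|, by positivity, fun u hu => ?_⟩
  have := h1 u hu
  have := h2 u hu
  have := le_abs_self M1
  have := le_abs_self M2
  have := abs_nonneg M1
  have := abs_nonneg M2
  constructor <;> linarith

lemma coord_le {l : ℕ} (v : Vec l) (i : Fin l) : |v i| ≤ ‖v‖ := by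
  simpa using PiLp.norm_apply_le v i

section path
variable {l : ℕ} {T : ℝ} {x x' : ℝ → Vec l}

lemma GoodPath.lip (h : GoodPath l T x x') {M : ℝ} (hM : ∀ u ∈ Icc 0 T, ‖x u‖ ≤ M ∧ ‖x' u‖ ≤ M)
    (s t : ℝ) (h1 : 0 ≤ s) (h2 : s ≤ t) (h3 : t ≤ T) : ‖x t - x s‖ ≤ M * (t - s) := by
  rw [← h.ftc s t h1 h2 h3]
  have := intervalIntegral.norm_integral_le_of_norm_le_const (a := s) (b := t) (C := M) (f := x')
    (fun u hu => by
      rw [uIoc_of_le h2] at hu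
      exact (hM u ⟨by linarith [hu.1], by linarith [hu.2]⟩).2)
  rwa [abs_of_nonneg (by linarith)] at this

lemma GoodPath.x2Entry_le (h : GoodPath l T x x') {M : ℝ} (hM0 : 0 ≤ M)
    (hM : ∀ u ∈ Icc 0 T, ‖x u‖ ≤ M ∧ ‖x' u‖ ≤ M)
    (s t : ℝ) (h1 : 0 ≤ s) (h2 : s ≤ t) (h3 : t ≤ T) (i j : Fin l) :
    |x2Entry l x x' s t i j| ≤ M ^ 2 * (t - s) ^ 2 := by
  have := intervalIntegral.norm_integral_le_of_norm_le_const (a := s) (b := t)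
    (C := M * (t - s) * M) (f := fun u => (x u i - x s i) * x' u j)
    (fun u hu => by
      rw [uIoc_of_le h2] at hu
      have a1 : |x u i - x s i| ≤ M * (t - s) := by
        have e1 := h.lip hM s u h1 hu.1.le (by linarith [hu.2])
        have e2 := coord_le (x u - x s) i
        rw [PiLp.sub_apply] at e2
        exact e2.trans (e1.trans (mul_le_mul_of_nonneg_left (by linarith [hu.2]) hM0))
      have a2 : |x' u j| ≤ M :=
        (coord_le _ j).trans (hM u ⟨by linarith [hu.1], by linarith [hu.2]⟩).2
      rw [norm_mul, Real.norm_eq_abs, Real.norm_eq_abs]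
      exact mul_le_mul a1 a2 (abs_nonneg _) (mul_nonneg hM0 (by linarith)))
  rw [abs_of_nonneg (show (0:ℝ) ≤ t - s by linarith)] at this
  rw [x2Entry, ← Real.norm_eq_abs]
  calc _ ≤ _ := this
    _ = _ := by ring

lemma GoodPath.int_entry (h : GoodPath l T x x') (c s t : ℝ) (h1 : 0 ≤ s) (h2 : s ≤ t)
    (h3 : t ≤ T) (i j : Fin l) :
    IntervalIntegrable (fun u => (x u i - c) * x' u j) volume s t := by
  have hsub : uIcc s t ⊆ Icc 0 T := by rw [uIcc_of_le h2]; exact Icc_subset_Icc h1 h3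
  have c1 : ContinuousOn (fun u => x u i) (Icc 0 T) :=
    (EuclideanSpace.proj (𝕜 := ℝ) i).continuous.comp_continuousOn h.cx
  have c2 : ContinuousOn (fun u => x' u j) (Icc 0 T) :=
    (EuclideanSpace.proj (𝕜 := ℝ) j).continuous.comp_continuousOn h.cx'
  exact (((c1.sub continuousOn_const).mul c2).mono hsub).intervalIntegrable

lemma GoodPath.chen (h : GoodPath l T x x') (s u t : ℝ) (h1 : 0 ≤ s) (h2 : s ≤ u)
    (h3 : u ≤ t) (h4 : t ≤ T) (i j : Fin l) :
    x2Entry l x x' s t i j = x2Entry l x x' s u i j + x2Entry l x x' u t i j +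
      (x u - x s) i * (x t - x u) j := by
  have ij : IntervalIntegrable (fun v => x' v) volume u t := by
    refine (h.cx'.mono ?_).intervalIntegrable
    rw [uIcc_of_le h3]; exact Icc_subset_Icc (by linarith) h4
  have ijj : IntervalIntegrable (fun v => x' v j) volume u t := by
    have c2 : ContinuousOn (fun u => x' u j) (Icc 0 T) :=
      (EuclideanSpace.proj (𝕜 := ℝ) j).continuous.comp_continuousOn h.cx'
    refine (c2.mono ?_).intervalIntegrable
    rw [uIcc_of_le h3]; exact Icc_subset_Icc (by linarith) h4
  have e0 : ∫ v in u..t, x' v j = (x t - x u) j := by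
    have := (EuclideanSpace.proj (𝕜 := ℝ) j).intervalIntegral_comp_comm ij
    rw [h.ftc u t (by linarith) h3 h4] at this
    simpa using this
  have e1 : x2Entry l x x' s t i j = x2Entry l x x' s u i j +
      ∫ v in u..t, (x v i - x s i) * x' v j := by
    rw [x2Entry, x2Entry, intervalIntegral.integral_add_adjacent_intervals]
    · exact h.int_entry _ s u h1 h2 (by linarith) i j
    · exact h.int_entry _ u t (by linarith) h3 h4 i j
  have e2 : ∫ v in u..t, (x v i - x s i) * x' v j = x2Entry l x x' u t i j +
      (x u - x s) i * (x t - x u) j := by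
    rw [x2Entry, ← e0, ← intervalIntegral.integral_const_mul, ← intervalIntegral.integral_add]
    · congr 1; funext v; rw [PiLp.sub_apply]; ring
    · exact h.int_entry _ u t (by linarith) h3 h4 i j
    · exact ijj.const_mul _
  rw [e1, e2]; ring

lemma GoodPath.x2Norm_le (h : GoodPath l T x x') {M : ℝ} (hM0 : 0 ≤ M)
    (hM : ∀ u ∈ Icc 0 T, ‖x u‖ ≤ M ∧ ‖x' u‖ ≤ M)
    (s t : ℝ) (h1 : 0 ≤ s) (h2 : s ≤ t) (h3 : t ≤ T) :
    x2Norm l x x' s t ≤ l * M ^ 2 * (t - s) ^ 2 := by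
  rw [x2Norm]
  apply Real.sqrt_le_iff.2
  refine ⟨by positivity, ?_⟩
  have : ∀ i j, (x2Entry l x x' s t i j) ^ 2 ≤ (M ^ 2 * (t - s) ^ 2) ^ 2 := fun i j =>
    sq_le_sq' (by linarith [(abs_le.1 (h.x2Entry_le hM0 hM s t h1 h2 h3 i j)).1])
      (abs_le.1 (h.x2Entry_le hM0 hM s t h1 h2 h3 i j)).2
  calc _ ≤ ∑ i : Fin l, ∑ j : Fin l, (M ^ 2 * (t - s) ^ 2) ^ 2 :=
        Finset.sum_le_sum fun i _ => Finset.sum_le_sum fun j _ => this i j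
    _ = _ := by simp; ring

lemma abs_x2Entry_le (s t : ℝ) (i j : Fin l) : |x2Entry l x x' s t i j| ≤ x2Norm l x x' s t := by
  rw [x2Norm]
  apply Real.abs_le_sqrt
  refine le_trans ?_ (Finset.single_le_sum (f := fun i => ∑ j : Fin l, (x2Entry l x x' s t i j) ^ 2)
    (fun i _ => Finset.sum_nonneg fun j _ => sq_nonneg _) (Finset.mem_univ i))
  exact Finset.single_le_sum (f := fun j => (x2Entry l x x' s t i j) ^ 2)
    (fun j _ => sq_nonneg _) (Finset.mem_univ j)

/-- The rough norm is finite and controls the increments. -/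
lemma GoodPath.rough (h : GoodPath l T x x') {γ : ℝ} (hγ0 : 0 < γ) (hγ : γ ≤ 1) :
    0 ≤ roughNormSmooth l γ T x x' ∧
    ∀ s t, 0 ≤ s → s ≤ t → t ≤ T →
      ‖x t - x s‖ ≤ roughNormSmooth l γ T x x' * (t - s) ^ γ ∧
      x2Norm l x x' s t ≤ roughNormSmooth l γ T x x' * ((t - s) ^ γ) ^ 2 := by
  refine ⟨ENNReal.toReal_nonneg, ?_⟩
  obtain ⟨M, hM0, hM⟩ := h.bdd
  set A1 := supENorm 0 T x with hA1
  set A2 := holderENorm γ 0 T x with hA2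
  set A3 := ⨆ p : {p : ℝ × ℝ // 0 ≤ p.1 ∧ p.1 < p.2 ∧ p.2 ≤ T},
      ENNReal.ofReal (x2Norm l x x' p.1.1 p.1.2 / (p.1.2 - p.1.1) ^ (2 * γ)) with hA3
  have f1 : A1 ≠ ⊤ := by
    refine ne_top_of_le_ne_top (ENNReal.ofReal_ne_top (r := M)) (iSup_le fun u => ?_)
    exact ENNReal.ofReal_le_ofReal (hM u u.2).1
  have f2 : A2 ≠ ⊤ := by
    refine ne_top_of_le_ne_top (ENNReal.ofReal_ne_top (r := M * T ^ (1 - γ))) (iSup_le ?_)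
    rintro ⟨⟨s, t⟩, p1, p2, p3⟩
    dsimp only at p1 p2 p3 ⊢
    apply ENNReal.ofReal_le_ofReal
    have hp : 0 < t - s := by linarith
    rw [div_le_iff₀ (Real.rpow_pos_of_pos hp _)]
    have e1 : t - s = (t - s) ^ (1 - γ) * (t - s) ^ γ := by
      rw [← Real.rpow_add hp]; simp
    have e2 : (t - s) ^ (1 - γ) ≤ T ^ (1 - γ) :=
      Real.rpow_le_rpow hp.le (by linarith) (by linarith)
    calc ‖x t - x s‖ ≤ M * (t - s) := h.lip hM s t p1 p2.le p3
      _ = M * ((t - s) ^ (1 - γ) * (t - s) ^ γ) := by rw [← e1]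
      _ ≤ M * (T ^ (1 - γ) * (t - s) ^ γ) := by gcongr
      _ = _ := by ring
  have f3 : A3 ≠ ⊤ := by
    refine ne_top_of_le_ne_top (ENNReal.ofReal_ne_top (r := l * M ^ 2 * T ^ (2 - 2 * γ)))
      (iSup_le ?_)
    rintro ⟨⟨s, t⟩, p1, p2, p3⟩
    dsimp only at p1 p2 p3 ⊢
    apply ENNReal.ofReal_le_ofReal
    have hp : 0 < t - s := by linarith
    rw [div_le_iff₀ (Real.rpow_pos_of_pos hp _)]
    have e1 : (t - s) ^ 2 = (t - s) ^ (2 - 2 * γ) * (t - s) ^ (2 * γ) := by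
      rw [← Real.rpow_add hp]; simp
    have e2 : (t - s) ^ (2 - 2 * γ) ≤ T ^ (2 - 2 * γ) :=
      Real.rpow_le_rpow hp.le (by linarith) (by linarith)
    calc _ ≤ l * M ^ 2 * (t - s) ^ 2 := h.x2Norm_le hM0 hM s t p1 p2.le p3
      _ = l * M ^ 2 * ((t - s) ^ (2 - 2 * γ) * (t - s) ^ (2 * γ)) := by rw [← e1]
      _ ≤ l * M ^ 2 * (T ^ (2 - 2 * γ) * (t - s) ^ (2 * γ)) := by gcongr
      _ = _ := by ring
  have hne : A1 + A2 + A3 ≠ ⊤ := by simp [f1, f2, f3]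
  have hrho : roughNormSmooth l γ T x x' = (A1 + A2 + A3).toReal := rfl
  intro s t h1 h2 h3
  rcases eq_or_lt_of_le h2 with he | hlt
  · subst he
    have : x2Norm l x x' s s = 0 := by simp [x2Norm, x2Entry]
    rw [this]
    simp [Real.zero_rpow hγ0.ne']
  have hp : 0 < t - s := by linarith
  rw [hrho]
  constructor
  · rw [← div_le_iff₀ (Real.rpow_pos_of_pos hp _)]
    apply (ENNReal.ofReal_le_iff_le_toReal hne).1
    refine le_trans ?_ (le_trans le_add_self (le_self_add (a := A1 + A2) (b := A3)))
    rw [hA2, holderENorm]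
    exact le_iSup (fun p : {p : ℝ × ℝ // 0 ≤ p.1 ∧ p.1 < p.2 ∧ p.2 ≤ T} =>
      ENNReal.ofReal (‖x p.1.2 - x p.1.1‖ / (p.1.2 - p.1.1) ^ γ)) ⟨(s, t), h1, hlt, h3⟩
  · have e1 : ((t - s) ^ γ) ^ 2 = (t - s) ^ (2 * γ) := by
      rw [← Real.rpow_natCast, ← Real.rpow_mul hp.le, mul_comm]; norm_num
    rw [e1, ← div_le_iff₀ (Real.rpow_pos_of_pos hp _)]
    apply (ENNReal.ofReal_le_iff_le_toReal hne).1
    refine le_trans ?_ (le_add_self (a := A3) (b := A1 + A2))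
    rw [hA3]
    exact le_iSup (fun p : {p : ℝ × ℝ // 0 ≤ p.1 ∧ p.1 < p.2 ∧ p.2 ≤ T} =>
      ENNReal.ofReal (x2Norm l x x' p.1.1 p.1.2 / (p.1.2 - p.1.1) ^ (2 * γ)))
      ⟨(s, t), h1, hlt, h3⟩
end path

/-! ### Contraction with the second-order process -/
section cst
set_option maxSynthPendingDepth 3
variable {l d : ℕ} {T : ℝ} {x x' : ℝ → Vec l}

/-- contraction of a bilinear map with a matrix -/
def contr (d : ℕ) {l : ℕ} (X : Fin l → Fin l → ℝ) :
    (Vec l →L[ℝ] Vec l →L[ℝ] Vec d) →L[ℝ] Vec d :=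
  ∑ i : Fin l, ∑ j : Fin l, X i j •
    (ContinuousLinearMap.apply ℝ (Vec d) (EuclideanSpace.single j (1 : ℝ))).comp
      (ContinuousLinearMap.apply ℝ (Vec l →L[ℝ] Vec d) (EuclideanSpace.single i (1 : ℝ)))

lemma contr_apply (X : Fin l → Fin l → ℝ) (A : Vec l →L[ℝ] Vec l →L[ℝ] Vec d) :
    contr d X A = ∑ i : Fin l, ∑ j : Fin l, X i j •
      A (EuclideanSpace.single i (1 : ℝ)) (EuclideanSpace.single j (1 : ℝ)) := by
  simp [contr, ContinuousLinearMap.sum_apply]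

lemma contr_norm (X : Fin l → Fin l → ℝ) {m : ℝ} (hm0 : 0 ≤ m) (hm : ∀ i j, |X i j| ≤ m) :
    ‖contr d X‖ ≤ (l : ℝ) ^ 2 * m := by
  refine ContinuousLinearMap.opNorm_le_bound _ (by positivity) fun A => ?_
  rw [contr_apply]
  have : ∀ i j, ‖X i j • A (EuclideanSpace.single i (1 : ℝ)) (EuclideanSpace.single j (1 : ℝ))‖
      ≤ m * ‖A‖ := by
    intro i j
    rw [norm_smul, Real.norm_eq_abs]
    have e : ‖A (EuclideanSpace.single i (1 : ℝ)) (EuclideanSpace.single j (1 : ℝ))‖ ≤ ‖A‖ := by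
      have := A.le_opNorm₂ (EuclideanSpace.single i (1 : ℝ)) (EuclideanSpace.single j (1 : ℝ))
      simpa using this
    exact mul_le_mul (hm i j) e (norm_nonneg _) hm0
  calc _ ≤ ∑ i : Fin l, ∑ j : Fin l, m * ‖A‖ :=
        (norm_sum_le _ _).trans (Finset.sum_le_sum fun i _ =>
          (norm_sum_le _ _).trans (Finset.sum_le_sum fun j _ => this i j))
    _ = _ := by simp; ring

lemma bilin_expand (A : Vec l →L[ℝ] Vec l →L[ℝ] Vec d) (a b : Vec l) :
    A a b = contr d (fun i j => a i * b j) A := by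
  rw [contr_apply]
  have ha : a = ∑ i, a i • EuclideanSpace.single i (1 : ℝ) := by
    have := (EuclideanSpace.basisFun (Fin l) ℝ).sum_repr a
    simpa using this.symm
  have hb : b = ∑ i, b i • EuclideanSpace.single i (1 : ℝ) := by
    have := (EuclideanSpace.basisFun (Fin l) ℝ).sum_repr b
    simpa using this.symm
  conv_lhs => rw [ha, hb]
  simp only [map_sum, map_smul, ContinuousLinearMap.sum_apply, ContinuousLinearMap.smul_apply,
    Finset.smul_sum, smul_smul]
  rw [Finset.sum_comm]
  refine Finset.sum_congr rfl fun i _ => Finset.sum_congr rfl fun j _ => ?_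
  rw [mul_comm]

/-- the second-order process acting on bilinear maps -/
def cst (d : ℕ) {l : ℕ} (x x' : ℝ → Vec l) (s t : ℝ) :
    (Vec l →L[ℝ] Vec l →L[ℝ] Vec d) →L[ℝ] Vec d :=
  contr d (fun i j => x2Entry l x x' s t i j)

lemma GoodPath.cst_chen (h : GoodPath l T x x') (s u t : ℝ) (h1 : 0 ≤ s) (h2 : s ≤ u)
    (h3 : u ≤ t) (h4 : t ≤ T) (A : Vec l →L[ℝ] Vec l →L[ℝ] Vec d) :
    cst d x x' s t A = cst d x x' s u A + cst d x x' u t A + A (x u - x s) (x t - x u) := by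
  rw [bilin_expand, cst, cst, cst]
  simp only [contr_apply, ← Finset.sum_add_distrib, ← add_smul]
  refine Finset.sum_congr rfl fun i _ => Finset.sum_congr rfl fun j _ => ?_
  rw [h.chen s u t h1 h2 h3 h4 i j]
end cst

/-! ### Solutions -/
section sol
set_option maxSynthPendingDepth 3
variable {l d : ℕ} {T : ℝ} {x x' : ℝ → Vec l} {g : Vec d → Vec l →L[ℝ] Vec d}

lemma sol_integrable (h : GoodPath l T x x') {B : ℝ} (hg : GoodG B g) {s t : ℝ} (hs : 0 ≤ s)
    (hst : s ≤ t) (ht : t ≤ T) {z : Vec d} {y : ℝ → Vec d} (hy : OdeSol d l g x' s t z y) :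
    IntervalIntegrable (fun v => g (y v) (x' v)) volume s t := by
  by_contra hnot
  obtain ⟨M, hM0, hM⟩ := h.bdd
  have gc : Continuous g := hg.d1.continuous
  set f := fun v => g (y v) (x' v) with hf
  set S := {u | u ∈ Icc s t ∧ IntervalIntegrable f volume s u} with hS
  have hsS : s ∈ S := ⟨left_mem_Icc.2 hst, by simp⟩
  have hbd : BddAbove S := ⟨t, fun u hu => hu.1.2⟩
  set c := sSup S with hc
  have hsc : s ≤ c := le_csSup hbd hsS
  have hct : c ≤ t := csSup_le ⟨s, hsS⟩ fun u hu => hu.1.2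
  have hyc : ContinuousOn y (Ico s c) := by
    intro u hu
    obtain ⟨u', hu'S, huu'⟩ := exists_lt_of_lt_csSup ⟨s, hsS⟩ hu.2
    have c1 : ContinuousOn (fun r => z + ∫ v in s..r, f v) (Icc s u') := by
      have := intervalIntegral.continuousOn_primitive_interval' hu'S.2 left_mem_uIcc
      rw [uIcc_of_le hu'S.1.1] at this
      exact continuousOn_const.add this
    have c2 : ContinuousOn y (Icc s u') :=
      c1.congr fun r hr => hy.2 r ⟨hr.1, hr.2.trans hu'S.1.2⟩
    refine (c2 u ⟨hu.1, huu'.le⟩).mono_of_mem_nhdsWithin ?_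
    filter_upwards [self_mem_nhdsWithin, nhdsWithin_le_nhds (Iio_mem_nhds huu')] with r h1 h2
    exact ⟨h1.1, le_of_lt h2⟩
  have hyz : ∀ u ∈ Ioc c t, y u = z := by
    intro u hu
    have hu' : u ∈ Icc s t := ⟨by linarith [hu.1], hu.2⟩
    have : ¬ IntervalIntegrable f volume s u := fun hi =>
      absurd (le_csSup hbd (show u ∈ S from ⟨hu', hi⟩)) (not_le.2 hu.1)
    rw [hy.2 u hu', intervalIntegral.integral_undef this, add_zero]
  have hsub : Icc s t ⊆ Icc 0 T := Icc_subset_Icc hs ht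
  have p1 : AEStronglyMeasurable f (volume.restrict (Ico s c)) := by
    refine ContinuousOn.aestronglyMeasurable ?_ measurableSet_Ico
    refine ContinuousOn.clm_apply (gc.comp_continuousOn hyc) (h.cx'.mono ?_)
    exact fun u hu => hsub ⟨hu.1, by linarith [hu.2]⟩
  have p2 : AEStronglyMeasurable f (volume.restrict {c}) :=
    (continuousOn_singleton f c).aestronglyMeasurable (measurableSet_singleton c)
  have p3 : AEStronglyMeasurable f (volume.restrict (Ioc c t)) := by
    refine ContinuousOn.aestronglyMeasurable ?_ measurableSet_Ioc
    have : ContinuousOn (fun v => g z (x' v)) (Ioc c t) :=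
      (g z).continuous.comp_continuousOn (h.cx'.mono fun u hu =>
        hsub ⟨by linarith [hu.1], hu.2⟩)
    refine this.congr fun u hu => ?_
    simp only [hf]
    rw [hyz u hu]
  have p4 : AEStronglyMeasurable f (volume.restrict (Ioc s t)) := by
    have := aestronglyMeasurable_union_iff.2 ⟨aestronglyMeasurable_union_iff.2 ⟨p1, p2⟩, p3⟩
    refine this.mono_measure (Measure.restrict_mono ?_ le_rfl)
    intro u hu
    rcases lt_trichotomy u c with h | h | h
    · exact Or.inl (Or.inl ⟨hu.1.le, h⟩)
    · exact Or.inl (Or.inr h)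
    · exact Or.inr ⟨h, hu.2⟩
  apply hnot
  rw [intervalIntegrable_iff_integrableOn_Ioc_of_le hst]
  refine Integrable.of_bound p4 (B * M) ?_
  refine (ae_restrict_iff' measurableSet_Ioc).2 (Filter.Eventually.of_forall fun u hu => ?_)
  exact ((g (y u)).le_opNorm _).trans (mul_le_mul (hg.b0 _)
    (hM u (hsub ⟨hu.1.le, hu.2⟩)).2 (norm_nonneg _) hg.pos)

lemma sol_incr (h : GoodPath l T x x') {B : ℝ} (hg : GoodG B g) {s t : ℝ} (hs : 0 ≤ s)
    (hst : s ≤ t) (ht : t ≤ T) {z : Vec d} {y : ℝ → Vec d} (hy : OdeSol d l g x' s t z y) :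
    ContinuousOn y (Icc s t) ∧
    ∃ M, ∀ a b, s ≤ a → a ≤ b → b ≤ t →
      ‖y b - y a - tht g (x b - x a) (cst d x x' a b) (y a)‖ ≤ M * (b - a) ^ 2 := by
  have hi := sol_integrable h hg hs hst ht hy
  obtain ⟨M, hM0, hM⟩ := h.bdd
  have hB := hg.pos
  have gc : Continuous g := hg.d1.continuous
  have hcont : ContinuousOn y (Icc s t) := by
    have := intervalIntegral.continuousOn_primitive_interval' hi left_mem_uIcc
    rw [uIcc_of_le hst] at this
    exact (continuousOn_const.add this).congr fun r hr => hy.2 r hr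
  refine ⟨hcont, B * (B * M) * M + (l : ℝ) ^ 2 * M ^ 2 * B, ?_⟩
  have hii : ∀ a b, s ≤ a → a ≤ b → b ≤ t →
      IntervalIntegrable (fun v => g (y v) (x' v)) volume a b := fun a b h1 h2 h3 =>
    hi.mono_set (by rw [uIcc_of_le hst, uIcc_of_le h2]; exact Icc_subset_Icc h1 h3)
  have inc : ∀ a b, s ≤ a → a ≤ b → b ≤ t → y b - y a = ∫ v in a..b, g (y v) (x' v) := by
    intro a b h1 h2 h3
    rw [hy.2 b ⟨by linarith, h3⟩, hy.2 a ⟨h1, by linarith⟩,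
      ← intervalIntegral.integral_add_adjacent_intervals (hii s a le_rfl h1 (by linarith))
        (hii a b h1 h2 h3)]
    abel
  have lipy : ∀ a b, s ≤ a → a ≤ b → b ≤ t → ‖y b - y a‖ ≤ B * M * (b - a) := by
    intro a b h1 h2 h3
    rw [inc a b h1 h2 h3]
    have := intervalIntegral.norm_integral_le_of_norm_le_const (a := a) (b := b) (C := B * M)
      (f := fun v => g (y v) (x' v)) (fun u hu => by
        rw [uIoc_of_le h2] at hu
        exact ((g (y u)).le_opNorm _).trans (mul_le_mul (hg.b0 _)
          (hM u ⟨by linarith [hu.1], by linarith [hu.2]⟩).2 (norm_nonneg _) hB))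
    rwa [abs_of_nonneg (by linarith)] at this
  intro a b h1 h2 h3
  have ix : IntervalIntegrable x' volume a b := by
    refine (h.cx'.mono ?_).intervalIntegrable
    rw [uIcc_of_le h2]; exact Icc_subset_Icc (by linarith) (by linarith)
  have igx : IntervalIntegrable (fun v => g (y a) (x' v)) volume a b := by
    refine ((g (y a)).continuous.comp_continuousOn (h.cx'.mono ?_)).intervalIntegrable
    rw [uIcc_of_le h2]; exact Icc_subset_Icc (by linarith) (by linarith)
  have e1 : g (y a) (x b - x a) = ∫ v in a..b, g (y a) (x' v) := by
    rw [← h.ftc a b (by linarith) h2 (by linarith)]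
    exact ((g (y a)).intervalIntegral_comp_comm ix).symm
  have e2 : y b - y a - tht g (x b - x a) (cst d x x' a b) (y a) =
      (∫ v in a..b, (g (y v) - g (y a)) (x' v)) - cst d x x' a b (GG g (y a)) := by
    rw [tht, e1, inc a b h1 h2 h3, ← sub_sub, ← intervalIntegral.integral_sub (hii a b h1 h2 h3) igx]
    rfl
  rw [e2]
  have e3 : ‖∫ v in a..b, (g (y v) - g (y a)) (x' v)‖ ≤ (B * (B * M * (b - a)) * M) * (b - a) := by
    have := intervalIntegral.norm_integral_le_of_norm_le_const (a := a) (b := b)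
      (C := B * (B * M * (b - a)) * M)
      (f := fun v => (g (y v) - g (y a)) (x' v)) (fun u hu => by
        rw [uIoc_of_le h2] at hu
        have i1 : ‖y u - y a‖ ≤ B * M * (b - a) :=
          (lipy a u h1 hu.1.le (by linarith [hu.2])).trans
            (mul_le_mul_of_nonneg_left (by linarith [hu.2]) (by positivity))
        have i2 : ‖g (y u) - g (y a)‖ ≤ B * (B * M * (b - a)) :=
          (hg.ng.lip _ _).trans (mul_le_mul_of_nonneg_left i1 hB)
        exact (ContinuousLinearMap.le_opNorm _ _).trans (mul_le_mul i2
          (hM u ⟨by linarith [hu.1], by linarith [hu.2]⟩).2 (norm_nonneg _)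
          ((norm_nonneg _).trans i2)))
    rwa [abs_of_nonneg (show (0 : ℝ) ≤ b - a by linarith)] at this
  have e4 : ‖cst d x x' a b (GG g (y a))‖ ≤ ((l : ℝ) ^ 2 * (M ^ 2 * (b - a) ^ 2)) * B :=
    (ContinuousLinearMap.le_opNorm _ _).trans (mul_le_mul
      (contr_norm _ (by positivity) (fun i j =>
        h.x2Entry_le hM0 hM a b (by linarith) h2 (by linarith) i j))
      (hg.nG.bdd _) (norm_nonneg _) (by positivity))
  refine (norm_sub_le _ _).trans ?_
  linarith
end sol

/-! ### The estimate with a bound on the rough norm -/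

set_option maxSynthPendingDepth 3 in
lemma stability_bounded (d l : ℕ) (γ T : ℝ) (hγ1 : 1 / 3 < γ) (hγ2 : γ ≤ 1)
    (g : Vec d → Vec l →L[ℝ] Vec d) (hg : IsC3Bounded g) (ρ : ℝ) (hρ : 0 ≤ ρ) :
    ∃ C : ℝ, 0 ≤ C ∧ ∀ x x' : ℝ → Vec l, PiecewiseC1 l T x x' →
      roughNormSmooth l γ T x x' ≤ ρ →
      ∀ s t : ℝ, 0 ≤ s → s ≤ t → t ≤ T →
      ∀ (z zt : Vec d) (y yt : ℝ → Vec d),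
        OdeSol d l g x' s t z y → OdeSol d l g x' s t zt yt →
        ‖y t - yt t‖ ≤ C * ‖z - zt‖ ∧
        ‖(y t - yt t) - (z - zt)‖ ≤ C * (t - s) ^ γ * ‖z - zt‖ := by
  obtain ⟨B, hG⟩ := goodG_of_C3 hg
  have hγ0 : 0 < γ := by linarith
  obtain ⟨r, hr⟩ : ∃ r, r = ((l : ℝ) ^ 2 + 1) * ρ := ⟨_, rfl⟩
  have hr0 : 0 ≤ r := by rw [hr]; positivity
  have hρr : ρ ≤ r := by
    rw [hr]
    have : 0 ≤ (l : ℝ) ^ 2 * ρ := by positivity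
    linarith
  obtain ⟨L, hL0, hLB, hL⟩ := defect_bounds hG hr0
  obtain ⟨h, h0, h1, K, hK0, core⟩ := core_step γ hγ1 L hL0
  obtain ⟨N, hN⟩ := exists_nat_ge (T / h)
  have hNT : T ≤ N * h := by rwa [div_le_iff₀ h0] at hN
  have hhγ : 0 < h ^ γ := Real.rpow_pos_of_pos h0 _
  refine ⟨2 ^ N + K + (2 ^ N + 1) / h ^ γ, by positivity, ?_⟩
  intro x x' hpw hrough s t hs hst ht z zt y yt hy hyt
  have hx := goodPath_of_piecewise hpw
  obtain ⟨ρ0, hinc⟩ := hx.rough hγ0 hγ2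
  set ρ' := roughNormSmooth l γ T x x' with hρ'
  obtain ⟨cy, M1, hM1⟩ := sol_incr hx hG hs hst ht hy
  obtain ⟨cyt, M2, hM2⟩ := sol_incr hx hG hs hst ht hyt
  -- bounds on increments
  have bx : ∀ a b, 0 ≤ a → a ≤ b → b ≤ T → ∀ q, (b - a) ^ γ ≤ q →
      ‖x b - x a‖ ≤ r * q ∧ ‖cst d x x' a b‖ ≤ r * q ^ 2 := by
    intro a b h1 h2 h3 q hq
    obtain ⟨i1, i2⟩ := hinc a b h1 h2 h3
    have q0 : 0 ≤ (b - a) ^ γ := Real.rpow_nonneg (by linarith) _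
    have q2 : ((b - a) ^ γ) ^ 2 ≤ q ^ 2 := pow_le_pow_left₀ q0 hq 2
    constructor
    · exact i1.trans (mul_le_mul (hrough.trans hρr) hq q0 hr0)
    · have i3 : x2Norm l x x' a b ≤ ρ * q ^ 2 :=
        i2.trans (mul_le_mul hrough q2 (by positivity) hρ)
      have i4 := contr_norm (d := d) (fun i j => x2Entry l x x' a b i j)
        (m := ρ * q ^ 2) (by positivity) (fun i j => (abs_x2Entry_le a b i j).trans i3)
      refine i4.trans ?_
      have : 0 ≤ ρ * q ^ 2 := by positivity
      rw [hr]
      linarith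
  -- local step
  have step : ∀ a b, s ≤ a → a ≤ b → b ≤ t → b - a ≤ h →
      ‖y b - yt b‖ ≤ 2 * ‖y a - yt a‖ ∧
      ‖(y b - yt b) - (y a - yt a)‖ ≤ K * (b - a) ^ γ * ‖y a - yt a‖ := by
    intro a b ha hab hb hbh
    have nice : ∀ s t, a ≤ s → s ≤ t → t ≤ b →
        NiceFun (2 * B * r * (t - s) ^ γ) (tht g (x t - x s) (cst d x x' s t)) := by
      intro s' t' k1 k2 k3
      obtain ⟨b1, b2⟩ := bx s' t' (by linarith) k2 (by linarith) _ le_rfl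
      exact tht_nice hG hr0 (Real.rpow_nonneg (by linarith) _)
        (Real.rpow_le_one (by linarith) (by linarith) hγ0.le) b1 b2
    have hLq : ∀ s t : ℝ, s ≤ t → 2 * B * r * (t - s) ^ γ ≤ L * (t - s) ^ γ := fun s t hst =>
      mul_le_mul_of_nonneg_right hLB (Real.rpow_nonneg (by linarith) _)
    have def3 : ∀ s u t, a ≤ s → s ≤ u → u ≤ t → t ≤ b →
      (∀ z, ‖tht g (x u - x s) (cst d x x' s u) z +
          tht g (x t - x u) (cst d x x' u t) (z + tht g (x u - x s) (cst d x x' s u) z) -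
          tht g (x t - x s) (cst d x x' s t) z‖ ≤ L * (t - s) ^ (3 * γ)) ∧
      (∀ z w, ‖(tht g (x u - x s) (cst d x x' s u) z +
          tht g (x t - x u) (cst d x x' u t) (z + tht g (x u - x s) (cst d x x' s u) z) -
          tht g (x t - x s) (cst d x x' s t) z) -
          (tht g (x u - x s) (cst d x x' s u) w +
          tht g (x t - x u) (cst d x x' u t) (w + tht g (x u - x s) (cst d x x' s u) w) -
          tht g (x t - x s) (cst d x x' s t) w)‖ ≤ L * (t - s) ^ (3 * γ) * ‖z - w‖) := by
      intro s' u t' k1 k2 k3 k4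
      have q1 : (u - s') ^ γ ≤ (t' - s') ^ γ :=
        Real.rpow_le_rpow (by linarith) (by linarith) hγ0.le
      have q2 : (t' - u) ^ γ ≤ (t' - s') ^ γ :=
        Real.rpow_le_rpow (by linarith) (by linarith) hγ0.le
      obtain ⟨b1, b2⟩ := bx s' u (by linarith) k2 (by linarith) _ q1
      obtain ⟨b3, b4⟩ := bx u t' (by linarith) k3 (by linarith) _ q2
      have e1 : ((t' - s') ^ γ) ^ 3 = (t' - s') ^ (3 * γ) := by
        rw [← Real.rpow_natCast, ← Real.rpow_mul (by linarith), mul_comm]; norm_num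
      have := hL _ (Real.rpow_nonneg (by linarith) _)
        (Real.rpow_le_one (by linarith) (by linarith) hγ0.le) (x u - x s') (x t' - x u)
        (cst d x x' s' u) (cst d x x' u t') (cst d x x' s' t') b1 b3 b2 b4
        (fun A => hx.cst_chen s' u t' (by linarith) k2 k3 (by linarith) A)
      rw [e1] at this
      have e2 : (x u - x s') + (x t' - x u) = x t' - x s' := by abel
      rwa [e2] at this
    refine core (Vec d) (fun s t => tht g (x t - x s) (cst d x x' s t)) y yt a b (max M1 M2)
      hab hbh ?_ ?_ ?_ ?_ ?_ ?_ ?_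
    · intro s' t' k1 k2 k3 p q
      exact ((nice s' t' k1 k2 k3).lip p q).trans
        (mul_le_mul_of_nonneg_right (hLq s' t' k2) (norm_nonneg _))
    · intro s' t' k1 k2 k3 p q e e'
      exact ((nice s' t' k1 k2 k3).four p q e e').trans
        (mul_le_mul_of_nonneg_right (hLq s' t' k2) (by positivity))
    · intro s' u t' k1 k2 k3 k4 p
      exact (def3 s' u t' k1 k2 k3 k4).1 p
    · intro s' u t' k1 k2 k3 k4 p q
      exact (def3 s' u t' k1 k2 k3 k4).2 p q
    · intro s' t' k1 k2 k3
      exact (hM1 s' t' (by linarith) k2 (by linarith)).trans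
        (mul_le_mul_of_nonneg_right (le_max_left _ _) (sq_nonneg _))
    · intro s' t' k1 k2 k3
      exact (hM2 s' t' (by linarith) k2 (by linarith)).trans
        (mul_le_mul_of_nonneg_right (le_max_right _ _) (sq_nonneg _))
    · exact (cy.sub cyt).mono (Icc_subset_Icc ha hb)
  -- iteration
  have iter : ∀ n : ℕ, ∀ u, s ≤ u → u ≤ t → u - s ≤ n * h →
      ‖y u - yt u‖ ≤ 2 ^ n * ‖y s - yt s‖ := by
    intro n
    induction n with
    | zero =>
      intro u h1 h2 h3
      have : u = s := by
        simp only [Nat.cast_zero, zero_mul] at h3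
        linarith
      rw [this]; simp
    | succ n ih =>
      intro u h1 h2 h3
      push_cast at h3
      have hnh : 0 ≤ (n : ℝ) * h := by positivity
      have k1 : max s (u - h) ≤ u := max_le h1 (by linarith)
      have k2 : max s (u - h) - s ≤ n * h := by
        rw [sub_le_iff_le_add]
        exact max_le (by linarith) (by linarith)
      have k3 : u - max s (u - h) ≤ h := by linarith [le_max_right s (u - h)]
      have i1 := ih _ (le_max_left _ _) (k1.trans h2) k2
      have i2 := (step _ u (le_max_left _ _) k1 h2 k3).1
      rw [pow_succ]
      linarith
  have total := iter N t hst le_rfl (by linarith)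
  rw [hy.1, hyt.1] at total
  have n0 : 0 ≤ ‖z - zt‖ := norm_nonneg _
  have pN : (0 : ℝ) ≤ 2 ^ N := by positivity
  have r0 : 0 ≤ (2 ^ N + 1) / h ^ γ := by positivity
  have d0 : 0 ≤ (t - s) ^ γ := Real.rpow_nonneg (by linarith) _
  constructor
  · refine total.trans (mul_le_mul_of_nonneg_right ?_ n0)
    linarith
  · rcases le_total (t - s) h with hth | hth
    · have := (step s t le_rfl hst le_rfl hth).2
      rw [hy.1, hyt.1] at this
      refine this.trans (mul_le_mul_of_nonneg_right (mul_le_mul_of_nonneg_right ?_ d0) n0)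
      linarith
    · have i1 : ‖(y t - yt t) - (z - zt)‖ ≤ (2 ^ N + 1) * ‖z - zt‖ := by
        have := norm_sub_le (y t - yt t) (z - zt)
        linarith
      refine i1.trans (mul_le_mul_of_nonneg_right ?_ n0)
      have i2 : h ^ γ ≤ (t - s) ^ γ := Real.rpow_le_rpow h0.le hth hγ0.le
      have i3 : (2 ^ N + 1) ≤ (2 ^ N + 1) / h ^ γ * (t - s) ^ γ := by
        rw [div_mul_eq_mul_div, le_div_iff₀ hhγ]
        exact mul_le_mul_of_nonneg_left i2 (by positivity)
      refine i3.trans (mul_le_mul_of_nonneg_right ?_ d0)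
      linarith

/-- **Stability of the flow of an ODE driven by a smooth path in rough-path norm.** There is
a nondecreasing function `C_T : ℝ → [0,∞)`, depending only on `T, g, γ, d, l`, such that for
every piecewise `C¹` path `x`, `|Φ(z;s,t) - Φ(z̃;s,t)| ≤ C_T(‖x‖_{γ,rough}) |z - z̃|` and
`|(Φ(z;s,t) - Φ(z̃;s,t)) - (z - z̃)| ≤ C_T(‖x‖_{γ,rough}) (t-s)^γ |z - z̃|`. -/
theorem ode_flow_stability (d l : ℕ) (γ T : ℝ) (hγ1 : 1 / 3 < γ) (hγ2 : γ ≤ 1) (hT : 0 < T)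
    (g : Vec d → Vec l →L[ℝ] Vec d) (hg : IsC3Bounded g) :
    ∃ C : ℝ → ℝ, (∀ r : ℝ, 0 ≤ C r) ∧ Monotone C ∧
      ∀ x x' : ℝ → Vec l, PiecewiseC1 l T x x' →
      ∀ s t : ℝ, 0 ≤ s → s ≤ t → t ≤ T →
      ∀ (z zt : Vec d) (y yt : ℝ → Vec d),
        OdeSol d l g x' s t z y → OdeSol d l g x' s t zt yt →
        ‖y t - yt t‖ ≤ C (roughNormSmooth l γ T x x') * ‖z - zt‖ ∧
        ‖(y t - yt t) - (z - zt)‖ ≤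
          C (roughNormSmooth l γ T x x') * (t - s) ^ γ * ‖z - zt‖ := by
  choose! c hc0 hc using fun n : ℕ => stability_bounded d l γ T hγ1 hγ2 g hg n (Nat.cast_nonneg n)
  refine ⟨fun r => ∑ k ∈ Finset.range (⌈r⌉₊ + 1), c k,
    fun r => Finset.sum_nonneg fun k _ => hc0 k, ?_, ?_⟩
  · intro r r' hrr
    refine Finset.sum_le_sum_of_subset_of_nonneg ?_ (fun k _ _ => hc0 k)
    exact Finset.range_subset_range.2 (Nat.add_le_add_right (Nat.ceil_mono hrr) 1)
  · intro x x' hx s t hs hst ht z zt y yt hy hyt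
    obtain ⟨k1, k2⟩ := hc _ x x' hx (Nat.le_ceil (roughNormSmooth l γ T x x'))
      s t hs hst ht z zt y yt hy hyt
    have hle : c ⌈roughNormSmooth l γ T x x'⌉₊ ≤
        ∑ k ∈ Finset.range (⌈roughNormSmooth l γ T x x'⌉₊ + 1), c k :=
      Finset.single_le_sum (fun k _ => hc0 k) (Finset.mem_range.2 (Nat.lt_succ_self _))
    have d0 : 0 ≤ (t - s) ^ γ := Real.rpow_nonneg (by linarith) _
    refine ⟨k1.trans (mul_le_mul_of_nonneg_right hle (norm_nonneg _)), k2.trans ?_⟩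
    exact mul_le_mul_of_nonneg_right (mul_le_mul_of_nonneg_right hle d0) (norm_nonneg _)

end
end

section
/- Global error bound for the second-order Taylor scheme for ODEs driven by a smooth path (Proposition 4.2): Let 1/3 < γ ≤ 1, T > 0, n ∈ ℕ, and let g ∈ C³(ℝ^d; ℝ^{d×l}) be bounded with bounded derivatives up to order three. For the uniform grid t_k = kT/n, define y_{t_k} = Φ(a;0,t_k) and the scheme z_0 = a, z_{k+1} = Ψ(z_k; t_k, t_{k+1}), k = 0,…,n−1, and set M^x_{st} = ( ∫_s^t |ẋ_u| du )³. Then there exists a nondecreasing function C̃_T : ℝ → [0,∞), depending only on T, g, γ, d, l, such that for every continuous piecewise continuously differentiable x : [0,T] → ℝ^l, every a ∈ ℝ^d, every n and all 0 ≤ p < q ≤ n: (i) |y_{t_q} − z_q| ≤ C̃_T(‖x‖_{γ,rough}) Σ_{k=0}^{q−1} M^x_{t_k t_{k+1}}, and (ii) |(y_{t_q} − z_q) − (y_{t_p} − z_p)| ≤ C̃_T(‖x‖_{γ,rough}) ( Σ_{k=p}^{q−1} M^x_{t_k t_{k+1}} + (t_q − t_p)^γ Σ_{k=0}^{p−1}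 M^x_{t_k t_{k+1}} ). -/
open Set MeasureTheory
open scoped ENNReal

noncomputable section

set_option linter.unusedSectionVars false
/-- A bounded, Lipschitz function with a four-point (second order) estimate. -/
structure GoodF {E F : Type*} [NormedAddCommGroup E] [NormedAddCommGroup F]
    (M : ℝ) (f : E → F) : Prop where
  bdd : ∀ a, ‖f a‖ ≤ M
  lip : ∀ a b, ‖f b - f a‖ ≤ M * ‖b - a‖
  four : ∀ a b a' b', ‖(f b - f a) - (f b' - f a')‖ ≤
    M * (‖(b - a) - (b' - a')‖ + (‖a - a'‖ + ‖b - b'‖) * (‖b - a‖ + ‖b' - a'‖))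

section good
variable {E F F₁ F₂ F₃ : Type*} [NormedAddCommGroup E] [NormedSpace ℝ E]
  [NormedAddCommGroup F] [NormedSpace ℝ F]
  [NormedAddCommGroup F₁] [NormedSpace ℝ F₁] [NormedAddCommGroup F₂] [NormedSpace ℝ F₂]
  [NormedAddCommGroup F₃] [NormedSpace ℝ F₃]

theorem GoodF.nonneg {M : ℝ} {f : E → F} (h : GoodF M f) : 0 ≤ M :=
  (norm_nonneg _).trans (h.bdd 0)

theorem GoodF.mono {M N : ℝ} {f : E → F} (h : GoodF M f) (hMN : M ≤ N) : GoodF N f where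
  bdd a := (h.bdd a).trans hMN
  lip a b := (h.lip a b).trans (by gcongr)
  four a b a' b' := (h.four a b a' b').trans (by gcongr)

theorem GoodF.clm {M : ℝ} {f : E → F} (h : GoodF M f) (L : F →L[ℝ] F₁) :
    GoodF (‖L‖ * M) (fun z => L (f z)) where
  bdd a := L.le_opNorm_of_le (h.bdd a)
  lip a b := by
    rw [← map_sub, mul_assoc]; exact L.le_opNorm_of_le (h.lip a b)
  four a b a' b' := by
    rw [← map_sub, ← map_sub, ← map_sub, mul_assoc]; exact L.le_opNorm_of_le (h.four a b a' b')

theorem GoodF.add {M N : ℝ} {f k : E → F} (h : GoodF M f) (h' : GoodF N k) :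
    GoodF (M + N) (fun z => f z + k z) where
  bdd a := norm_add_le_of_le (h.bdd a) (h'.bdd a)
  lip a b := by
    have : f b + k b - (f a + k a) = (f b - f a) + (k b - k a) := by abel
    rw [this, add_mul]; exact norm_add_le_of_le (h.lip a b) (h'.lip a b)
  four a b a' b' := by
    have : f b + k b - (f a + k a) - (f b' + k b' - (f a' + k a')) =
      ((f b - f a) - (f b' - f a')) + ((k b - k a) - (k b' - k a')) := by abel
    rw [this, add_mul]; exact norm_add_le_of_le (h.four a b a' b') (h'.four a b a' b')

theorem GoodF.sum {ι : Type*} (s : Finset ι) {f : ι → E → F}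
    (h : ∀ i, ∃ M, GoodF M (f i)) : ∃ M, GoodF M (fun z => ∑ i ∈ s, f i z) := by
  classical
  induction s using Finset.induction_on with
  | empty => exact ⟨0, by constructor <;> simp⟩
  | insert i s his ih =>
    obtain ⟨M, hM⟩ := h i
    obtain ⟨N, hN⟩ := ih
    refine ⟨M + N, ?_⟩
    simp only [Finset.sum_insert his]
    exact hM.add hN

theorem GoodF.bilin {M N : ℝ} {f : E → F₁} {k : E → F₂} (h : GoodF M f) (h' : GoodF N k)
    (B : F₁ →L[ℝ] F₂ →L[ℝ] F₃) : GoodF (4 * ‖B‖ * M * N) (fun z => B (f z) (k z)) := by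
  have hM := h.nonneg
  have hN := h'.nonneg
  have key : ∀ u v, ∀ p q : ℝ, ‖u‖ ≤ p → ‖v‖ ≤ q → ‖B u v‖ ≤ ‖B‖ * p * q := fun u v p q hp hq =>
    (B.le_opNorm₂ u v).trans (by
      have := (norm_nonneg u).trans hp
      gcongr)
  have hB := norm_nonneg B
  refine ⟨fun a => (key _ _ _ _ (h.bdd a) (h'.bdd a)).trans ?_, fun a b => ?_, fun a b a' b' => ?_⟩
  · have : 0 ≤ ‖B‖ * M * N := by positivity
    nlinarith
  · have e : B (f b) (k b) - B (f a) (k a) = B (f b - f a) (k b) + B (f a) (k b - k a) := by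
      simp
    rw [e]
    refine (norm_add_le_of_le (key _ _ _ _ (h.lip a b) (h'.bdd b))
      (key _ _ _ _ (h.bdd a) (h'.lip a b))).trans ?_
    have : 0 ≤ ‖B‖ * M * N * ‖b - a‖ := by positivity
    nlinarith
  · have e : B (f b) (k b) - B (f a) (k a) - (B (f b') (k b') - B (f a') (k a')) =
      B ((f b - f a) - (f b' - f a')) (k b) + B (f b' - f a') (k b - k b')
      + B (f a - f a') (k b - k a) + B (f a') ((k b - k a) - (k b' - k a')) := by
      simp; abel
    rw [e]
    refine (norm_add_le_of_le (norm_add_le_of_le (norm_add_le_of_le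
      (key _ _ _ _ (h.four a b a' b') (h'.bdd b))
      (key _ _ _ _ (h.lip a' b') (h'.lip b' b))) (key _ _ _ _ (h.lip a' a) (h'.lip a b)))
      (key _ _ _ _ (h.bdd a') (h'.four a b a' b'))).trans ?_
    have e0 := norm_nonneg ((b - a) - (b' - a'))
    have h1 : 0 ≤ ‖B‖ * M * N := by positivity
    have e1 := norm_nonneg (b - a)
    have e2 := norm_nonneg (b' - a')
    have e3 := norm_nonneg (a - a')
    have e4 := norm_nonneg (b - b')
    have h3 : ‖b' - a'‖ * ‖b - b'‖ + ‖a - a'‖ * ‖b - a‖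
      ≤ (‖a - a'‖ + ‖b - b'‖) * (‖b - a‖ + ‖b' - a'‖) := by nlinarith [mul_nonneg e3 e2, mul_nonneg e4 e1]
    have h4 := mul_le_mul_of_nonneg_left h3 h1
    have h5 := mul_nonneg h1 e0
    have h6 := mul_nonneg h1 (mul_nonneg (add_nonneg e3 e4) (add_nonneg e1 e2))
    linarith

theorem good_of_deriv {M : ℝ} {f : E → F} (hf : Differentiable ℝ f) (h0 : ∀ z, ‖f z‖ ≤ M)
    (h1 : ∀ z, ‖fderiv ℝ f z‖ ≤ M)
    (h2 : ∀ a b, ‖fderiv ℝ f b - fderiv ℝ f a‖ ≤ M * ‖b - a‖) : GoodF M f := by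
  have hM : 0 ≤ M := (norm_nonneg _).trans (h0 0)
  refine ⟨h0, fun a b => ?_, fun a b a' b' => ?_⟩
  · exact Convex.norm_image_sub_le_of_norm_fderiv_le (s := univ) (fun x _ => hf x) (fun x _ => h1 x)
      convex_univ (mem_univ _) (mem_univ _)
  · have hd : ∀ (c v : E) (r : ℝ), HasDerivAt (fun r : ℝ => f (c + r • v))
        (fderiv ℝ f (c + r • v) v) r := by
      intro c v r
      have h3 : HasDerivAt (fun r : ℝ => c + r • v) v r := by
        simpa using ((hasDerivAt_id r).smul_const v).const_add c
      exact (hf (c + r • v)).hasFDerivAt.comp_hasDerivAt r h3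
    have := norm_image_sub_le_of_norm_deriv_le_segment_01'
      (f := fun r : ℝ => f (a + r • (b - a)) - f (a' + r • (b' - a')))
      (C := M * (‖(b - a) - (b' - a')‖ + (‖a - a'‖ + ‖b - b'‖) * (‖b - a‖ + ‖b' - a'‖)))
      (fun r _ => ((hd a (b - a) r).sub (hd a' (b' - a') r)).hasDerivWithinAt) ?_
    · refine le_trans (le_of_eq ?_) this
      simp; congr 1; abel
    · rintro r ⟨hr0, hr1⟩
      have e : fderiv ℝ f (a + r • (b - a)) (b - a) - fderiv ℝ f (a' + r • (b' - a')) (b' - a') =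
        fderiv ℝ f (a + r • (b - a)) ((b - a) - (b' - a')) +
        (fderiv ℝ f (a + r • (b - a)) - fderiv ℝ f (a' + r • (b' - a'))) (b' - a') := by
        simp
      rw [e]
      have h4 : ‖(a + r • (b - a)) - (a' + r • (b' - a'))‖ ≤ ‖a - a'‖ + ‖b - b'‖ := by
        have : (a + r • (b - a)) - (a' + r • (b' - a')) = (1 - r) • (a - a') + r • (b - b') := by
          module
        rw [this]
        refine norm_add_le_of_le ?_ ?_
        · rw [norm_smul, Real.norm_of_nonneg (by linarith)]
          nlinarith [norm_nonneg (a - a')]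
        · rw [norm_smul, Real.norm_of_nonneg (by linarith)]
          nlinarith [norm_nonneg (b - b')]
      refine (norm_add_le_of_le (ContinuousLinearMap.le_of_opNorm_le _ (h1 _) _)
        (ContinuousLinearMap.le_of_opNorm_le _ ((h2 _ _).trans
          (mul_le_mul_of_nonneg_left h4 hM)) _)).trans ?_
      have h6 : 0 ≤ M * (‖a - a'‖ + ‖b - b'‖) * ‖b - a‖ := by positivity
      linarith

/-- Second order Taylor remainder. -/
def tayF (g : E → F) (a b : E) : F := g b - g a - fderiv ℝ g a (b - a)

theorem tayF_four {M : ℝ} {g : E → F} (hg : Differentiable ℝ g) (h : GoodF M (fderiv ℝ g))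
    (a b a' b' : E) : ‖tayF g a b - tayF g a' b'‖ ≤
      M * (‖b - a‖ * ‖(b - a) - (b' - a')‖ + (‖(b - a) - (b' - a')‖ +
        (2 * ‖a - a'‖ + ‖b - b'‖) * (‖b - a‖ + ‖b' - a'‖)) * ‖b' - a'‖) := by
  have hM : 0 ≤ M := h.nonneg
  have hd : ∀ (c v : E) (r : ℝ), HasDerivAt (fun r : ℝ => g (c + r • v) - r • fderiv ℝ g c v)
      (fderiv ℝ g (c + r • v) v - fderiv ℝ g c v) r := by
    intro c v r
    have h3 : HasDerivAt (fun r : ℝ => c + r • v) v r := by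
      simpa using ((hasDerivAt_id r).smul_const v).const_add c
    have h4 := (hg (c + r • v)).hasFDerivAt.comp_hasDerivAt r h3
    have h5 : HasDerivAt (fun r : ℝ => r • fderiv ℝ g c v) (fderiv ℝ g c v) r := by
      simpa using ((hasDerivAt_id r).smul_const (fderiv ℝ g c v))
    exact h4.sub h5
  have := norm_image_sub_le_of_norm_deriv_le_segment_01'
    (f := fun r : ℝ => (g (a + r • (b - a)) - r • fderiv ℝ g a (b - a)) -
      (g (a' + r • (b' - a')) - r • fderiv ℝ g a' (b' - a')))
    (C := M * (‖b - a‖ * ‖(b - a) - (b' - a')‖ + (‖(b - a) - (b' - a')‖ +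
        (2 * ‖a - a'‖ + ‖b - b'‖) * (‖b - a‖ + ‖b' - a'‖)) * ‖b' - a'‖))
    (fun r _ => ((hd a (b - a) r).sub (hd a' (b' - a') r)).hasDerivWithinAt) ?_
  · refine le_trans (le_of_eq ?_) this
    simp only [tayF, one_smul, zero_smul, add_sub_cancel, add_zero, sub_zero]
    congr 1; abel
  · rintro r ⟨hr0, hr1⟩
    set c := a + r • (b - a) with hc
    set c' := a' + r • (b' - a') with hc'
    have e : fderiv ℝ g c (b - a) - fderiv ℝ g a (b - a) -
        (fderiv ℝ g c' (b' - a') - fderiv ℝ g a' (b' - a')) =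
      (fderiv ℝ g c - fderiv ℝ g a) ((b - a) - (b' - a')) +
      ((fderiv ℝ g c - fderiv ℝ g a) - (fderiv ℝ g c' - fderiv ℝ g a')) (b' - a') := by
      simp; abel
    rw [e]
    have h4 : ‖c - c'‖ ≤ ‖a - a'‖ + ‖b - b'‖ := by
      have : c - c' = (1 - r) • (a - a') + r • (b - b') := by
        rw [hc, hc']; module
      rw [this]
      refine norm_add_le_of_le ?_ ?_
      · rw [norm_smul, Real.norm_of_nonneg (by linarith)]
        nlinarith [norm_nonneg (a - a')]
      · rw [norm_smul, Real.norm_of_nonneg (by linarith)]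
        nlinarith [norm_nonneg (b - b')]
    have h5 : ∀ v : E, ‖r • v‖ ≤ ‖v‖ := by
      intro v
      rw [norm_smul, Real.norm_of_nonneg hr0]
      nlinarith [norm_nonneg v]
    have h6 : ‖c - a‖ ≤ ‖b - a‖ := by rw [hc, add_sub_cancel_left]; exact h5 _
    have h7 : ‖c' - a'‖ ≤ ‖b' - a'‖ := by rw [hc', add_sub_cancel_left]; exact h5 _
    have h8 : ‖(c - a) - (c' - a')‖ ≤ ‖(b - a) - (b' - a')‖ := by
      rw [hc', hc, add_sub_cancel_left, add_sub_cancel_left, ← smul_sub]; exact h5 _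
    have h9 : ‖fderiv ℝ g c - fderiv ℝ g a‖ ≤ M * ‖b - a‖ := (h.lip a c).trans (by gcongr)
    have h10 : ‖(fderiv ℝ g c - fderiv ℝ g a) - (fderiv ℝ g c' - fderiv ℝ g a')‖ ≤
        M * (‖(b - a) - (b' - a')‖ +
        (2 * ‖a - a'‖ + ‖b - b'‖) * (‖b - a‖ + ‖b' - a'‖)) := by
      refine (h.four a c a' c').trans ?_
      have h11 : ‖a - a'‖ + ‖c - c'‖ ≤ 2 * ‖a - a'‖ + ‖b - b'‖ := by linarith
      gcongr
    refine (norm_add_le_of_le (ContinuousLinearMap.le_of_opNorm_le _ h9 _)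
        (ContinuousLinearMap.le_of_opNorm_le _ h10 _)).trans (le_of_eq ?_)
    ring

theorem tayF_le {M : ℝ} {g : E → F} (hg : Differentiable ℝ g) (h : GoodF M (fderiv ℝ g))
    (a b : E) : ‖tayF g a b‖ ≤ M * ‖b - a‖ ^ 2 := by
  have := tayF_four hg h a b a a
  simp only [tayF, sub_self, map_zero, sub_zero, norm_zero, mul_zero, add_zero, sub_self] at this ⊢
  rw [sq]; exact this
end good

/-- The `γ`-th power of the length of the grid interval `[p h, q h]`. -/
def om (γ h : ℝ) (p q : ℕ) : ℝ := (((q : ℝ) - p) * h) ^ γ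

theorem om_nonneg {γ h : ℝ} (hh : 0 < h) {p q : ℕ} (hpq : p ≤ q) : 0 ≤ om γ h p q := by
  have : (p : ℝ) ≤ q := by exact_mod_cast hpq
  exact Real.rpow_nonneg (mul_nonneg (by linarith) hh.le) _

theorem om_mono {γ h : ℝ} (hγ : 0 < γ) (hh : 0 < h) {p q P Q : ℕ} (h1 : P ≤ p) (hpq : p ≤ q)
    (h2 : q ≤ Q) : om γ h p q ≤ om γ h P Q := by
  have a1 : (p : ℝ) ≤ q := by exact_mod_cast hpq
  have a2 : (P : ℝ) ≤ p := by exact_mod_cast h1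
  have a3 : (q : ℝ) ≤ Q := by exact_mod_cast h2
  refine Real.rpow_le_rpow (mul_nonneg (by linarith) hh.le) ?_ hγ.le
  exact mul_le_mul_of_nonneg_right (by linarith) hh.le

theorem om_half {γ h : ℝ} (hγ : 0 < γ) (hh : 0 < h) {p q p' q' : ℕ} (hpq : p' ≤ q')
    (h2 : 2 * (q' - p') ≤ q - p) (hpq2 : p ≤ q) :
    om γ h p' q' ≤ (1 / 2 : ℝ) ^ γ * om γ h p q := by
  have a1 : (p' : ℝ) ≤ q' := by exact_mod_cast hpq
  have a0 : (p : ℝ) ≤ q := by exact_mod_cast hpq2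
  have a2 : 2 * ((q' : ℝ) - p') ≤ q - p := by
    have : 2 * q' + p ≤ q + 2 * p' := by omega
    have : (2 : ℝ) * q' + p ≤ q + 2 * p' := by exact_mod_cast this
    linarith
  unfold om
  rw [← Real.mul_rpow (by norm_num) (mul_nonneg (by linarith) hh.le)]
  refine Real.rpow_le_rpow (mul_nonneg (by linarith) hh.le) ?_ hγ.le
  nlinarith

set_option maxHeartbeats 1000000 in
theorem sewing {F : Type*} [NormedAddCommGroup F] (γ : ℝ) (hγ : 1 / 3 < γ) :
    ∃ κ > 0, ∃ A : ℝ, 0 ≤ A ∧ ∀ (J : ℕ → ℕ → F) (h K1 K2 : ℝ) (P Q : ℕ), 0 < h → 0 ≤ K1 → 0 ≤ K2 →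
      K2 * om γ h P Q ≤ κ →
      (∀ p u q, P ≤ p → p ≤ u → u ≤ q → q ≤ Q → ‖J p q - J p u - J u q‖ ≤
        K1 * om γ h p q ^ 3 + K2 * om γ h p q * ‖J p u‖) →
      ∀ p q, P ≤ p → p ≤ q → q ≤ Q →
        ‖J p q‖ ≤ A * K1 * om γ h p q ^ 3 + 2 * ∑ k ∈ Finset.Ico p q, ‖J k (k + 1)‖ := by
  have hγ0 : 0 < γ := by linarith
  obtain ⟨σ, hσ⟩ : ∃ σ : ℝ, σ = (1 / 2 : ℝ) ^ γ := ⟨_, rfl⟩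
  have hσ0 : 0 < σ := hσ ▸ Real.rpow_pos_of_pos (by norm_num) _
  have hσ1 : σ < 1 := hσ ▸ Real.rpow_lt_one (by norm_num) (by norm_num) hγ0
  have hσ3 : σ ^ 3 < 1 / 2 := by
    rw [hσ, ← Real.rpow_natCast, ← Real.rpow_mul (by norm_num)]
    have := Real.rpow_lt_rpow_of_exponent_gt (x := (1 / 2 : ℝ)) (by norm_num) (by norm_num)
      (show (1 : ℝ) < γ * (3 : ℕ) by push_cast; linarith)
    rwa [Real.rpow_one] at this
  obtain ⟨ρ, hρ⟩ : ∃ ρ : ℝ, ρ = 2 * σ ^ 3 := ⟨_, rfl⟩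
  have hρ1 : ρ < 1 := by linarith
  have hρ0 : 0 < ρ := by rw [hρ]; positivity
  refine ⟨min ((1 - ρ) / 2) ((1 - σ) / 2), lt_min (by linarith) (by linarith), 4 / (1 - ρ),
    div_nonneg (by norm_num) (by linarith), ?_⟩
  intro J h K1 K2 P Q hh hK1 hK2 hκ hδ
  obtain ⟨A, hA⟩ : ∃ A : ℝ, A = 4 / (1 - ρ) := ⟨_, rfl⟩
  obtain ⟨B, hB⟩ : ∃ B : ℝ, B = 2 * K2 / (1 - σ) := ⟨_, rfl⟩
  have hA' : A * (1 - ρ) = 4 := by rw [hA]; field_simp [show (1 - ρ) ≠ 0 by linarith]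
  have hB' : B * (1 - σ) = 2 * K2 := by rw [hB]; field_simp [show (1 - σ) ≠ 0 by linarith]
  have hA0 : 0 ≤ A := by rw [hA]; exact div_nonneg (by norm_num) (by linarith)
  have hB0 : 0 ≤ B := by rw [hB]; exact div_nonneg (by linarith) (by linarith)
  rw [← hA]
  have hκ1 := hκ.trans (min_le_left _ _)
  have hκ2 := hκ.trans (min_le_right _ _)
  have small : ∀ p q, P ≤ p → p ≤ q → q ≤ Q → K2 * om γ h p q ≤ (1 - ρ) / 2 ∧ B * om γ h p q ≤ 1 := by
    intro p q h1 h2 h3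
    have h4 := mul_le_mul_of_nonneg_left (om_mono hγ0 hh h1 h2 h3) hK2
    refine ⟨h4.trans hκ1, ?_⟩
    have : B * om γ h p q * (1 - σ) ≤ 1 * (1 - σ) := by
      calc B * om γ h p q * (1 - σ) = 2 * (K2 * om γ h p q) := by
            rw [mul_right_comm, hB']; ring
        _ ≤ _ := by linarith
    exact le_of_mul_le_mul_right this (by linarith)
  have main : ∀ N : ℕ, ∀ p q, P ≤ p → p ≤ q → q ≤ Q → q - p ≤ N →
      ‖J p q‖ ≤ A * K1 * om γ h p q ^ 3 +
        (1 + B * om γ h p q) * ∑ k ∈ Finset.Ico p q, ‖J k (k + 1)‖ := by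
    intro N
    induction N using Nat.strong_induction_on with
    | _ N ih =>
    intro p q h1 h2 h3 h4
    have hs0 := om_nonneg (γ := γ) hh h2
    rcases Nat.eq_or_lt_of_le h2 with rfl | hlt
    · have := hδ p p p h1 le_rfl le_rfl h3
      have o0 : om γ h p p = 0 := by simp [om, Real.zero_rpow hγ0.ne']
      simp only [o0] at this ⊢
      simpa using this
    obtain ⟨u, hu⟩ : ∃ u, u = (p + q) / 2 := ⟨_, rfl⟩
    have pu : p ≤ u := by omega
    have uq : u + 1 ≤ q := by omega
    have d1 := hδ p u q h1 pu (by omega) h3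
    have d2 := hδ u (u + 1) q (by omega) (by omega) uq h3
    have hm := om_mono (γ := γ) hγ0 hh pu (show u ≤ q by omega) le_rfl
    have hm0 := om_nonneg (γ := γ) hh (show u ≤ q by omega)
    have i1 := ih (u - p) (by omega) p u h1 pu (by omega) le_rfl
    have i2 := ih (q - (u + 1)) (by omega) (u + 1) q (by omega) uq h3 le_rfl
    have o1 : om γ h p u ≤ σ * om γ h p q := by
      rw [hσ]; exact om_half hγ0 hh pu (by omega) h2
    have o2 : om γ h (u + 1) q ≤ σ * om γ h p q := by
      rw [hσ]; exact om_half hγ0 hh uq (by omega) h2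
    have o10 := om_nonneg (γ := γ) hh pu
    have o20 := om_nonneg (γ := γ) hh uq
    obtain ⟨sm1, sm2⟩ := small p q h1 h2 h3
    have hS : ∑ k ∈ Finset.Ico p q, ‖J k (k + 1)‖ = ∑ k ∈ Finset.Ico p u, ‖J k (k + 1)‖ +
        (‖J u (u + 1)‖ + ∑ k ∈ Finset.Ico (u + 1) q, ‖J k (k + 1)‖) := by
      rw [← Finset.sum_Ico_consecutive _ pu (show u ≤ q by omega),
        Finset.sum_eq_sum_Ico_succ_bot (show u < q by omega)]
    have hS10 : 0 ≤ ∑ k ∈ Finset.Ico p u, ‖J k (k + 1)‖ := Finset.sum_nonneg fun _ _ => norm_nonneg _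
    have hS20 : 0 ≤ ∑ k ∈ Finset.Ico (u + 1) q, ‖J k (k + 1)‖ :=
      Finset.sum_nonneg fun _ _ => norm_nonneg _
    rw [hS]
    generalize ∑ k ∈ Finset.Ico p u, ‖J k (k + 1)‖ = S1 at *
    generalize ∑ k ∈ Finset.Ico (u + 1) q, ‖J k (k + 1)‖ = S2 at *
    have hε := norm_nonneg (J u (u + 1))
    have tri : ‖J p q‖ ≤ ‖J p q - J p u - J u q‖ + ‖J p u‖ +
        (‖J u q - J u (u + 1) - J (u + 1) q‖ + ‖J u (u + 1)‖ + ‖J (u + 1) q‖) := by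
      have e : J p q = (J p q - J p u - J u q) + J p u + ((J u q - J u (u + 1) - J (u + 1) q) +
        J u (u + 1) + J (u + 1) q) := by abel
      calc ‖J p q‖ = _ := congrArg norm e
        _ ≤ _ := by
          refine norm_add_le_of_le (norm_add_le_of_le le_rfl le_rfl)
            (norm_add_le_of_le (norm_add_le_of_le le_rfl le_rfl) le_rfl)
    generalize om γ h p q = s at *
    generalize om γ h u q = s' at *
    generalize om γ h p u = s1 at *
    generalize om γ h (u + 1) q = s2 at *
    generalize ‖J u (u + 1)‖ = ε at *
    have j1 : ‖J p u‖ ≤ A * K1 * (σ * s) ^ 3 + (1 + B * (σ * s)) * S1 := by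
      refine i1.trans ?_; gcongr
    have j2 : ‖J (u + 1) q‖ ≤ A * K1 * (σ * s) ^ 3 + (1 + B * (σ * s)) * S2 := by
      refine i2.trans ?_; gcongr
    have d2' : ‖J u q - J u (u + 1) - J (u + 1) q‖ ≤ K1 * s ^ 3 + K2 * s * ε := by
      refine d2.trans ?_; gcongr
    have n2 := norm_nonneg (J (u + 1) q)
    have n1 := norm_nonneg (J p u)
    generalize ‖J p u‖ = a1 at *
    generalize ‖J (u + 1) q‖ = a2 at *
    have t1 : ‖J p q‖ ≤ (1 + K2 * s) * (a1 + ε + a2) + 2 * K1 * s ^ 3 := by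
      have : 0 ≤ K2 * s * a2 := by positivity
      linarith
    have hη : 0 ≤ K2 * s := by positivity
    have t2 : (1 + K2 * s) * (a1 + ε + a2) ≤
        (1 + K2 * s) * (A * K1 * s ^ 3 * ρ + (1 + B * (σ * s)) * (S1 + (ε + S2))) := by
      refine mul_le_mul_of_nonneg_left ?_ (by linarith)
      have : 0 ≤ B * (σ * s) * ε := by positivity
      rw [hρ]
      linarith
    have t3 : (1 + K2 * s) * (1 + B * (σ * s)) ≤ 1 + B * s := by
      have e1 : K2 * s * (B * (σ * s)) ≤ K2 * s * 1 := by
        refine mul_le_mul_of_nonneg_left ?_ hη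
        calc B * (σ * s) = σ * (B * s) := by ring
          _ ≤ 1 * 1 := mul_le_mul hσ1.le sm2 (by positivity) zero_le_one
          _ = 1 := one_mul 1
      have e2 : B * s - B * (σ * s) = 2 * K2 * s := by rw [← hB']; ring
      linarith
    have t4 : (1 + K2 * s) * ρ * A + 2 ≤ A := by
      have e0 := mul_le_mul_of_nonneg_right sm1 hρ0.le
      have e3 := sq_nonneg (1 - ρ)
      have e1 : (1 + K2 * s) * ρ ≤ (1 + ρ) / 2 := by linarith
      have e2 := mul_le_mul_of_nonneg_right e1 hA0
      linarith
    have t5 := mul_le_mul_of_nonneg_right t3 (show 0 ≤ S1 + (ε + S2) by positivity)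
    have t6 := mul_le_mul_of_nonneg_right t4 (show 0 ≤ K1 * s ^ 3 by positivity)
    linarith
  intro p q h1 h2 h3
  refine (main _ p q h1 h2 h3 le_rfl).trans ?_
  have := (small p q h1 h2 h3).2
  have : (1 + B * om γ h p q) * ∑ k ∈ Finset.Ico p q, ‖J k (k + 1)‖ ≤
    2 * ∑ k ∈ Finset.Ico p q, ‖J k (k + 1)‖ :=
    mul_le_mul_of_nonneg_right (by linarith) (Finset.sum_nonneg fun _ _ => norm_nonneg _)
  linarith

set_option linter.unusedSectionVars false
section davie
variable {E V W : Type*} [NormedAddCommGroup E] [NormedSpace ℝ E]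
  [NormedAddCommGroup V] [NormedSpace ℝ V] [NormedAddCommGroup W] [NormedSpace ℝ W]

/-- Standing assumptions on the coefficient fields. -/
structure CoefB (M : ℝ) (g : E → V →L[ℝ] E) (G : E → W →L[ℝ] E) : Prop where
  one_le : 1 ≤ M
  diff : Differentiable ℝ g
  good : GoodF M g
  goodD : GoodF M (fderiv ℝ g)
  goodG : GoodF M G

/-- The local Milstein remainder. -/
def Jf (g : E → V →L[ℝ] E) (G : E → W →L[ℝ] E) (w₀ w₁ : E) (X : V) (Y : W) : E :=
  w₁ - w₀ - g w₀ X - G w₀ Y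

theorem app_le {A B : Type*} [NormedAddCommGroup A] [NormedSpace ℝ A]
    [NormedAddCommGroup B] [NormedSpace ℝ B] {L : A →L[ℝ] B} {v : A} {p q : ℝ}
    (h1 : ‖L‖ ≤ p) (h2 : ‖v‖ ≤ q) : ‖L v‖ ≤ p * q :=
  (L.le_opNorm v).trans (mul_le_mul h1 h2 (norm_nonneg _) ((norm_nonneg _).trans h1))

theorem delta_one {M : ℝ} {g : E → V →L[ℝ] E} {G : E → W →L[ℝ] E} (H : CoefB M g G)
    {s : ℝ} (hs0 : 0 ≤ s) (hs1 : s ≤ 1) (w₀ w₁ : E) (X₁ X₂ : V) (Y₁ Y₂ : W)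
    (hX1 : ‖X₁‖ ≤ M * s) (hX2 : ‖X₂‖ ≤ M * s) (hY1 : ‖Y₁‖ ≤ M * s ^ 2) (hY2 : ‖Y₂‖ ≤ M * s ^ 2) :
    ‖(g w₁ - g w₀ - fderiv ℝ g w₀ (g w₀ X₁)) X₂ + (G w₁ - G w₀) Y₂‖ ≤
      7 * M ^ 6 * (s ^ 3 + s * ‖Jf g G w₀ w₁ X₁ Y₁‖) := by
  obtain ⟨hM, hd, h1, h2, h3⟩ := H
  have hM0 : 0 ≤ M := by linarith
  set J := Jf g G w₀ w₁ X₁ Y₁ with hJ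
  obtain ⟨v, hv⟩ : ∃ v, v = w₀ + (g w₀ X₁ + G w₀ Y₁) := ⟨_, rfl⟩
  have hw : w₁ - v = J := by rw [hJ, hv, Jf]; abel
  have hs2 : s ^ 2 ≤ s := by nlinarith
  have hgX : ‖g w₀ X₁‖ ≤ M * (M * s) := app_le (h1.bdd _) hX1
  have hGY : ‖G w₀ Y₁‖ ≤ M * (M * s ^ 2) := app_le (h3.bdd _) hY1
  have hvw : ‖v - w₀‖ ≤ 2 * M ^ 2 * s := by
    rw [hv, add_sub_cancel_left]
    refine (norm_add_le_of_le hgX hGY).trans ?_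
    have : M ^ 2 * s ^ 2 ≤ M ^ 2 * s := by gcongr
    linarith
  have hww : ‖w₁ - w₀‖ ≤ 2 * M ^ 2 * s + ‖J‖ := by
    have : w₁ - w₀ = (v - w₀) + (w₁ - v) := by abel
    rw [this, hw]; exact norm_add_le_of_le hvw le_rfl
  have e : g w₁ - g w₀ - fderiv ℝ g w₀ (g w₀ X₁) =
      (g w₁ - g v) + tayF g w₀ v + fderiv ℝ g w₀ (G w₀ Y₁) := by
    rw [tayF, hv, add_sub_cancel_left, map_add]; abel
  have b1 : ‖g w₁ - g w₀ - fderiv ℝ g w₀ (g w₀ X₁)‖ ≤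
      M * ‖J‖ + M * (2 * M ^ 2 * s) ^ 2 + M * (M * (M * s ^ 2)) := by
    rw [e]
    refine norm_add_le_of_le (norm_add_le_of_le ?_ ?_) (app_le (h2.bdd _) hGY)
    · rw [← hw]; exact h1.lip _ _
    · exact (tayF_le hd h2 w₀ v).trans (by gcongr)
  have b2 : ‖G w₁ - G w₀‖ ≤ M * (2 * M ^ 2 * s + ‖J‖) := (h3.lip _ _).trans (by gcongr)
  refine (norm_add_le_of_le (app_le b1 hX2) (app_le b2 hY2)).trans ?_
  have hJ0 := norm_nonneg J
  generalize ‖J‖ = j at *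
  have p2 : M ^ 2 ≤ M ^ 6 := pow_le_pow_right₀ hM (by norm_num)
  have p4 : M ^ 4 ≤ M ^ 6 := pow_le_pow_right₀ hM (by norm_num)
  have q1 : M ^ 2 * (s * j) ≤ M ^ 6 * (s * j) := by gcongr
  have q2 : M ^ 4 * s ^ 3 ≤ M ^ 6 * s ^ 3 := by gcongr
  have q3 : M ^ 2 * (s ^ 2 * j) ≤ M ^ 6 * (s * j) := by gcongr
  have q4 : 0 ≤ M ^ 6 * (s * j) := by positivity
  linarith

theorem delta_two {M : ℝ} {g : E → V →L[ℝ] E} {G : E → W →L[ℝ] E} (H : CoefB M g G)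
    {s e : ℝ} (hs0 : 0 ≤ s) (hs1 : s ≤ 1) (y₀ y₁ z₀ z₁ : E) (X₁ X₂ : V) (Y₁ Y₂ : W)
    (hX1 : ‖X₁‖ ≤ M * s) (hX2 : ‖X₂‖ ≤ M * s) (hY1 : ‖Y₁‖ ≤ M * s ^ 2) (hY2 : ‖Y₂‖ ≤ M * s ^ 2)
    (hy : ‖y₁ - y₀‖ ≤ M * s) (hz : ‖z₁ - z₀‖ ≤ M * s) (hR : ‖z₁ - z₀ - g z₀ X₁‖ ≤ M * s ^ 2)
    (he0 : ‖y₀ - z₀‖ ≤ e) (he1 : ‖y₁ - z₁‖ ≤ e) :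
    ‖((g y₁ - g y₀ - fderiv ℝ g y₀ (g y₀ X₁)) X₂ + (G y₁ - G y₀) Y₂) -
      ((g z₁ - g z₀ - fderiv ℝ g z₀ (g z₀ X₁)) X₂ + (G z₁ - G z₀) Y₂)‖ ≤
      18 * M ^ 5 * (e * s ^ 3 + s * ‖Jf g G y₀ y₁ X₁ Y₁ - Jf g G z₀ z₁ X₁ Y₁‖) := by
  obtain ⟨hM, hd, h1, h2, h3⟩ := H
  have hM0 : 0 ≤ M := by linarith
  have hee : 0 ≤ e := (norm_nonneg _).trans he0
  set J := Jf g G y₀ y₁ X₁ Y₁ - Jf g G z₀ z₁ X₁ Y₁ with hJ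
  have hs2 : s ^ 2 ≤ s := by nlinarith
  have hs3 : s ^ 3 ≤ s ^ 2 := by nlinarith [sq_nonneg s]
  have dg : ‖g y₀ - g z₀‖ ≤ M * e := (h1.lip _ _).trans (by gcongr)
  have dG : ‖G y₀ - G z₀‖ ≤ M * e := (h3.lip _ _).trans (by gcongr)
  have dD : ‖fderiv ℝ g y₀ - fderiv ℝ g z₀‖ ≤ M * e := (h2.lip _ _).trans (by gcongr)
  have hJ0 := norm_nonneg J
  have eta : ‖(y₁ - y₀) - (z₁ - z₀)‖ ≤ 2 * M ^ 2 * e * s + ‖J‖ := by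
    have : (y₁ - y₀) - (z₁ - z₀) = (g y₀ - g z₀) X₁ + (G y₀ - G z₀) Y₁ + J := by
      rw [hJ, Jf, Jf]; simp only [sub_apply]; abel
    rw [this]
    refine (norm_add_le_of_le (norm_add_le_of_le (app_le dg hX1) (app_le dG hY1)) le_rfl).trans ?_
    have : M ^ 2 * e * s ^ 2 ≤ M ^ 2 * e * s := by gcongr
    linarith
  have third : ‖(G y₁ - G y₀) - (G z₁ - G z₀)‖ ≤
      M * ((2 * M ^ 2 * e * s + ‖J‖) + (e + e) * (M * s + M * s)) :=
    (h3.four _ _ _ _).trans (by gcongr)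
  have tay : ‖tayF g y₀ y₁ - tayF g z₀ z₁‖ ≤
      M * ((M * s) * (2 * M ^ 2 * e * s + ‖J‖) + ((2 * M ^ 2 * e * s + ‖J‖) +
        (2 * e + e) * (M * s + M * s)) * (M * s)) :=
    (tayF_four hd h2 _ _ _ _).trans (by gcongr)
  have lin : ‖fderiv ℝ g y₀ (y₁ - y₀ - g y₀ X₁) - fderiv ℝ g z₀ (z₁ - z₀ - g z₀ X₁)‖ ≤
      M * (M * e * (M * s ^ 2) + ‖J‖) + M * e * (M * s ^ 2) := by
    have : fderiv ℝ g y₀ (y₁ - y₀ - g y₀ X₁) - fderiv ℝ g z₀ (z₁ - z₀ - g z₀ X₁) =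
      fderiv ℝ g y₀ ((G y₀ - G z₀) Y₁ + J) +
        (fderiv ℝ g y₀ - fderiv ℝ g z₀) (z₁ - z₀ - g z₀ X₁) := by
      have : (G y₀ - G z₀) Y₁ + J = (y₁ - y₀ - g y₀ X₁) - (z₁ - z₀ - g z₀ X₁) := by
        rw [hJ, Jf, Jf]; simp only [sub_apply]; abel
      rw [this]; simp only [map_sub, sub_apply]; abel
    rw [this]
    exact norm_add_le_of_le (app_le (h2.bdd _) (norm_add_le_of_le (app_le dG hY1) le_rfl))
      (app_le dD hR)
  have first : ‖(g y₁ - g y₀ - fderiv ℝ g y₀ (g y₀ X₁)) - (g z₁ - g z₀ - fderiv ℝ g z₀ (g z₀ X₁))‖ ≤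
      M * ((M * s) * (2 * M ^ 2 * e * s + ‖J‖) + ((2 * M ^ 2 * e * s + ‖J‖) +
        (2 * e + e) * (M * s + M * s)) * (M * s)) +
      (M * (M * e * (M * s ^ 2) + ‖J‖) + M * e * (M * s ^ 2)) := by
    have : (g y₁ - g y₀ - fderiv ℝ g y₀ (g y₀ X₁)) - (g z₁ - g z₀ - fderiv ℝ g z₀ (g z₀ X₁)) =
      (tayF g y₀ y₁ - tayF g z₀ z₁) +
      (fderiv ℝ g y₀ (y₁ - y₀ - g y₀ X₁) - fderiv ℝ g z₀ (z₁ - z₀ - g z₀ X₁)) := by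
      simp only [tayF, map_sub]; abel
    rw [this]
    exact norm_add_le_of_le tay lin
  have fin : ((g y₁ - g y₀ - fderiv ℝ g y₀ (g y₀ X₁)) X₂ + (G y₁ - G y₀) Y₂) -
      ((g z₁ - g z₀ - fderiv ℝ g z₀ (g z₀ X₁)) X₂ + (G z₁ - G z₀) Y₂) =
      ((g y₁ - g y₀ - fderiv ℝ g y₀ (g y₀ X₁)) - (g z₁ - g z₀ - fderiv ℝ g z₀ (g z₀ X₁))) X₂ +
      ((G y₁ - G y₀) - (G z₁ - G z₀)) Y₂ := by
    simp only [sub_apply]; abel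
  rw [fin]
  refine (norm_add_le_of_le (app_le first hX2) (app_le third hY2)).trans ?_
  generalize ‖J‖ = j at *
  have p2 : M ^ 2 ≤ M ^ 5 := pow_le_pow_right₀ hM (by norm_num)
  have p3 : M ^ 3 ≤ M ^ 5 := pow_le_pow_right₀ hM (by norm_num)
  have p4 : M ^ 4 ≤ M ^ 5 := pow_le_pow_right₀ hM (by norm_num)
  have q1 : M ^ 4 * (e * s ^ 3) ≤ M ^ 5 * (e * s ^ 3) := by gcongr
  have q2 : M ^ 3 * (e * s ^ 3) ≤ M ^ 5 * (e * s ^ 3) := by gcongr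
  have q3 : M ^ 2 * (s * j) ≤ M ^ 5 * (s * j) := by gcongr
  have q4 : M ^ 3 * (s ^ 2 * j) ≤ M ^ 5 * (s * j) := by gcongr
  have q5 : M ^ 2 * (s ^ 2 * j) ≤ M ^ 5 * (s * j) := by gcongr
  have q6 : 0 ≤ M ^ 5 * (s * j) := by positivity
  have q7 : 0 ≤ M ^ 5 * (e * s ^ 3) := by positivity
  linarith
end davie

set_option linter.unusedSectionVars false
section davie2
variable {E V W : Type*} [NormedAddCommGroup E] [NormedSpace ℝ E]
  [NormedAddCommGroup V] [NormedSpace ℝ V] [NormedAddCommGroup W] [NormedSpace ℝ W]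

theorem CoefB.mono {M N : ℝ} {g : E → V →L[ℝ] E} {G : E → W →L[ℝ] E} (H : CoefB M g G)
    (h : M ≤ N) : CoefB N g G :=
  ⟨H.one_le.trans h, H.diff, H.good.mono h, H.goodD.mono h, H.goodG.mono h⟩

/-- A discrete rough driver on the grid `0, h, …, n h`. -/
structure DrvB (M γ h : ℝ) (n : ℕ) (g : E → V →L[ℝ] E) (G : E → W →L[ℝ] E)
    (X : ℕ → ℕ → V) (Y : ℕ → ℕ → W) : Prop where
  hpos : 0 < h
  add : ∀ p u q, p ≤ u → u ≤ q → q ≤ n → X p q = X p u + X u q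
  chen : ∀ p u q, p ≤ u → u ≤ q → q ≤ n → ∀ z, G z (Y p q) =
    G z (Y p u) + G z (Y u q) + fderiv ℝ g z (g z (X p u)) (X u q)
  boundX : ∀ p q, p ≤ q → q ≤ n → ‖X p q‖ ≤ M * om γ h p q
  boundY : ∀ p q, p ≤ q → q ≤ n → ‖Y p q‖ ≤ M * om γ h p q ^ 2

theorem DrvB.mono {M N γ h : ℝ} {n : ℕ} {g : E → V →L[ℝ] E} {G : E → W →L[ℝ] E}
    {X : ℕ → ℕ → V} {Y : ℕ → ℕ → W} (D : DrvB M γ h n g G X Y) (hMN : M ≤ N) :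
    DrvB N γ h n g G X Y :=
  ⟨D.hpos, D.add, D.chen, fun p q h1 h2 => (D.boundX p q h1 h2).trans
    (mul_le_mul_of_nonneg_right hMN (om_nonneg D.hpos h1)),
    fun p q h1 h2 => (D.boundY p q h1 h2).trans
    (mul_le_mul_of_nonneg_right hMN (sq_nonneg _))⟩

theorem delta_eq {M γ h : ℝ} {n : ℕ} {g : E → V →L[ℝ] E} {G : E → W →L[ℝ] E}
    {X : ℕ → ℕ → V} {Y : ℕ → ℕ → W} (D : DrvB M γ h n g G X Y) (w : ℕ → E) (p u q : ℕ)
    (h1 : p ≤ u) (h2 : u ≤ q) (h3 : q ≤ n) :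
    Jf g G (w p) (w q) (X p q) (Y p q) - Jf g G (w p) (w u) (X p u) (Y p u) -
      Jf g G (w u) (w q) (X u q) (Y u q) =
    (g (w u) - g (w p) - fderiv ℝ g (w p) (g (w p) (X p u))) (X u q) +
      (G (w u) - G (w p)) (Y u q) := by
  simp only [Jf, D.add p u q h1 h2 h3, D.chen p u q h1 h2 h3, map_add, sub_apply]
  abel

theorem apriori {M γ : ℝ} (hγ : 1 / 3 < γ) {g : E → V →L[ℝ] E} {G : E → W →L[ℝ] E}
    (H : CoefB M g G) : ∃ s₀ : ℝ, 0 < s₀ ∧ s₀ ≤ 1 ∧ ∃ A : ℝ, 0 ≤ A ∧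
    ∀ (h : ℝ) (n : ℕ) (X : ℕ → ℕ → V) (Y : ℕ → ℕ → W), DrvB M γ h n g G X Y →
    ∀ (w : ℕ → E) (p q : ℕ), p ≤ q → q ≤ n → om γ h p q ≤ s₀ →
      ‖Jf g G (w p) (w q) (X p q) (Y p q)‖ ≤ A * om γ h p q ^ 3 +
        2 * ∑ k ∈ Finset.Ico p q, ‖Jf g G (w k) (w (k + 1)) (X k (k + 1)) (Y k (k + 1))‖ := by
  obtain ⟨κ, hκ, A, hA, hS⟩ := sewing (F := E) γ hγ
  have hM := H.one_le
  have hK : 0 < 7 * M ^ 6 := by positivity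
  refine ⟨min 1 (κ / (7 * M ^ 6)), lt_min one_pos (by positivity), min_le_left _ _, A * (7 * M ^ 6),
    by positivity, ?_⟩
  intro h n X Y D w P Q hPQ hQn hom
  have hs1 := hom.trans (min_le_left _ _)
  have hs2 := hom.trans (min_le_right _ _)
  rw [le_div_iff₀ hK, mul_comm] at hs2
  refine hS (fun p q => Jf g G (w p) (w q) (X p q) (Y p q)) h _ _ P Q D.hpos hK.le hK.le hs2 ?_
    P Q le_rfl hPQ le_rfl
  intro p u q h1 h2 h3 h4
  have hγ0 : 0 < γ := by linarith
  rw [delta_eq D w p u q h2 h3 (h4.trans hQn)]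
  have hs0 := om_nonneg (γ := γ) D.hpos (h2.trans h3)
  have m1 := om_mono hγ0 D.hpos le_rfl h2 h3
  have m2 := om_mono hγ0 D.hpos h2 h3 le_rfl
  have n1 := om_nonneg (γ := γ) D.hpos h2
  have n2 := om_nonneg (γ := γ) D.hpos h3
  have hM0 : 0 ≤ M := by linarith
  refine (delta_one H (s := om γ h p q) hs0 ((om_mono hγ0 D.hpos h1 (h2.trans h3) h4).trans hs1)
    _ _ (X p u) _ (Y p u) _ ((D.boundX p u h2 (by omega)).trans (by gcongr))
    ((D.boundX u q h3 (by omega)).trans (by gcongr)) ((D.boundY p u h2 (by omega)).trans (by gcongr))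
    ((D.boundY u q h3 (by omega)).trans (by gcongr))).trans (le_of_eq ?_)
  ring

theorem local_diff {M γ : ℝ} (hγ : 1 / 3 < γ) {g : E → V →L[ℝ] E} {G : E → W →L[ℝ] E}
    (H : CoefB M g G) : ∃ s₀ : ℝ, 0 < s₀ ∧ ∃ C : ℝ, 0 ≤ C ∧
    ∀ (h : ℝ) (n : ℕ) (X : ℕ → ℕ → V) (Y : ℕ → ℕ → W), DrvB M γ h n g G X Y →
    ∀ (y z : ℕ → E) (P Q : ℕ), P ≤ Q → Q ≤ n → om γ h P Q ≤ s₀ →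
      (∀ p q, P ≤ p → p ≤ q → q ≤ Q → ‖y q - y p‖ ≤ M * om γ h p q ∧ ‖z q - z p‖ ≤ M * om γ h p q ∧
        ‖z q - z p - g (z p) (X p q)‖ ≤ M * om γ h p q ^ 2) →
      ‖(y Q - z Q) - (y P - z P)‖ ≤ C * ((∑ k ∈ Finset.Ico P Q,
        ‖Jf g G (y k) (y (k + 1)) (X k (k + 1)) (Y k (k + 1)) -
          Jf g G (z k) (z (k + 1)) (X k (k + 1)) (Y k (k + 1))‖) + om γ h P Q * ‖y P - z P‖) := by
  obtain ⟨κ, hκ, A, hA, hS⟩ := sewing (F := E) γ hγ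
  have hM := H.one_le
  have hM0 : 0 ≤ M := by linarith
  obtain ⟨K, hKd⟩ : ∃ K, K = 18 * M ^ 5 := ⟨_, rfl⟩
  have hK : 0 < K := by rw [hKd]; positivity
  refine ⟨min 1 (min (κ / K) (1 / (2 * (A * K + 1)))), by positivity,
    2 * M ^ 2 + 2 * (A * K) * (1 + 2 * M ^ 2) + 4, by positivity, ?_⟩
  intro h n X Y D y z P Q hPQ hQn hom hyz
  have hγ0 : 0 < γ := by linarith
  have hs1 := hom.trans (min_le_left _ _)
  have hs2 := (hom.trans (min_le_right _ _)).trans (min_le_left _ _)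
  have hs3 := (hom.trans (min_le_right _ _)).trans (min_le_right _ _)
  rw [le_div_iff₀ hK, mul_comm] at hs2
  rw [le_div_iff₀ (by positivity)] at hs3
  have hs0 := om_nonneg (γ := γ) D.hpos hPQ
  obtain ⟨m, hm, hmax⟩ := Finset.exists_max_image (Finset.Icc P Q) (fun k => ‖y k - z k‖)
    ⟨P, Finset.mem_Icc.2 ⟨le_rfl, hPQ⟩⟩
  rw [Finset.mem_Icc] at hm
  obtain ⟨e, he⟩ : ∃ e, e = ‖y m - z m‖ := ⟨_, rfl⟩
  have hmax' : ∀ k, P ≤ k → k ≤ Q → ‖y k - z k‖ ≤ e := fun k h1 h2 => by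
    rw [he]; exact hmax k (Finset.mem_Icc.2 ⟨h1, h2⟩)
  have he0 : 0 ≤ e := by rw [he]; positivity
  have main := hS (fun p q => Jf g G (y p) (y q) (X p q) (Y p q) - Jf g G (z p) (z q) (X p q) (Y p q))
    h (K * e) K P Q D.hpos (by positivity) hK.le hs2 ?_
  · beta_reduce at main
    have hSn : ∀ p q, 0 ≤ ∑ k ∈ Finset.Ico p q, ‖Jf g G (y k) (y (k + 1)) (X k (k + 1)) (Y k (k + 1)) -
          Jf g G (z k) (z (k + 1)) (X k (k + 1)) (Y k (k + 1))‖ := fun p q =>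
      Finset.sum_nonneg fun _ _ => norm_nonneg _
    obtain ⟨S, hSd⟩ : ∃ S, S = ∑ k ∈ Finset.Ico P Q,
      ‖Jf g G (y k) (y (k + 1)) (X k (k + 1)) (Y k (k + 1)) -
          Jf g G (z k) (z (k + 1)) (X k (k + 1)) (Y k (k + 1))‖ := ⟨_, rfl⟩
    have hS0 : 0 ≤ S := by rw [hSd]; exact hSn _ _
    have inc : ∀ q, P ≤ q → q ≤ Q → ‖(y q - z q) - (y P - z P)‖ ≤
        2 * M ^ 2 * ‖y P - z P‖ * om γ h P Q + A * (K * e) * om γ h P Q + 2 * S := by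
      intro q h1 h2
      have e1 : (y q - z q) - (y P - z P) = (g (y P) - g (z P)) (X P q) + (G (y P) - G (z P)) (Y P q)
        + (Jf g G (y P) (y q) (X P q) (Y P q) - Jf g G (z P) (z q) (X P q) (Y P q)) := by
        simp only [Jf, sub_apply]; abel
      have o0 := om_nonneg (γ := γ) D.hpos h1
      have o1 := om_mono hγ0 D.hpos le_rfl h1 h2
      have o2 : om γ h P q ^ 2 ≤ om γ h P Q := by
        calc om γ h P q ^ 2 ≤ om γ h P Q ^ 2 := by gcongr
          _ ≤ om γ h P Q := by nlinarith
      have o3 : om γ h P q ^ 3 ≤ om γ h P Q := by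
        calc om γ h P q ^ 3 ≤ om γ h P Q ^ 3 := by gcongr
          _ ≤ om γ h P Q := pow_le_of_le_one hs0 hs1 (by norm_num)
      have hSq : ∑ k ∈ Finset.Ico P q, ‖Jf g G (y k) (y (k + 1)) (X k (k + 1)) (Y k (k + 1)) -
          Jf g G (z k) (z (k + 1)) (X k (k + 1)) (Y k (k + 1))‖ ≤ S := by
        rw [hSd]
        exact Finset.sum_le_sum_of_subset_of_nonneg (Finset.Ico_subset_Ico_right h2)
          fun _ _ _ => norm_nonneg _
      have b1 := app_le (H.good.lip (z P) (y P)) (D.boundX P q h1 (by omega))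
      have b2 := app_le (H.goodG.lip (z P) (y P)) (D.boundY P q h1 (by omega))
      have b3 := main P q le_rfl h1 h2
      rw [e1]
      refine (norm_add_le_of_le (norm_add_le_of_le b1 b2) b3).trans ?_
      have c1 : M * ‖y P - z P‖ * (M * om γ h P q) ≤ M * ‖y P - z P‖ * (M * om γ h P Q) := by gcongr
      have c2 : M * ‖y P - z P‖ * (M * om γ h P q ^ 2) ≤ M * ‖y P - z P‖ * (M * om γ h P Q) := by
        gcongr
      have c3 : A * (K * e) * om γ h P q ^ 3 ≤ A * (K * e) * om γ h P Q := by gcongr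
      linarith
    have im := inc m hm.1 hm.2
    have iQ := inc Q hPQ le_rfl
    rw [← hSd]
    have tri : e ≤ ‖(y m - z m) - (y P - z P)‖ + ‖y P - z P‖ := by
      rw [he]; simpa using norm_add_le ((y m - z m) - (y P - z P)) (y P - z P)
    have hp0 := norm_nonneg (y P - z P)
    generalize om γ h P Q = s at *
    generalize ‖y P - z P‖ = ε at *
    have hAK : 0 ≤ A * K := by positivity
    have f1 : A * K * s ≤ 1 / 2 := by nlinarith
    have f2 : A * (K * e) * s ≤ e / 2 := by
      have := mul_le_mul_of_nonneg_right f1 he0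
      linarith
    have f3 : 2 * M ^ 2 * ε * s ≤ 2 * M ^ 2 * ε := mul_le_of_le_one_right (by positivity) hs1
    have f4 : e ≤ 2 * (1 + 2 * M ^ 2) * ε + 4 * S := by linarith
    have f5 : A * (K * e) * s ≤ A * K * s * (2 * (1 + 2 * M ^ 2) * ε + 4 * S) := by
      calc A * (K * e) * s = A * K * s * e := by ring
        _ ≤ _ := by gcongr
    have f6 : A * K * s * (4 * S) ≤ 1 / 2 * (4 * S) := by gcongr
    have f7 : 0 ≤ (2 * M ^ 2 + 2 * (A * K) * (1 + 2 * M ^ 2)) * S := by positivity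
    have f8 : 0 ≤ s * ε := by positivity
    linarith
  intro p u q h1 h2 h3 h4
  have hs0 := om_nonneg (γ := γ) D.hpos (h2.trans h3)
  have m1 := om_mono hγ0 D.hpos le_rfl h2 h3
  have m2 := om_mono hγ0 D.hpos h2 h3 le_rfl
  have n1 := om_nonneg (γ := γ) D.hpos h2
  have n2 := om_nonneg (γ := γ) D.hpos h3
  obtain ⟨a1, a2, a3⟩ := hyz p u h1 h2 (by omega)
  have d1 := delta_eq D y p u q h2 h3 (h4.trans hQn)
  have d2 := delta_eq D z p u q h2 h3 (h4.trans hQn)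
  have e1 : ∀ a b c a' b' c' : E, (a - a') - (b - b') - (c - c') = (a - b - c) - (a' - b' - c') := by
    intros; abel
  rw [e1, d1, d2]
  refine (delta_two H (s := om γ h p q) (e := e) hs0
    ((om_mono hγ0 D.hpos h1 (h2.trans h3) h4).trans hs1)
    _ _ _ _ (X p u) _ (Y p u) _ ((D.boundX p u h2 (by omega)).trans (by gcongr))
    ((D.boundX u q h3 (by omega)).trans (by gcongr)) ((D.boundY p u h2 (by omega)).trans (by gcongr))
    ((D.boundY u q h3 (by omega)).trans (by gcongr)) (a1.trans (by gcongr)) (a2.trans (by gcongr))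
    (a3.trans (by gcongr)) (hmax' _ h1 (by omega)) (hmax' _ (by omega) (by omega))).trans
      (le_of_eq ?_)
  rw [← hKd]
  ring
end davie2

set_option linter.unusedSectionVars false
section davie3
variable {E V W : Type*} [NormedAddCommGroup E] [NormedSpace ℝ E]
  [NormedAddCommGroup V] [NormedSpace ℝ V] [NormedAddCommGroup W] [NormedSpace ℝ W]

theorem om_le_T {γ h T : ℝ} (hγ : 0 < γ) (hh : 0 < h) {n : ℕ} (hn : (n : ℝ) * h ≤ T)
    {p q : ℕ} (hpq : p ≤ q) (hq : q ≤ n) : om γ h p q ≤ T ^ γ := by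
  have a1 : (p : ℝ) ≤ q := by exact_mod_cast hpq
  have a2 : (q : ℝ) ≤ n := by exact_mod_cast hq
  have a3 : (0 : ℝ) ≤ p := by positivity
  refine Real.rpow_le_rpow (mul_nonneg (by linarith) hh.le) ?_ hγ.le
  refine (mul_le_mul_of_nonneg_right (by linarith) hh.le).trans hn

theorem patch {γ T s₁ C : ℝ} (hγ : 0 < γ) (hT : 0 < T) (hs : 0 < s₁) (hC : 0 ≤ C) :
    ∃ C' : ℝ, 0 ≤ C' ∧ ∀ (h : ℝ) (n : ℕ), 0 < h → (n : ℝ) * h ≤ T → ∀ (e : ℕ → E) (m : ℕ → ℝ),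
      (∀ k, 0 ≤ m k) →
      (∀ p q, p ≤ q → q ≤ n → (om γ h p q ≤ s₁ ∨ q = p + 1) →
        ‖e q - e p‖ ≤ C * ((∑ k ∈ Finset.Ico p q, m k) + om γ h p q * ‖e p‖)) →
      ∀ p q, p ≤ q → q ≤ n →
        ‖e q - e p‖ ≤ C' * ((∑ k ∈ Finset.Ico p q, m k) + om γ h p q * ‖e p‖) := by
  obtain ⟨T₁, hT1d⟩ : ∃ T₁ : ℝ, T₁ = s₁ ^ (1 / γ) := ⟨_, rfl⟩
  have hT1 : 0 < T₁ := hT1d ▸ Real.rpow_pos_of_pos hs _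
  have hT1s : T₁ ^ γ = s₁ := by
    rw [hT1d, ← Real.rpow_mul hs.le, one_div, inv_mul_cancel₀ hγ.ne', Real.rpow_one]
  obtain ⟨D, hD⟩ : ∃ D : ℝ, D = 1 + C * (1 + T ^ γ) := ⟨_, rfl⟩
  have hTγ : 0 < T ^ γ := Real.rpow_pos_of_pos hT _
  have hD1 : 1 ≤ D := by
    have : 0 ≤ C * (1 + T ^ γ) := by positivity
    linarith
  have hD0 : 0 ≤ D := by linarith
  obtain ⟨N₀, hN0⟩ : ∃ N₀ : ℕ, N₀ = ⌈2 * T / T₁⌉₊ := ⟨_, rfl⟩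
  refine ⟨C + (D ^ (N₀ + 1) + 1) * (1 + 1 / s₁), by positivity, ?_⟩
  intro h n hh hn e m hm hloc
  have small : ∀ p q : ℕ, p ≤ q → ((q : ℝ) - p) * h ≤ T₁ → om γ h p q ≤ s₁ := by
    intro p q hpq hle
    have a1 : (p : ℝ) ≤ q := by exact_mod_cast hpq
    rw [← hT1s]
    exact Real.rpow_le_rpow (mul_nonneg (by linarith) hh.le) hle hγ.le
  have Sn : ∀ p q, 0 ≤ ∑ k ∈ Finset.Ico p q, m k := fun p q => Finset.sum_nonneg fun k _ => hm k
  have one : ∀ p q, p ≤ q → q ≤ n → (om γ h p q ≤ s₁ ∨ q = p + 1) →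
      ‖e q‖ ≤ D * (‖e p‖ + ∑ k ∈ Finset.Ico p q, m k) := by
    intro p q h1 h2 h3
    have a := hloc p q h1 h2 h3
    have b := om_le_T hγ hh hn h1 h2
    have c : ‖e q‖ ≤ ‖e q - e p‖ + ‖e p‖ := by simpa using norm_add_le (e q - e p) (e p)
    have d : om γ h p q * ‖e p‖ ≤ T ^ γ * ‖e p‖ := by gcongr
    have f := mul_le_mul_of_nonneg_left d hC
    have n0 := norm_nonneg (e p)
    have s0 := Sn p q
    have g1 : 0 ≤ C * ‖e p‖ := by positivity
    have g2 : 0 ≤ C * T ^ γ * ∑ k ∈ Finset.Ico p q, m k := by positivity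
    rw [hD]
    linarith
  have ind : ∀ N p q : ℕ, p ≤ q → q ≤ n → ((q : ℝ) - p) * h ≤ N * (T₁ / 2) →
      ‖e q‖ ≤ D ^ (N + 1) * (‖e p‖ + ∑ k ∈ Finset.Ico p q, m k) := by
    intro N
    induction N with
    | zero =>
      intro p q h1 h2 h3
      rw [zero_add, pow_one]
      refine one p q h1 h2 (Or.inl (small p q h1 ?_))
      simp only [Nat.cast_zero, zero_mul] at h3
      linarith
    | succ N ih =>
      intro p q h1 h2 h3
      have s0 := Sn p q
      have weak : D * (‖e p‖ + ∑ k ∈ Finset.Ico p q, m k) ≤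
          D ^ (N + 1 + 1) * (‖e p‖ + ∑ k ∈ Finset.Ico p q, m k) := by
        have : D ^ 1 ≤ D ^ (N + 1 + 1) := pow_le_pow_right₀ hD1 (by omega)
        rw [pow_one] at this
        have n0 := norm_nonneg (e p)
        gcongr
      obtain ⟨f, hf⟩ : ∃ f : ℕ, f = ⌊T₁ / h⌋₊ := ⟨_, rfl⟩
      have hfle : (f : ℝ) * h ≤ T₁ := by
        have := Nat.floor_le (show 0 ≤ T₁ / h by positivity)
        rw [← hf, le_div_iff₀ hh] at this
        exact this
      have hflt : T₁ < (f + 1 : ℝ) * h := by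
        have := Nat.lt_floor_add_one (T₁ / h)
        rwa [← hf, div_lt_iff₀ hh] at this
      have localok : ∀ q', p ≤ q' → q' ≤ p + max 1 f → om γ h p q' ≤ s₁ ∨ q' = p + 1 := by
        intro q' h4 h5
        by_cases hq : q' ≤ p + f
        · left
          refine small p q' h4 (le_trans ?_ hfle)
          have : (q' : ℝ) ≤ p + f := by exact_mod_cast hq
          exact mul_le_mul_of_nonneg_right (by linarith) hh.le
        · right; omega
      by_cases hq : q ≤ p + max 1 f
      · exact (one p q h1 h2 (localok q h1 hq)).trans weak
      · push Not at hq
        obtain ⟨u, hu⟩ : ∃ u : ℕ, u = p + max 1 f := ⟨_, rfl⟩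
        have pu : p ≤ u := by omega
        have uq : u ≤ q := by omega
        have i1 := one p u pu (by omega) (localok u pu hu.le)
        have hlen : T₁ / 2 ≤ ((u : ℝ) - p) * h := by
          have : f + 1 ≤ 2 * (max 1 f) := by omega
          have h5 : (f : ℝ) + 1 ≤ 2 * ((max 1 f : ℕ) : ℝ) := by exact_mod_cast this
          have h6 : (u : ℝ) - p = ((max 1 f : ℕ) : ℝ) := by rw [hu]; push_cast; ring
          rw [h6]
          have := mul_le_mul_of_nonneg_right h5 hh.le
          linarith
        have i2 := ih u q uq h2 (by push_cast at h3; linarith)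
        rw [← Finset.sum_Ico_consecutive _ pu uq] at *
        have s1 := Sn p u
        have s2 := Sn u q
        refine i2.trans ?_
        rw [pow_succ D (N + 1), mul_assoc]
        refine mul_le_mul_of_nonneg_left ?_ (by positivity)
        have : 0 ≤ (D - 1) * ∑ k ∈ Finset.Ico u q, m k := mul_nonneg (by linarith) s2
        linarith
  intro p q h1 h2
  have s0 := Sn p q
  have n0 := norm_nonneg (e p)
  have o0 := om_nonneg (γ := γ) hh h1
  by_cases hsm : om γ h p q ≤ s₁
  · refine (hloc p q h1 h2 (Or.inl hsm)).trans ?_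
    have : 0 ≤ (D ^ (N₀ + 1) + 1) * (1 + 1 / s₁) := by positivity
    gcongr
    linarith
  · push Not at hsm
    have hN : ((q : ℝ) - p) * h ≤ N₀ * (T₁ / 2) := by
      have a2 : (q : ℝ) ≤ n := by exact_mod_cast h2
      have a3 : (0 : ℝ) ≤ p := by positivity
      have b : ((q : ℝ) - p) * h ≤ T :=
        (mul_le_mul_of_nonneg_right (by linarith) hh.le).trans hn
      have c := Nat.le_ceil (2 * T / T₁)
      rw [← hN0, div_le_iff₀ hT1] at c
      linarith
    have i := ind N₀ p q h1 h2 hN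
    have tri := norm_sub_le (e q) (e p)
    have hd0 : 0 ≤ D ^ (N₀ + 1) := by positivity
    generalize D ^ (N₀ + 1) = d at *
    generalize ∑ k ∈ Finset.Ico p q, m k = S at *
    generalize om γ h p q = s at *
    generalize ‖e p‖ = ε at *
    have e1 : ε ≤ 1 / s₁ * (s * ε) := by
      rw [one_div, inv_mul_eq_div, le_div_iff₀ hs]
      nlinarith
    have e2 := mul_le_mul_of_nonneg_left e1 (show 0 ≤ d + 1 by linarith)
    have e3 : 0 ≤ C * (S + s * ε) := by positivity
    have e4 : 0 ≤ (d + 1) * (1 / s₁) * S := by positivity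
    have e5 : 0 ≤ (d + 1) * (s * ε) := by positivity
    linarith

theorem discrete_main {M γ T s₀ A : ℝ} (hγ : 1 / 3 < γ) (hT : 0 < T) (hs₀ : 0 < s₀) (hA : 0 ≤ A)
    {g : E → V →L[ℝ] E} {G : E → W →L[ℝ] E} (H : CoefB M g G) : ∃ C : ℝ, 0 ≤ C ∧
    ∀ (h : ℝ) (n : ℕ) (X : ℕ → ℕ → V) (Y : ℕ → ℕ → W), (n : ℝ) * h ≤ T → DrvB M γ h n g G X Y →
    ∀ (y z : ℕ → E), (∀ k < n, Jf g G (z k) (z (k + 1)) (X k (k + 1)) (Y k (k + 1)) = 0) →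
    (∀ p q, p ≤ q → q ≤ n → om γ h p q ≤ s₀ →
      ‖Jf g G (y p) (y q) (X p q) (Y p q)‖ ≤ A * om γ h p q ^ 3) →
    ∀ p q, p ≤ q → q ≤ n →
      ‖(y q - z q) - (y p - z p)‖ ≤ C * ((∑ k ∈ Finset.Ico p q,
        ‖Jf g G (y k) (y (k + 1)) (X k (k + 1)) (Y k (k + 1))‖) + om γ h p q * ‖y p - z p‖) := by
  have hγ0 : 0 < γ := by linarith
  obtain ⟨s₁, hs₁, hs₁1, A', hA', hz⟩ := apriori hγ H
  have hM := H.one_le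
  have hM0 : 0 ≤ M := by linarith
  obtain ⟨N, hN⟩ : ∃ N : ℝ, N = M + 2 * M ^ 2 + A + A' := ⟨_, rfl⟩
  have hM2 : 0 ≤ M ^ 2 := by positivity
  have hMN : M ≤ N := by linarith
  obtain ⟨s₂, hs₂, C₁, hC₁, hl⟩ := local_diff hγ (H.mono hMN)
  have hTγ : 0 < T ^ γ := Real.rpow_pos_of_pos hT _
  obtain ⟨C', hC', hp⟩ := patch (E := E) (s₁ := min s₀ (min s₁ s₂))
    (C := C₁ + (M ^ 2 * (1 + T ^ γ) + 1)) hγ0 hT (by positivity) (by positivity)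
  refine ⟨C', hC', ?_⟩
  intro h n X Y hn D y z hz0 hy
  refine hp h n D.hpos hn (fun k => y k - z k) _ (fun k => norm_nonneg _) ?_
  intro P Q hPQ hQn hor
  have hS0 : 0 ≤ ∑ k ∈ Finset.Ico P Q,
        ‖Jf g G (y k) (y (k + 1)) (X k (k + 1)) (Y k (k + 1))‖ :=
    Finset.sum_nonneg fun _ _ => norm_nonneg _
  have ho0 := om_nonneg (γ := γ) D.hpos hPQ
  have hn0 := norm_nonneg (y P - z P)
  have hon : 0 ≤ om γ h P Q * ‖y P - z P‖ := mul_nonneg ho0 hn0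
  rcases hor with hom | rfl
  · have h0 := hom.trans (min_le_left _ _)
    have h1 := (hom.trans (min_le_right _ _)).trans (min_le_left _ _)
    have h2 := (hom.trans (min_le_right _ _)).trans (min_le_right _ _)
    have gen : ∀ (w : ℕ → E) (B : ℝ), 0 ≤ B → (∀ p q, P ≤ p → p ≤ q → q ≤ Q →
        ‖Jf g G (w p) (w q) (X p q) (Y p q)‖ ≤ B * om γ h p q ^ 3) →
        ∀ p q, P ≤ p → p ≤ q → q ≤ Q → ‖w q - w p‖ ≤ (2 * M ^ 2 + B) * om γ h p q ∧
        ‖w q - w p - g (w p) (X p q)‖ ≤ (2 * M ^ 2 + B) * om γ h p q ^ 2 := by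
      intro w B hB hJ p q h3 h4 h5
      have o0 := om_nonneg (γ := γ) D.hpos h4
      have o1 : om γ h p q ≤ 1 := ((om_mono hγ0 D.hpos h3 h4 h5).trans h1).trans hs₁1
      have o2 : om γ h p q ^ 2 ≤ om γ h p q := pow_le_of_le_one o0 o1 (by norm_num)
      have o3 : om γ h p q ^ 3 ≤ om γ h p q ^ 2 := pow_le_pow_of_le_one o0 o1 (by norm_num)
      have b1 := app_le (H.good.bdd (w p)) (D.boundX p q h4 (by omega))
      have b2 := app_le (H.goodG.bdd (w p)) (D.boundY p q h4 (by omega))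
      have b3 := hJ p q h3 h4 h5
      have r : ‖w q - w p - g (w p) (X p q)‖ ≤ (M ^ 2 + B) * om γ h p q ^ 2 := by
        have e1 : w q - w p - g (w p) (X p q) =
          G (w p) (Y p q) + Jf g G (w p) (w q) (X p q) (Y p q) := by rw [Jf]; abel
        rw [e1]
        refine (norm_add_le_of_le b2 b3).trans ?_
        have := mul_le_mul_of_nonneg_left o3 hB
        linarith
      constructor
      · have e1 : w q - w p = g (w p) (X p q) + (w q - w p - g (w p) (X p q)) := by abel
        rw [e1]
        refine (norm_add_le_of_le b1 r).trans ?_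
        have := mul_le_mul_of_nonneg_left o2 (show 0 ≤ M ^ 2 + B by linarith)
        linarith
      · refine r.trans ?_
        have : 0 ≤ M ^ 2 * om γ h p q ^ 2 := by positivity
        linarith
    have gy := gen y A hA fun p q h3 h4 h5 => hy p q h4 (by omega)
      ((om_mono hγ0 D.hpos h3 h4 h5).trans h0)
    have gz := gen z A' hA' fun p q h3 h4 h5 => by
      refine (hz h n X Y D z p q h4 (by omega) ((om_mono hγ0 D.hpos h3 h4 h5).trans h1)).trans ?_
      rw [Finset.sum_eq_zero]
      · simp
      · intro k hk
        rw [Finset.mem_Ico] at hk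
        rw [hz0 k (by omega), norm_zero]
    have main := hl h n X Y (D.mono hMN) y z P Q hPQ hQn h2 (fun p q h3 h4 h5 => by
      have o0 := om_nonneg (γ := γ) D.hpos h4
      refine ⟨(gy p q h3 h4 h5).1.trans ?_, (gz p q h3 h4 h5).1.trans ?_,
        (gz p q h3 h4 h5).2.trans ?_⟩
      · exact mul_le_mul_of_nonneg_right (by linarith) o0
      · exact mul_le_mul_of_nonneg_right (by linarith) o0
      · exact mul_le_mul_of_nonneg_right (by linarith) (sq_nonneg _))
    have hsum : ∑ k ∈ Finset.Ico P Q,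
        ‖Jf g G (y k) (y (k + 1)) (X k (k + 1)) (Y k (k + 1)) -
          Jf g G (z k) (z (k + 1)) (X k (k + 1)) (Y k (k + 1))‖ = ∑ k ∈ Finset.Ico P Q,
        ‖Jf g G (y k) (y (k + 1)) (X k (k + 1)) (Y k (k + 1))‖ := by
      refine Finset.sum_congr rfl fun k hk => ?_
      rw [Finset.mem_Ico] at hk
      rw [hz0 k (by omega), sub_zero]
    rw [hsum] at main
    refine main.trans ?_
    have : 0 ≤ M ^ 2 * (1 + T ^ γ) + 1 := by positivity
    gcongr
    linarith
  · have hTo := om_le_T hγ0 D.hpos hn hPQ hQn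
    simp only [Nat.Ico_succ_singleton, Finset.sum_singleton] at hS0 ⊢
    have e1 : (y (P + 1) - z (P + 1)) - (y P - z P) = (g (y P) - g (z P)) (X P (P + 1)) +
        (G (y P) - G (z P)) (Y P (P + 1)) +
        (Jf g G (y P) (y (P + 1)) (X P (P + 1)) (Y P (P + 1)) -
          Jf g G (z P) (z (P + 1)) (X P (P + 1)) (Y P (P + 1))) := by
      simp only [Jf, sub_apply]; abel
    rw [e1, hz0 P (by omega), sub_zero]
    have b1 := app_le (H.good.lip (z P) (y P)) (D.boundX P (P + 1) hPQ hQn)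
    have b2 := app_le (H.goodG.lip (z P) (y P)) (D.boundY P (P + 1) hPQ hQn)
    refine (norm_add_le_of_le (norm_add_le_of_le b1 b2) le_rfl).trans ?_
    generalize om γ h P (P + 1) = s at *
    generalize ‖y P - z P‖ = ε at *
    generalize ‖Jf g G (y P) (y (P + 1)) (X P (P + 1)) (Y P (P + 1))‖ = S at *
    have f1 : M ^ 2 * (s * ε) * s ≤ M ^ 2 * (s * ε) * T ^ γ := by gcongr
    have f2 : 0 ≤ (C₁ + M ^ 2 * (1 + T ^ γ)) * S := by positivity
    have f3 : 0 ≤ (C₁ + 1) * (s * ε) := by positivity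
    linarith
end davie3

theorem good_of_contDiff {E F : Type*} [NormedAddCommGroup E] [NormedSpace ℝ E]
    [NormedAddCommGroup F] [NormedSpace ℝ F] {f : E → F} (hf : ContDiff ℝ 2 f) {B : ℝ}
    (h0 : ∀ z, ‖f z‖ ≤ B) (h1 : ∀ z, ‖iteratedFDeriv ℝ 1 f z‖ ≤ B)
    (h2 : ∀ z, ‖iteratedFDeriv ℝ 2 f z‖ ≤ B) : GoodF B f := by
  replace h1 : ∀ z, ‖fderiv ℝ f z‖ ≤ B := fun z => by
    rw [← norm_iteratedFDeriv_one]; exact h1 z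
  replace h2 : ∀ z, ‖fderiv ℝ (fderiv ℝ f) z‖ ≤ B := fun z => by
    rw [← norm_iteratedFDeriv_one, norm_iteratedFDeriv_fderiv]; exact h2 z
  refine good_of_deriv (hf.differentiable (by norm_num)) h0 h1 fun a b => ?_
  have hd : Differentiable ℝ (fderiv ℝ f) :=
    (hf.fderiv_right (m := 1) (by norm_num)).differentiable (by norm_num)
  exact Convex.norm_image_sub_le_of_norm_fderiv_le (s := univ) (fun x _ => hd x) (fun x _ => h2 x)
      convex_univ (mem_univ _) (mem_univ _)

theorem c3_good {E F : Type*} [NormedAddCommGroup E] [NormedSpace ℝ E]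
    [NormedAddCommGroup F] [NormedSpace ℝ F] {g : E → F} (hg : IsC3Bounded g) :
    ∃ M, GoodF M g ∧ GoodF M (fderiv ℝ g) := by
  obtain ⟨hc, hb⟩ := hg
  obtain ⟨B0, h0⟩ := hb 0 (by norm_num)
  obtain ⟨B1, h1⟩ := hb 1 (by norm_num)
  obtain ⟨B2, h2⟩ := hb 2 (by norm_num)
  obtain ⟨B3, h3⟩ := hb 3 (by norm_num)
  simp only [norm_iteratedFDeriv_zero] at h0
  have e1 : ∀ z, ‖fderiv ℝ g z‖ ≤ B1 := fun z => by rw [← norm_iteratedFDeriv_one]; exact h1 z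
  refine ⟨max (max B0 B1) (max B2 B3), ?_, ?_⟩
  · refine good_of_contDiff (hc.of_le (by norm_num)) (fun z => (h0 z).trans ?_)
      (fun z => (h1 z).trans ?_) (fun z => (h2 z).trans ?_) <;> simp
  · refine good_of_contDiff (hc.fderiv_right (by norm_num)) (fun z => (e1 z).trans ?_)
      (fun z => (norm_iteratedFDeriv_fderiv.trans_le (h2 z)).trans ?_)
      (fun z => (norm_iteratedFDeriv_fderiv.trans_le (h3 z)).trans ?_) <;> simp

/-- The second-order coefficient acting on `ℝ^{l×l}`. -/
def Gc (d l : ℕ) (g : Vec d → Vec l →L[ℝ] Vec d) (z : Vec d) :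
    EuclideanSpace ℝ (Fin l × Fin l) →L[ℝ] Vec d :=
  ∑ i : Fin l, ∑ j : Fin l,
    ContinuousLinearMap.smulRightL ℝ (EuclideanSpace ℝ (Fin l × Fin l)) (Vec d)
      (EuclideanSpace.proj (i, j)) (Dvf d l g i j z)

theorem Gc_apply (d l : ℕ) (g : Vec d → Vec l →L[ℝ] Vec d) (z : Vec d)
    (Y : EuclideanSpace ℝ (Fin l × Fin l)) :
    Gc d l g z Y = ∑ i : Fin l, ∑ j : Fin l, Y (i, j) • Dvf d l g i j z := by
  simp [Gc]

theorem Dvf_eq {d l : ℕ} {g : Vec d → Vec l →L[ℝ] Vec d} (hd : Differentiable ℝ g) (i j : Fin l)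
    (z : Vec d) : Dvf d l g i j z =
      (fderiv ℝ g z (g z (EuclideanSpace.single i (1 : ℝ)))) (EuclideanSpace.single j (1 : ℝ)) := by
  unfold Dvf
  rw [fderiv_clm_apply (hd z) (differentiableAt_const _)]
  simp

theorem coef_exists {d l : ℕ} {g : Vec d → Vec l →L[ℝ] Vec d} (hg : IsC3Bounded g) :
    ∃ M, CoefB M g (Gc d l g) := by
  obtain ⟨M, h1, h2⟩ := c3_good hg
  have hd : Differentiable ℝ g := hg.1.differentiable (by norm_num)
  have h3 : ∀ i j : Fin l, ∃ N, GoodF N (Dvf d l g i j) := by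
    intro i j
    have := ((h2.bilin (h1.clm (ContinuousLinearMap.apply ℝ (Vec d)
      (EuclideanSpace.single i (1 : ℝ)))) (ContinuousLinearMap.id ℝ _)).clm
      (ContinuousLinearMap.apply ℝ (Vec d) (EuclideanSpace.single j (1 : ℝ))))
    have e : Dvf d l g i j = fun z => (fderiv ℝ g z (g z (EuclideanSpace.single i (1 : ℝ))))
        (EuclideanSpace.single j (1 : ℝ)) := funext fun z => Dvf_eq hd i j z
    rw [e]
    exact ⟨_, this⟩
  obtain ⟨N, h4⟩ : ∃ N, GoodF N (Gc d l g) := by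
    unfold Gc
    exact GoodF.sum _ fun i => GoodF.sum _ fun j => by
      obtain ⟨N, hN⟩ := h3 i j
      exact ⟨_, hN.clm _⟩
  refine ⟨max 1 (max M N), le_max_left _ _, hd, h1.mono ?_, h2.mono ?_, h4.mono ?_⟩ <;> simp

/-- The tensor product of two vectors. -/
def tens {l : ℕ} (a b : Vec l) : EuclideanSpace ℝ (Fin l × Fin l) :=
  WithLp.toLp 2 (fun ij => a ij.1 * b ij.2)

theorem Gc_tens {d l : ℕ} {g : Vec d → Vec l →L[ℝ] Vec d} (hd : Differentiable ℝ g) (z : Vec d)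
    (a b : Vec l) : Gc d l g z (tens a b) = fderiv ℝ g z (g z a) b := by
  have ex : ∀ c : Vec l, c = ∑ i, c i • EuclideanSpace.single i (1 : ℝ) := by
    intro c
    ext j
    simp [Pi.single_apply]
  conv_rhs => rw [ex a, ex b]
  rw [Gc_apply]
  simp only [Dvf_eq hd, tens, map_sum, map_smul, sum_apply, smul_apply, Finset.smul_sum,
    Finset.sum_apply, smul_smul]
  rw [Finset.sum_comm]
  refine Finset.sum_congr rfl fun j _ => Finset.sum_congr rfl fun i _ => ?_
  rw [mul_comm]

/-- The Lévy area as a vector. -/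
def Yc {l : ℕ} (x x' : ℝ → Vec l) (s t : ℝ) : EuclideanSpace ℝ (Fin l × Fin l) :=
  WithLp.toLp 2 (fun ij => x2Entry l x x' s t ij.1 ij.2)

theorem Yc_norm {l : ℕ} (x x' : ℝ → Vec l) (s t : ℝ) : ‖Yc x x' s t‖ = x2Norm l x x' s t := by
  rw [EuclideanSpace.norm_eq, x2Norm, Fintype.sum_prod_type]
  simp [Yc]

theorem Psi_eq (d l : ℕ) (g : Vec d → Vec l →L[ℝ] Vec d) (x x' : ℝ → Vec l) (s t : ℝ) (z : Vec d) :
    Psi d l g x x' s t z = z + g z (x t - x s) + Gc d l g z (Yc x x' s t) := by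
  rw [Psi, Gc_apply]; rfl

theorem tens_norm {l : ℕ} (a b : Vec l) : ‖tens a b‖ = ‖a‖ * ‖b‖ := by
  rw [EuclideanSpace.norm_eq, EuclideanSpace.norm_eq, EuclideanSpace.norm_eq,
    ← Real.sqrt_mul (by positivity), Fintype.sum_prod_type, Finset.sum_mul_sum]
  simp [tens, mul_pow]

theorem tens_cont {l : ℕ} {a b : ℝ → Vec l} {s : Set ℝ} (ha : ContinuousOn a s)
    (hb : ContinuousOn b s) : ContinuousOn (fun v => tens (a v) (b v)) s := by
  unfold tens
  refine (PiLp.continuous_toLp 2 _).comp_continuousOn (continuousOn_pi.2 fun ij => ?_)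
  exact ((EuclideanSpace.proj (𝕜 := ℝ) ij.1).continuous.comp_continuousOn ha).mul
    ((EuclideanSpace.proj (𝕜 := ℝ) ij.2).continuous.comp_continuousOn hb)

/-- A nice driving path on `[0,T]`. -/
structure PathS {l : ℕ} (T : ℝ) (x x' : ℝ → Vec l) : Prop where
  cx : ContinuousOn x (Icc 0 T)
  cx' : ContinuousOn x' (Icc 0 T)
  ftc : ∀ s t, 0 ≤ s → s ≤ t → t ≤ T → ∫ v in s..t, x' v = x t - x s

theorem pathS_of {l : ℕ} {T : ℝ} {x x' : ℝ → Vec l} (h : PiecewiseC1 l T x x') :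
    PathS T x x' := by
  obtain ⟨hx, N, τ, h0, hN, hlt, hk⟩ := h
  have key : ∀ k ≤ N, 0 ≤ τ k ∧ ContinuousOn x' (Icc 0 (τ k)) ∧
      ∀ u ∈ Ioo 0 (τ k), u ∉ range τ → HasDerivAt x (x' u) u := by
    intro k
    induction k with
    | zero => intro _; rw [h0]; refine ⟨le_rfl, ?_, ?_⟩ <;> simp
    | succ k ih =>
      intro hkN
      obtain ⟨i1, i2, i3⟩ := ih (by omega)
      obtain ⟨j1, j2⟩ := hk k (by omega)
      have hl := hlt k (by omega)
      refine ⟨by linarith, ?_, ?_⟩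
      · rw [← Icc_union_Icc_eq_Icc i1 hl.le]
        exact i2.union_of_isClosed j1 isClosed_Icc isClosed_Icc
      · intro u hu hr
        rcases lt_trichotomy u (τ k) with h | h | h
        · exact i3 u ⟨hu.1, h⟩ hr
        · exact absurd ⟨k, h.symm⟩ hr
        · exact j2 u ⟨h, hu.2⟩
  obtain ⟨_, k2, k3⟩ := key N le_rfl
  rw [hN] at k2 k3
  refine ⟨hx, k2, fun s t hs hst ht => ?_⟩
  have hsub : Icc s t ⊆ Icc 0 T := Icc_subset_Icc hs ht
  refine MeasureTheory.integral_eq_of_hasDerivAt_off_countable_of_le x x' hst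
    (countable_range τ) (hx.mono hsub) (fun u hu => k3 u ⟨?_, ?_⟩ hu.2) ?_
  · linarith [hu.1.1]
  · linarith [hu.1.2]
  · exact (k2.mono (by rwa [uIcc_of_le hst])).intervalIntegrable

theorem ii_of {E : Type*} [NormedAddCommGroup E] {T s t : ℝ} {f : ℝ → E}
    (hf : ContinuousOn f (Icc 0 T)) (hs : 0 ≤ s) (hst : s ≤ t) (ht : t ≤ T) :
    IntervalIntegrable f volume s t :=
  (hf.mono (by rw [uIcc_of_le hst]; exact Icc_subset_Icc hs ht)).intervalIntegrable

section
variable {l : ℕ} {T : ℝ} {x x' : ℝ → Vec l}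

theorem Yc_int (P : PathS T x x') {s t : ℝ} (hs : 0 ≤ s) (hst : s ≤ t) (ht : t ≤ T) :
    Yc x x' s t = ∫ v in s..t, tens (x v - x s) (x' v) := by
  ext ij
  have := (EuclideanSpace.proj (𝕜 := ℝ) ij : EuclideanSpace ℝ (Fin l × Fin l) →L[ℝ] ℝ).intervalIntegral_comp_comm
    (ii_of (tens_cont (P.cx.sub (continuousOn_const (c := x s))) P.cx') hs hst ht)
  exact this

theorem tens_int (P : PathS T x x') (c : Vec l) {s t : ℝ} (hs : 0 ≤ s) (hst : s ≤ t) (ht : t ≤ T) :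
    ∫ v in s..t, tens c (x' v) = tens c (x t - x s) := by
  rw [← P.ftc s t hs hst ht]
  ext ij
  have := (EuclideanSpace.proj (𝕜 := ℝ) ij : EuclideanSpace ℝ (Fin l × Fin l) →L[ℝ] ℝ).intervalIntegral_comp_comm
    (ii_of (tens_cont (continuousOn_const (c := c)) P.cx') hs hst ht)
  refine this.symm.trans ?_
  have h2 := (EuclideanSpace.proj (𝕜 := ℝ) ij.2 : Vec l →L[ℝ] ℝ).intervalIntegral_comp_comm
    (ii_of P.cx' hs hst ht)
  change ∫ v in s..t, c ij.1 * x' v ij.2 = c ij.1 * (∫ v in s..t, x' v) ij.2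
  rw [intervalIntegral.integral_const_mul]
  congr 1

theorem Yc_chen (P : PathS T x x') {s u t : ℝ} (hs : 0 ≤ s) (hsu : s ≤ u) (hut : u ≤ t)
    (ht : t ≤ T) : Yc x x' s t = Yc x x' s u + Yc x x' u t + tens (x u - x s) (x t - x u) := by
  have c1 : ∀ c, ContinuousOn (fun v => tens (x v - x c) (x' v)) (Icc 0 T) := fun c =>
    tens_cont (P.cx.sub (continuousOn_const (c := x c))) P.cx'
  rw [Yc_int P hs (hsu.trans hut) ht, Yc_int P hs hsu (hut.trans ht),
    Yc_int P (hs.trans hsu) hut ht, ← tens_int P _ (hs.trans hsu) hut ht,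
    ← intervalIntegral.integral_add_adjacent_intervals (ii_of (c1 s) hs hsu (hut.trans ht))
      (ii_of (c1 s) (hs.trans hsu) hut ht), add_assoc, ← intervalIntegral.integral_add
      (ii_of (c1 u) (hs.trans hsu) hut ht) (ii_of (tens_cont (continuousOn_const (c := x u - x s)) P.cx')
      (hs.trans hsu) hut ht)]
  congr 1
  refine intervalIntegral.integral_congr fun v _ => ?_
  ext ij
  simp only [tens, PiLp.add_apply, PiLp.sub_apply]
  ring

theorem Gc_Yc_int {d : ℕ} {g : Vec d → Vec l →L[ℝ] Vec d} (hd : Differentiable ℝ g)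
    (P : PathS T x x') (z : Vec d) {s t : ℝ} (hs : 0 ≤ s) (hst : s ≤ t) (ht : t ≤ T) :
    Gc d l g z (Yc x x' s t) = ∫ v in s..t, fderiv ℝ g z (g z (x v - x s)) (x' v) := by
  have c1 : ContinuousOn (fun v => tens (x v - x s) (x' v)) (Icc 0 T) :=
    tens_cont (P.cx.sub (continuousOn_const (c := x s))) P.cx'
  rw [Yc_int P hs hst ht, ← (Gc d l g z).intervalIntegral_comp_comm (ii_of c1 hs hst ht)]
  simp only [Gc_tens hd]

theorem path_bound (P : PathS T x x') : ∃ L, 0 ≤ L ∧ ∀ t ∈ Icc 0 T, ‖x t‖ ≤ L ∧ ‖x' t‖ ≤ L := by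
  obtain ⟨A, hA⟩ := isCompact_Icc.exists_bound_of_continuousOn P.cx
  obtain ⟨B, hB⟩ := isCompact_Icc.exists_bound_of_continuousOn P.cx'
  refine ⟨max 0 (max A B), le_max_left _ _, fun t ht => ⟨(hA t ht).trans ?_, (hB t ht).trans ?_⟩⟩ <;>
    simp

theorem path_lip (P : PathS T x x') {L : ℝ} (hL : ∀ t ∈ Icc 0 T, ‖x t‖ ≤ L ∧ ‖x' t‖ ≤ L)
    {s t : ℝ} (hs : 0 ≤ s) (hst : s ≤ t) (ht : t ≤ T) :
    ‖x t - x s‖ ≤ L * (t - s) ∧ ‖Yc x x' s t‖ ≤ L ^ 2 * (t - s) ^ 2 := by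
  have hb : ∀ s t, 0 ≤ s → s ≤ t → t ≤ T → ‖x t - x s‖ ≤ L * (t - s) := by
    intro s t hs hst ht
    rw [← P.ftc s t hs hst ht]
    refine (intervalIntegral.norm_integral_le_of_norm_le_const fun v hv => ?_).trans_eq
      (by rw [abs_of_nonneg (by linarith)])
    rw [uIoc_of_le hst] at hv
    exact (hL v ⟨by linarith [hv.1], by linarith [hv.2]⟩).2
  have hL0 : 0 ≤ L := (norm_nonneg _).trans (hL s ⟨hs, by linarith⟩).1
  refine ⟨hb s t hs hst ht, ?_⟩
  rw [Yc_int P hs hst ht]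
  refine (intervalIntegral.norm_integral_le_of_norm_le_const (C := L ^ 2 * (t - s)) fun v hv => ?_).trans_eq
      (by rw [abs_of_nonneg (by linarith)]; ring)
  rw [uIoc_of_le hst] at hv
  rw [tens_norm]
  have h1 := hb s v hs hv.1.le (by linarith [hv.2])
  have h2 := (hL v ⟨by linarith [hv.1], by linarith [hv.2]⟩).2
  have h3 : L * (v - s) ≤ L * (t - s) := mul_le_mul_of_nonneg_left (by linarith [hv.2]) hL0
  calc _ ≤ (L * (t - s)) * L := mul_le_mul (h1.trans h3) h2 (norm_nonneg _)
        (mul_nonneg hL0 (by linarith))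
    _ = _ := by ring

/-- The rough norm controls the path and its area. -/
theorem rough_control {γ : ℝ} (hγ0 : 0 < γ) (hγ : γ ≤ 1) (P : PathS T x x') {s t : ℝ}
    (hs : 0 ≤ s) (hst : s ≤ t) (ht : t ≤ T) :
    ‖x t - x s‖ ≤ roughNormSmooth l γ T x x' * (t - s) ^ γ ∧
    ‖Yc x x' s t‖ ≤ roughNormSmooth l γ T x x' * ((t - s) ^ γ) ^ 2 := by
  rcases hst.eq_or_lt with rfl | hlt
  · have : Yc x x' s s = 0 := by
      rw [Yc_int P hs le_rfl ht]; simp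
    simp [this, Real.zero_rpow hγ0.ne']
  obtain ⟨L, hL0, hL⟩ := path_bound P
  have pow1 : ∀ a b : ℝ, 0 ≤ a → a < b → b ≤ T → (b - a) ≤ T ^ (1 - γ) * (b - a) ^ γ := by
    intro a b ha hab hb
    have h1 : (b - a) = (b - a) ^ (1 - γ) * (b - a) ^ γ := by
      rw [← Real.rpow_add (by linarith)]; simp
    calc (b - a) = (b - a) ^ (1 - γ) * (b - a) ^ γ := h1
      _ ≤ _ := mul_le_mul_of_nonneg_right
        (Real.rpow_le_rpow (by linarith) (by linarith) (by linarith))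
        (Real.rpow_nonneg (by linarith) _)
  have two : ∀ a b : ℝ, a < b → (b - a) ^ (2 * γ) = ((b - a) ^ γ) ^ 2 := by
    intro a b hab
    rw [mul_comm, Real.rpow_mul (by linarith)]; norm_cast
  set S1 := supENorm 0 T x with hS1
  set S2 := holderENorm γ 0 T x with hS2
  set S3 := ⨆ p : {p : ℝ × ℝ // 0 ≤ p.1 ∧ p.1 < p.2 ∧ p.2 ≤ T},
      ENNReal.ofReal (x2Norm l x x' p.1.1 p.1.2 / (p.1.2 - p.1.1) ^ (2 * γ)) with hS3
  have hR : roughNormSmooth l γ T x x' = (S1 + S2 + S3).toReal := rfl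
  have f1 : S1 ≤ ENNReal.ofReal L := iSup_le fun t => ENNReal.ofReal_le_ofReal (hL t t.2).1
  have f2 : S2 ≤ ENNReal.ofReal (L * T ^ (1 - γ)) := iSup_le fun p => by
    obtain ⟨⟨a, b⟩, h1, h2, h3⟩ := p
    simp only at h1 h2 h3 ⊢
    refine ENNReal.ofReal_le_ofReal ?_
    rw [div_le_iff₀ (Real.rpow_pos_of_pos (by linarith) _), mul_assoc]
    exact (path_lip P hL h1 h2.le h3).1.trans (mul_le_mul_of_nonneg_left (pow1 a b h1 h2 h3) hL0)
  have f3 : S3 ≤ ENNReal.ofReal (L ^ 2 * (T ^ (1 - γ)) ^ 2) := iSup_le fun p => by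
    obtain ⟨⟨a, b⟩, h1, h2, h3⟩ := p
    simp only at h1 h2 h3 ⊢
    refine ENNReal.ofReal_le_ofReal ?_
    rw [div_le_iff₀ (Real.rpow_pos_of_pos (by linarith) _), two a b h2, ← Yc_norm, mul_assoc, ← mul_pow]
    exact (path_lip P hL h1 h2.le h3).2.trans (mul_le_mul_of_nonneg_left
      (pow_le_pow_left₀ (by linarith) (pow1 a b h1 h2 h3) 2) (sq_nonneg _))
  have fin : S1 + S2 + S3 ≠ ⊤ :=
    ENNReal.add_ne_top.2 ⟨ENNReal.add_ne_top.2 ⟨ne_top_of_le_ne_top ENNReal.ofReal_ne_top f1,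
      ne_top_of_le_ne_top ENNReal.ofReal_ne_top f2⟩, ne_top_of_le_ne_top ENNReal.ofReal_ne_top f3⟩
  have tp : (0 : ℝ) < (t - s) ^ γ := Real.rpow_pos_of_pos (by linarith) _
  constructor
  · rw [← div_le_iff₀ tp, hR, ← ENNReal.ofReal_le_iff_le_toReal fin]
    refine le_trans ?_ (le_add_right le_add_self)
    exact le_iSup (fun p : {p : ℝ × ℝ // 0 ≤ p.1 ∧ p.1 < p.2 ∧ p.2 ≤ T} =>
      ENNReal.ofReal (‖x p.1.2 - x p.1.1‖ / (p.1.2 - p.1.1) ^ γ)) ⟨(s, t), hs, hlt, ht⟩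
  · rw [← div_le_iff₀ (pow_pos tp 2), hR, ← ENNReal.ofReal_le_iff_le_toReal fin]
    refine le_trans ?_ le_add_self
    rw [← two s t hlt, Yc_norm]
    exact le_iSup (fun p : {p : ℝ × ℝ // 0 ≤ p.1 ∧ p.1 < p.2 ∧ p.2 ≤ T} =>
      ENNReal.ofReal (x2Norm l x x' p.1.1 p.1.2 / (p.1.2 - p.1.1) ^ (2 * γ))) ⟨(s, t), hs, hlt, ht⟩

theorem drv_of {d : ℕ} {g : Vec d → Vec l →L[ℝ] Vec d} (hd : Differentiable ℝ g) {γ M : ℝ}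
    (hγ0 : 0 < γ) (hγ : γ ≤ 1) (P : PathS T x x') (hM : roughNormSmooth l γ T x x' ≤ M)
    {s h : ℝ} {n : ℕ} (hs : 0 ≤ s) (hh : 0 < h) (hT : s + n * h ≤ T) :
    DrvB M γ h n g (Gc d l g) (fun p q => x (s + q * h) - x (s + p * h))
      (fun p q => Yc x x' (s + p * h) (s + q * h)) := by
  have g0 : ∀ p : ℕ, 0 ≤ s + p * h := fun p => by positivity
  have g1 : ∀ p q : ℕ, p ≤ q → s + p * h ≤ s + q * h := fun p q hpq => by
    have : (p : ℝ) ≤ q := by exact_mod_cast hpq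
    nlinarith
  have g2 : ∀ p : ℕ, p ≤ n → s + p * h ≤ T := fun p hp => (g1 p n hp).trans hT
  have e : ∀ p q : ℕ, s + q * h - (s + p * h) = ((q : ℝ) - p) * h := fun p q => by ring
  refine ⟨hh, fun p u q _ _ _ => by abel, ?_, ?_, ?_⟩
  · intro p u q hpu huq hq z
    rw [Yc_chen P (g0 p) (g1 p u hpu) (g1 u q huq) (g2 q hq), map_add, map_add, Gc_tens hd]
  · intro p q hpq hq
    have := (rough_control hγ0 hγ P (g0 p) (g1 p q hpq) (g2 q hq)).1
    rw [e] at this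
    exact this.trans (mul_le_mul_of_nonneg_right hM (om_nonneg hh hpq))
  · intro p q hpq hq
    have := (rough_control hγ0 hγ P (g0 p) (g1 p q hpq) (g2 q hq)).2
    rw [e] at this
    exact this.trans (mul_le_mul_of_nonneg_right hM (sq_nonneg _))
end

/-- A continuous solution on `[0,T]`. -/
structure SolS {d l : ℕ} (T : ℝ) (g : Vec d → Vec l →L[ℝ] Vec d) (x' : ℝ → Vec l)
    (y : ℝ → Vec d) : Prop where
  cy : ContinuousOn y (Icc 0 T)
  eq : ∀ s t, 0 ≤ s → s ≤ t → t ≤ T → ∫ v in s..t, g (y v) (x' v) = y t - y s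

section
variable {d l : ℕ} {T : ℝ} {g : Vec d → Vec l →L[ℝ] Vec d} {x x' : ℝ → Vec l} {y : ℝ → Vec d}

theorem sol_integrable_s10 {M : ℝ} (hT : 0 < T) (H : CoefB M g (Gc d l g)) (P : PathS T x x')
    {a : Vec d} (hy : OdeSol d l g x' 0 T a y) :
    IntervalIntegrable (fun v => g (y v) (x' v)) volume 0 T := by
  obtain ⟨L, hL0, hL⟩ := path_bound P
  have hgc : Continuous g := H.diff.continuous
  have hM0 : 0 ≤ M := by linarith [H.one_le]
  set f := fun v => g (y v) (x' v) with hf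
  have fb : ∀ v ∈ Icc 0 T, ‖f v‖ ≤ M * L := fun v hv => app_le (H.good.bdd _) (hL v hv).2
  have fc : ∀ s ⊆ Icc 0 T, ContinuousOn y s → ContinuousOn f s := fun s hs h =>
    (hgc.comp_continuousOn h).clm_apply (P.cx'.mono hs)
  set S := {u | u ∈ Icc 0 T ∧ IntervalIntegrable f volume 0 u} with hS
  have h0S : (0 : ℝ) ∈ S := ⟨⟨le_rfl, hT.le⟩, IntervalIntegrable.refl⟩
  have bS : BddAbove S := ⟨T, fun u hu => hu.1.2⟩
  set c := sSup S with hc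
  have hc0 : 0 ≤ c := le_csSup bS h0S
  have hcT : c ≤ T := csSup_le ⟨0, h0S⟩ fun u hu => hu.1.2
  have y1 : ContinuousOn y (Ico 0 c) := by
    intro u hu
    obtain ⟨w, hw, huw⟩ := exists_lt_of_lt_csSup ⟨0, h0S⟩ hu.2
    have cw : ContinuousOn y (Icc 0 w) := by
      have : ContinuousOn (fun u => a + ∫ v in (0:ℝ)..u, f v) (Icc 0 w) := by
        refine continuousOn_const.add ?_
        have := intervalIntegral.continuousOn_primitive_interval' hw.2 (a := 0) left_mem_uIcc
        rwa [uIcc_of_le hw.1.1] at this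
      exact this.congr fun v hv => hy.2 v ⟨hv.1, hv.2.trans hw.1.2⟩
    refine (cw u ⟨hu.1, huw.le⟩).mono_of_mem_nhdsWithin ?_
    refine mem_nhdsWithin.2 ⟨Iio w, isOpen_Iio, huw, fun v hv => ⟨hv.2.1, le_of_lt hv.1⟩⟩
  have y2 : ContinuousOn y (Ioc c T) := by
    refine (continuousOn_const (c := a)).congr fun u hu => ?_
    have hu0 : u ∈ Icc 0 T := ⟨by linarith [hu.1], hu.2⟩
    rw [hy.2 u hu0, intervalIntegral.integral_undef, add_zero]
    intro hi
    exact absurd (le_csSup bS (⟨hu0, hi⟩ : u ∈ S)) (not_le.2 hu.1)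
  have m1 := (fc _ (fun u hu => ⟨hu.1, hu.2.le.trans hcT⟩) y1).aestronglyMeasurable
    (μ := volume) measurableSet_Ico
  have m2 := (fc _ (fun u hu => ⟨hc0.trans hu.1.le, hu.2⟩) y2).aestronglyMeasurable
    (μ := volume) measurableSet_Ioc
  have m3 : AEStronglyMeasurable f (volume.restrict {c}) := by
    rw [Measure.restrict_singleton]; simp
  have m4 := aestronglyMeasurable_union_iff.2 ⟨aestronglyMeasurable_union_iff.2 ⟨m1, m2⟩, m3⟩
  have sub : Ioc 0 T ⊆ (Ico 0 c ∪ Ioc c T) ∪ {c} := by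
    intro u hu
    rcases lt_trichotomy u c with h | h | h
    · exact Or.inl (Or.inl ⟨hu.1.le, h⟩)
    · exact Or.inr h
    · exact Or.inl (Or.inr ⟨h, hu.2⟩)
  have m5 := m4.mono_measure (Measure.restrict_mono sub le_rfl)
  rw [intervalIntegrable_iff_integrableOn_Ioc_of_le hT.le]
  refine Integrable.of_bound m5 (M * L) ?_
  exact (ae_restrict_iff' measurableSet_Ioc).2 (Filter.Eventually.of_forall fun v hv =>
    fb v ⟨hv.1.le, hv.2⟩)

theorem solS_of {M : ℝ} (hT : 0 < T) (H : CoefB M g (Gc d l g)) (P : PathS T x x')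
    {a : Vec d} (hy : OdeSol d l g x' 0 T a y) : SolS T g x' y := by
  have hi := sol_integrable_s10 hT H P hy
  refine ⟨?_, fun s t hs hst ht => ?_⟩
  · have : ContinuousOn (fun u => a + ∫ v in (0:ℝ)..u, g (y v) (x' v)) (Icc 0 T) := by
      refine continuousOn_const.add ?_
      have := intervalIntegral.continuousOn_primitive_interval' hi (a := 0) left_mem_uIcc
      rwa [uIcc_of_le hT.le] at this
    exact this.congr fun v hv => hy.2 v hv
  · have j : ∀ u, 0 ≤ u → u ≤ T → IntervalIntegrable (fun v => g (y v) (x' v)) volume 0 u :=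
      fun u h1 h2 => hi.mono_set (by
        rw [uIcc_of_le h1, uIcc_of_le hT.le]; exact Icc_subset_Icc le_rfl h2)
    rw [hy.2 s ⟨hs, hst.trans ht⟩, hy.2 t ⟨hs.trans hst, ht⟩, add_sub_add_left_eq_sub,
      intervalIntegral.integral_interval_sub_left (j t (hs.trans hst) ht) (j s hs (hst.trans ht))]

theorem int_le {E : Type*} [NormedAddCommGroup E] [NormedSpace ℝ E] (P : PathS T x x')
    {s t v C : ℝ} (hs : 0 ≤ s) (hsv : s ≤ v) (hvt : v ≤ t) (ht : t ≤ T) (hC : 0 ≤ C) {f : ℝ → E}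
    (hf : ∀ w, s ≤ w → w ≤ v → ‖f w‖ ≤ C * ‖x' w‖) :
    ‖∫ w in s..v, f w‖ ≤ C * ∫ w in s..t, ‖x' w‖ := by
  have i1 := ii_of P.cx'.norm hs hsv (hvt.trans ht)
  refine (intervalIntegral.norm_integral_le_of_norm_le hsv
    (Filter.Eventually.of_forall fun w hw => hf w hw.1.le hw.2) (i1.const_mul C)).trans ?_
  rw [intervalIntegral.integral_const_mul]
  refine mul_le_mul_of_nonneg_left ?_ hC
  exact intervalIntegral.integral_mono_interval le_rfl hsv hvt
    (Filter.Eventually.of_forall fun w => norm_nonneg _) (ii_of P.cx'.norm hs (hsv.trans hvt) ht)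

theorem local_err {M : ℝ} (H : CoefB M g (Gc d l g)) (P : PathS T x x') (hy : SolS T g x' y)
    {s t : ℝ} (hs : 0 ≤ s) (hst : s ≤ t) (ht : t ≤ T) :
    ‖Jf g (Gc d l g) (y s) (y t) (x t - x s) (Yc x x' s t)‖ ≤
      2 * M ^ 3 * (∫ u in s..t, ‖x' u‖) ^ 3 := by
  have hM0 : 0 ≤ M := by linarith [H.one_le]
  have hgc : Continuous g := H.diff.continuous
  set m := ∫ u in s..t, ‖x' u‖ with hm
  have hm0 : 0 ≤ m := intervalIntegral.integral_nonneg hst fun u _ => norm_nonneg _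
  have c1 : ContinuousOn (fun v => g (y v) (x' v)) (Icc 0 T) :=
    (hgc.comp_continuousOn hy.cy).clm_apply P.cx'
  have c2 : ContinuousOn (fun v => g (y s) (x' v)) (Icc 0 T) :=
    (g (y s)).continuous.comp_continuousOn P.cx'
  have c3 : ContinuousOn (fun v => fderiv ℝ g (y s) (g (y s) (x v - x s)) (x' v)) (Icc 0 T) :=
    ((fderiv ℝ g (y s)).continuous.comp_continuousOn ((g (y s)).continuous.comp_continuousOn
      (P.cx.sub continuousOn_const))).clm_apply P.cx'
  have eg : ∀ v, s ≤ v → v ≤ t → g (y s) (x v - x s) = ∫ w in s..v, g (y s) (x' w) := by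
    intro v h1 h2
    rw [← P.ftc s v hs h1 (h2.trans ht),
      (g (y s)).intervalIntegral_comp_comm (ii_of P.cx' hs h1 (h2.trans ht))]
  have hyv : ∀ v, s ≤ v → v ≤ t → ‖y v - y s‖ ≤ M * m := by
    intro v h1 h2
    rw [← hy.eq s v hs h1 (h2.trans ht)]
    exact int_le P hs h1 h2 ht hM0 fun w _ _ => app_le (H.good.bdd _) le_rfl
  have hr : ∀ v, s ≤ v → v ≤ t → ‖y v - y s - g (y s) (x v - x s)‖ ≤ M * (M * m) * m := by
    intro v h1 h2
    rw [eg v h1 h2, ← hy.eq s v hs h1 (h2.trans ht), ← intervalIntegral.integral_sub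
      (ii_of c1 hs h1 (h2.trans ht)) (ii_of c2 hs h1 (h2.trans ht))]
    refine int_le P hs h1 h2 ht (by positivity) fun w hw1 hw2 => ?_
    rw [← sub_apply]
    exact app_le ((H.good.lip _ _).trans
      (mul_le_mul_of_nonneg_left (hyv w hw1 (hw2.trans h2)) hM0)) le_rfl
  have eJ : Jf g (Gc d l g) (y s) (y t) (x t - x s) (Yc x x' s t) =
      ∫ v in s..t, (tayF g (y s) (y v) + fderiv ℝ g (y s) (y v - y s - g (y s) (x v - x s))) (x' v) := by
    rw [Jf, Gc_Yc_int H.diff P _ hs hst ht, eg t hst le_rfl, ← hy.eq s t hs hst ht,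
      ← intervalIntegral.integral_sub (ii_of c1 hs hst ht) (ii_of c2 hs hst ht),
      ← intervalIntegral.integral_sub ((ii_of c1 hs hst ht).sub (ii_of c2 hs hst ht))
        (ii_of c3 hs hst ht)]
    refine intervalIntegral.integral_congr fun v _ => ?_
    simp only [tayF, map_sub, add_apply, sub_apply]
    abel
  rw [eJ]
  refine (int_le (C := 2 * M ^ 3 * m ^ 2) P hs hst le_rfl ht (by positivity)
    fun w h1 h2 => app_le ?_ le_rfl).trans_eq (by rw [← hm]; ring)
  refine (norm_add_le _ _).trans ?_
  have b1 := tayF_le H.diff H.goodD (y s) (y w)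
  have b2 := app_le (H.goodD.bdd (y s)) (hr w h1 h2)
  have b3 : M * ‖y w - y s‖ ^ 2 ≤ M * (M * m) ^ 2 :=
    mul_le_mul_of_nonneg_left (pow_le_pow_left₀ (norm_nonneg _) (hyv w h1 h2) 2) hM0
  linarith

theorem davie {M γ s₀ A : ℝ} (hγ0 : 0 < γ) (hγ : γ ≤ 1) (H : CoefB M g (Gc d l g))
    (hap : ∀ (h : ℝ) (n : ℕ) (X : ℕ → ℕ → Vec l) (Y : ℕ → ℕ → EuclideanSpace ℝ (Fin l × Fin l)),
      DrvB M γ h n g (Gc d l g) X Y →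
      ∀ (w : ℕ → Vec d) (p q : ℕ), p ≤ q → q ≤ n → om γ h p q ≤ s₀ →
      ‖Jf g (Gc d l g) (w p) (w q) (X p q) (Y p q)‖ ≤ A * om γ h p q ^ 3 +
        2 * ∑ k ∈ Finset.Ico p q,
          ‖Jf g (Gc d l g) (w k) (w (k + 1)) (X k (k + 1)) (Y k (k + 1))‖)
    (P : PathS T x x') (hR : roughNormSmooth l γ T x x' ≤ M) (hy : SolS T g x' y)
    {s t : ℝ} (hs : 0 ≤ s) (hst : s < t) (ht : t ≤ T) (hsm : (t - s) ^ γ ≤ s₀) :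
    ‖Jf g (Gc d l g) (y s) (y t) (x t - x s) (Yc x x' s t)‖ ≤ A * ((t - s) ^ γ) ^ 3 := by
  obtain ⟨L, hL0, hL⟩ := path_bound P
  have hM0 : 0 ≤ M := by linarith [H.one_le]
  set K := 2 * (2 * M ^ 3 * (L * (t - s)) ^ 3) with hK
  have hK0 : 0 ≤ K := by
    have : 0 ≤ t - s := by linarith
    positivity
  have main : ∀ m : ℕ, ‖Jf g (Gc d l g) (y s) (y t) (x t - x s) (Yc x x' s t)‖ ≤
      A * ((t - s) ^ γ) ^ 3 + K * (1 / ((m : ℝ) + 1)) := by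
    intro m
    set n := m + 1 with hn
    have hn0 : (0 : ℝ) < n := by positivity
    have hn1 : (1 : ℝ) ≤ n := by rw [hn]; push_cast; linarith [(Nat.cast_nonneg m : (0:ℝ) ≤ m)]
    set h := (t - s) / n with hh
    have hpos : 0 < h := div_pos (by linarith) hn0
    have enh : (n : ℝ) * h = t - s := by rw [hh]; field_simp
    have D := drv_of (n := n) H.diff hγ0 hγ P hR hs hpos (by rw [enh]; linarith)
    have eom : om γ h 0 n = (t - s) ^ γ := by
      unfold om; rw [← enh]; simp
    have key := hap h n _ _ D (fun k => y (s + k * h)) 0 n (Nat.zero_le _) le_rfl (by rwa [eom])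
    have est : s + (n : ℝ) * h = t := by rw [enh]; ring
    simp only [eom, est, Nat.cast_zero, zero_mul, add_zero] at key
    refine key.trans (add_le_add le_rfl ?_)
    have each : ∀ k ∈ Finset.Ico 0 n, ‖Jf g (Gc d l g) (y (s + k * h)) (y (s + (k + 1 : ℕ) * h))
        (x (s + (k + 1 : ℕ) * h) - x (s + k * h)) (Yc x x' (s + k * h) (s + (k + 1 : ℕ) * h))‖ ≤
        2 * M ^ 3 * (L * h) ^ 3 := by
      intro k hk
      have hkn : ((k + 1 : ℕ) : ℝ) ≤ n := by exact_mod_cast (Finset.mem_Ico.1 hk).2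
      have a0 : 0 ≤ s + k * h := by positivity
      have a1 : s + k * h ≤ s + (k + 1 : ℕ) * h := by push_cast; nlinarith
      have a2 : s + (k + 1 : ℕ) * h ≤ T := by
        have := mul_le_mul_of_nonneg_right hkn hpos.le
        linarith
      refine (local_err H P hy a0 a1 a2).trans ?_
      have a3 : 0 ≤ ∫ u in (s + k * h)..(s + (k + 1 : ℕ) * h), ‖x' u‖ :=
        intervalIntegral.integral_nonneg a1 fun u _ => norm_nonneg _
      have a4 : ∫ u in (s + k * h)..(s + (k + 1 : ℕ) * h), ‖x' u‖ ≤ L * h := by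
        have := intervalIntegral.norm_integral_le_of_norm_le_const (C := L) (f := fun u => ‖x' u‖)
          (a := s + k * h) (b := s + (k + 1 : ℕ) * h) fun u hu => by
            rw [uIoc_of_le a1] at hu
            rw [norm_norm]
            exact (hL u ⟨by linarith [hu.1], by linarith [hu.2]⟩).2
        refine (le_abs_self _).trans (this.trans_eq ?_)
        rw [abs_of_nonneg (by linarith)]; push_cast; ring
      exact mul_le_mul_of_nonneg_left (pow_le_pow_left₀ a3 a4 3) (by positivity)
    have sum := Finset.sum_le_sum each
    rw [Finset.sum_const, Nat.card_Ico, nsmul_eq_mul, Nat.sub_zero] at sum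
    have fin : (n : ℝ) * (2 * M ^ 3 * (L * h) ^ 3) = (2 * M ^ 3 * (L * (t - s)) ^ 3) * (1 / (n : ℝ) ^ 2) := by
      rw [hh]; field_simp
    have fin2 : 1 / (n : ℝ) ^ 2 ≤ 1 / (n : ℝ) :=
      one_div_le_one_div_of_le hn0 (by nlinarith)
    have en : (m : ℝ) + 1 = n := by rw [hn]; push_cast; rfl
    rw [en]
    have fin3 := mul_le_mul_of_nonneg_left fin2 hK0
    rw [fin] at sum
    calc _ ≤ 2 * (2 * M ^ 3 * (L * (t - s)) ^ 3 * (1 / (n : ℝ) ^ 2)) :=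
          mul_le_mul_of_nonneg_left sum (by norm_num)
      _ = K * (1 / (n : ℝ) ^ 2) := by rw [hK]; ring
      _ ≤ _ := fin3
  have lim : Filter.Tendsto (fun m : ℕ => A * ((t - s) ^ γ) ^ 3 + K * (1 / ((m : ℝ) + 1)))
      Filter.atTop (nhds (A * ((t - s) ^ γ) ^ 3 + K * 0)) :=
    (tendsto_one_div_add_atTop_nhds_zero_nat.const_mul K).const_add _
  rw [mul_zero, add_zero] at lim
  exact ge_of_tendsto' lim main
end

theorem level_bound (d l : ℕ) (γ T : ℝ) (hγ1 : 1 / 3 < γ) (hγ2 : γ ≤ 1) (hT : 0 < T)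
    (g : Vec d → Vec l →L[ℝ] Vec d) (hg : IsC3Bounded g) (R : ℕ) :
    ∃ c : ℝ, 0 ≤ c ∧
      ∀ x x' : ℝ → Vec l, PiecewiseC1 l T x x' → roughNormSmooth l γ T x x' ≤ R →
      ∀ (a : Vec d) (n : ℕ), 0 < n →
      ∀ z : ℕ → Vec d, z 0 = a →
        (∀ k < n, z (k + 1) =
          Psi d l g x x' ((k : ℝ) * T / n) (((k : ℝ) + 1) * T / n) (z k)) →
      ∀ y : ℝ → Vec d, OdeSol d l g x' 0 T a y →
      ∀ p q : ℕ, p ≤ q → q ≤ n →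
        ‖(y ((q : ℝ) * T / n) - z q) - (y ((p : ℝ) * T / n) - z p)‖ ≤
          c * ((∑ k ∈ Finset.Ico p q,
                (∫ u in ((k : ℝ) * T / n)..(((k : ℝ) + 1) * T / n), ‖x' u‖) ^ 3) +
              ((q : ℝ) * T / n - (p : ℝ) * T / n) ^ γ * ‖y ((p : ℝ) * T / n) - z p‖) := by
  obtain ⟨M₀, H₀⟩ := coef_exists hg
  have hγ0 : 0 < γ := by linarith
  set M := max M₀ (R : ℝ) with hM
  have H : CoefB M g (Gc d l g) := H₀.mono (le_max_left _ _)
  have hM1 := H.one_le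
  obtain ⟨s₀, hs0, hs1, A, hA, hap⟩ := apriori hγ1 H
  obtain ⟨C, hC, hD⟩ := discrete_main (T := T) hγ1 hT hs0 hA H
  refine ⟨C * (2 * M ^ 3 + 1), by positivity, ?_⟩
  intro x x' hx hR a n hn z hz0 hz y hy p q hpq hqn
  have P := pathS_of hx
  have S := solS_of hT H P hy
  have hRM : roughNormSmooth l γ T x x' ≤ M := hR.trans (le_max_right _ _)
  have hn0 : (0 : ℝ) < n := by exact_mod_cast hn
  set h := T / n with hh
  have hpos : 0 < h := div_pos hT hn0
  have enh : (n : ℝ) * h = T := by rw [hh]; field_simp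
  have et : ∀ r : ℝ, r * T / n = r * h := fun r => by rw [hh]; ring
  simp only [et] at hz ⊢
  have D := drv_of (n := n) H.diff hγ0 hγ2 P hRM le_rfl hpos (by rw [enh]; linarith)
  simp only [zero_add] at D
  have g1 : ∀ p q : ℕ, p ≤ q → (p : ℝ) * h ≤ q * h := fun p q hpq =>
    mul_le_mul_of_nonneg_right (by exact_mod_cast hpq) hpos.le
  have g2 : ∀ p : ℕ, p ≤ n → (p : ℝ) * h ≤ T := fun p hp => (g1 p n hp).trans enh.le
  have eom : ∀ p q : ℕ, om γ h p q = ((q : ℝ) * h - p * h) ^ γ := fun p q => by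
    unfold om; rw [sub_mul]
  have key := hD h n _ _ enh.le D (fun k => y (k * h)) z ?_ ?_ p q hpq hqn
  · refine key.trans ?_
    rw [eom, mul_assoc]
    refine mul_le_mul_of_nonneg_left ?_ hC
    have hsum : ∑ k ∈ Finset.Ico p q, ‖Jf g (Gc d l g) (y (k * h)) (y ((k + 1 : ℕ) * h))
        (x ((k + 1 : ℕ) * h) - x (k * h)) (Yc x x' (k * h) ((k + 1 : ℕ) * h))‖ ≤
        2 * M ^ 3 * ∑ k ∈ Finset.Ico p q, (∫ u in ((k : ℝ) * h)..(((k : ℝ) + 1) * h), ‖x' u‖) ^ 3 := by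
      rw [Finset.mul_sum]
      refine Finset.sum_le_sum fun k hk => ?_
      have hk' := Finset.mem_Ico.1 hk
      have := local_err H P S (s := (k : ℝ) * h) (t := ((k + 1 : ℕ) : ℝ) * h) (by positivity)
        (g1 _ _ (Nat.le_succ _)) (g2 _ (by omega))
      rw [Nat.cast_succ] at this ⊢
      exact this
    have n1 : 0 ≤ ∑ k ∈ Finset.Ico p q, (∫ u in ((k : ℝ) * h)..(((k : ℝ) + 1) * h), ‖x' u‖) ^ 3 :=
      Finset.sum_nonneg fun k _ => pow_nonneg (intervalIntegral.integral_nonneg (by nlinarith)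
        fun u _ => norm_nonneg _) 3
    have n2 : 0 ≤ ((q : ℝ) * h - p * h) ^ γ * ‖y (p * h) - z p‖ :=
      mul_nonneg (Real.rpow_nonneg (by linarith [g1 p q hpq]) _) (norm_nonneg _)
    have n3 : 0 ≤ 2 * M ^ 3 * (((q : ℝ) * h - p * h) ^ γ * ‖y (p * h) - z p‖) := by positivity
    linarith
  · intro k hk
    rw [Jf, hz k hk, Psi_eq, Nat.cast_succ]
    abel
  · intro p q hpq hqn hom
    rw [eom] at hom ⊢
    rcases hpq.eq_or_lt with rfl | hlt
    · have : Yc x x' (p * h) (p * h) = 0 := by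
        rw [Yc_int P (by positivity) le_rfl (g2 p hqn)]; simp
      simp [Jf, this, Real.zero_rpow hγ0.ne']
    · have hl : (p : ℝ) * h < q * h := mul_lt_mul_of_pos_right (by exact_mod_cast hlt) hpos
      exact davie hγ0 hγ2 H hap P hRM S (by positivity) hl (g2 q hqn) hom

/-- **Global error bound for the second-order Taylor (Milstein) scheme for ODEs driven by a
smooth path.** With `t_k = kT/n`, `y` the exact solution started at `a`, `z` the scheme
`z_{k+1} = Ψ(z_k; t_k, t_{k+1})`, `z_0 = a`, and `M^x_{st} = (∫_s^t |ẋ_u| du)³`, there is a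
nondecreasing `C̃_T : ℝ → [0,∞)`, depending only on `T, g, γ, d, l`, such that for all
`0 ≤ p < q ≤ n`:
`|y_{t_q} - z_q| ≤ C̃_T(‖x‖_{γ,rough}) ∑_{k<q} M^x_{t_k t_{k+1}}` and
`|(y_{t_q} - z_q) - (y_{t_p} - z_p)| ≤ C̃_T(‖x‖_{γ,rough}) (∑_{k=p}^{q-1} M^x_{t_k t_{k+1}}
+ (t_q - t_p)^γ ∑_{k<p} M^x_{t_k t_{k+1}})`. -/
theorem milstein_global_error (d l : ℕ) (γ T : ℝ) (hγ1 : 1 / 3 < γ) (hγ2 : γ ≤ 1) (hT : 0 < T)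
    (g : Vec d → Vec l →L[ℝ] Vec d) (hg : IsC3Bounded g) :
    ∃ C : ℝ → ℝ, (∀ r : ℝ, 0 ≤ C r) ∧ Monotone C ∧
      ∀ x x' : ℝ → Vec l, PiecewiseC1 l T x x' →
      ∀ (a : Vec d) (n : ℕ), 0 < n →
      ∀ z : ℕ → Vec d, z 0 = a →
        (∀ k < n, z (k + 1) =
          Psi d l g x x' ((k : ℝ) * T / n) (((k : ℝ) + 1) * T / n) (z k)) →
      ∀ y : ℝ → Vec d, OdeSol d l g x' 0 T a y →
      ∀ p q : ℕ, p < q → q ≤ n →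
        ‖y ((q : ℝ) * T / n) - z q‖ ≤
          C (roughNormSmooth l γ T x x') *
            ∑ k ∈ Finset.range q,
              (∫ u in ((k : ℝ) * T / n)..(((k : ℝ) + 1) * T / n), ‖x' u‖) ^ 3 ∧
        ‖(y ((q : ℝ) * T / n) - z q) - (y ((p : ℝ) * T / n) - z p)‖ ≤
          C (roughNormSmooth l γ T x x') *
            ((∑ k ∈ Finset.Ico p q,
                (∫ u in ((k : ℝ) * T / n)..(((k : ℝ) + 1) * T / n), ‖x' u‖) ^ 3) +
              ((q : ℝ) * T / n - (p : ℝ) * T / n) ^ γ *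
                ∑ k ∈ Finset.range p,
                  (∫ u in ((k : ℝ) * T / n)..(((k : ℝ) + 1) * T / n), ‖x' u‖) ^ 3) := by
  choose c hc0 hc using level_bound d l γ T hγ1 hγ2 hT g hg
  have hnn : ∀ i, 0 ≤ c i + c i ^ 2 := fun i => by have := hc0 i; positivity
  refine ⟨fun r => ∑ i ∈ Finset.range (⌈r⌉₊ + 1), (c i + c i ^ 2),
    fun r => Finset.sum_nonneg fun i _ => hnn i, fun r r' hr => ?_, ?_⟩
  · exact Finset.sum_le_sum_of_subset_of_nonneg
      (Finset.range_mono (Nat.succ_le_succ (Nat.ceil_mono hr))) fun i _ _ => hnn i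
  intro x x' hx a n hn z hz0 hz y hy p q hpq hqn
  set r := roughNormSmooth l γ T x x' with hr
  have hb := hc ⌈r⌉₊ x x' hx (Nat.le_ceil r) a n hn z hz0 hz y hy
  set K := c ⌈r⌉₊ with hK
  have hK0 : 0 ≤ K := hc0 _
  have hC : K + K ^ 2 ≤ ∑ i ∈ Finset.range (⌈r⌉₊ + 1), (c i + c i ^ 2) :=
    Finset.single_le_sum (f := fun i => c i + c i ^ 2) (fun i _ => hnn i)
      (Finset.self_mem_range_succ _)
  have hn0 : (0 : ℝ) < n := by exact_mod_cast hn
  have nonneg : ∀ k : ℕ, 0 ≤ (∫ u in ((k : ℝ) * T / n)..(((k : ℝ) + 1) * T / n), ‖x' u‖) ^ 3 :=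
    fun k => pow_nonneg (intervalIntegral.integral_nonneg
      (by gcongr; linarith) fun u _ => norm_nonneg _) 3
  set m : ℕ → ℝ := fun k => (∫ u in ((k : ℝ) * T / n)..(((k : ℝ) + 1) * T / n), ‖x' u‖) ^ 3 with hm
  have e0 : y 0 - z 0 = 0 := by rw [hz0, hy.1, sub_self]
  have one : ∀ j ≤ n, ‖y ((j : ℝ) * T / n) - z j‖ ≤ K * ∑ k ∈ Finset.range j, m k := by
    intro j hj
    have := hb 0 j (Nat.zero_le _) hj
    simp only [Nat.cast_zero, zero_mul, zero_div, e0, norm_zero, mul_zero, add_zero, sub_zero,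
      ← Finset.range_eq_Ico] at this
    exact this
  have hS : ∀ s : Finset ℕ, 0 ≤ ∑ k ∈ s, m k := fun s => Finset.sum_nonneg fun k _ => nonneg k
  constructor
  · refine (one q hqn).trans (mul_le_mul_of_nonneg_right (le_trans ?_ hC) (hS _))
    linarith [sq_nonneg K]
  · refine (hb p q hpq.le hqn).trans ?_
    have w0 : 0 ≤ ((q : ℝ) * T / n - (p : ℝ) * T / n) ^ γ := by
      refine Real.rpow_nonneg (sub_nonneg.2 ?_) _
      have : (p : ℝ) ≤ q := by exact_mod_cast hpq.le
      gcongr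
    set w := ((q : ℝ) * T / n - (p : ℝ) * T / n) ^ γ with hw
    have h1 := mul_le_mul_of_nonneg_left (one p (hpq.le.trans hqn)) w0
    have h2 := hS (Finset.Ico p q)
    have h3 := mul_nonneg w0 (hS (Finset.range p))
    refine le_trans ?_ (mul_le_mul_of_nonneg_right hC (add_nonneg h2 h3))
    have h4 := mul_le_mul_of_nonneg_left h1 hK0
    have h5 := mul_nonneg (sq_nonneg K) h2
    have h6 := mul_nonneg hK0 h3
    simp only [hm] at h2 h3 h4 h5 h6 ⊢
    linarith


end
end
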